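/- (Chowla–Selberg formula) Let D < 0 be the fundamental discriminant of an imaginary quadratic field K, let Z_D be the set of CM points of discriminant D in ℍ, on which PSL(2,ℤ) acts with finitely many orbits, and set w(D) = 6 if D = −3, w(D) = 4 if D = −4, w(D) = 2 if D < −4. Then, with Φ(τ) = Im(τ)·|η(τ)|⁴ (which is PSL(2,ℤ)-invariant) and χ_D(j) the Kronecker symbol (D|j), one has ∏_{z ∈ PSL(2,ℤ)\Z_D} (4π √|D| Φ(z))^{2/w(D)} = ∏_{j=1}^{|D|−1} Γ(j/|D|)^{χ_D(j)}, the first product taken over any set of orbit representatives. -/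

import Mathlib

open Complex

noncomputable section

/-- `e^{2πiτs}`, i.e. `q^s` for `q = e^{2πiτ}`. -/
def qp (τ s : ℂ) : ℂ := Complex.exp (2 * (Real.pi : ℂ) * Complex.I * τ * s)

/-- Dedekind eta function `η(τ) = q^{1/24} ∏_{n≥1}(1 − qⁿ)`. -/
def etaDedekind (τ : ℂ) : ℂ :=
  Complex.exp ((Real.pi : ℂ) * Complex.I * τ / 12) * ∏' n : ℕ, (1 - qp τ ((n : ℂ) + 1))

/-- `Φ(τ) = Im(τ)·|η(τ)|⁴` (a `PSL(2,ℤ)`-invariant function). -/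
def Phi (τ : ℂ) : ℝ := τ.im * ‖etaDedekind τ‖ ^ 4

abbrev SL2Z := Matrix.SpecialLinearGroup (Fin 2) ℤ

/-- Möbius action of `SL(2,ℤ)`: `γ·τ = (aτ+b)/(cτ+d)`. -/
def acts (γ : SL2Z) (τ : ℂ) : ℂ :=
  ((γ.1 0 0 : ℂ) * τ + (γ.1 0 1 : ℂ)) / ((γ.1 1 0 : ℂ) * τ + (γ.1 1 1 : ℂ))

/-- `z` and `w` lie in the same `PSL(2,ℤ)`-orbit. -/
def SLrel (z w : ℂ) : Prop := ∃ γ : SL2Z, w = acts γ z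

/-- A CM point of discriminant `D`: `z ∈ ℍ` with `az² + bz + c = 0` for integers
`a > 0`, `b`, `c` with `gcd(a,b,c) = 1` and `b² − 4ac = D`. -/
def IsCMPoint (D : ℤ) (z : ℂ) : Prop :=
  0 < z.im ∧ ∃ a b c : ℤ, 0 < a ∧ Int.gcd (Int.gcd a b : ℤ) c = 1 ∧
    b ^ 2 - 4 * a * c = D ∧ (a : ℂ) * z ^ 2 + (b : ℂ) * z + (c : ℂ) = 0

/-- `R` is a set of representatives for the `PSL(2,ℤ)`-orbits on the set of CM points
of discriminant `D`. -/
def IsRepSet (D : ℤ) (R : Finset ℂ) : Prop :=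
  (∀ z ∈ R, IsCMPoint D z) ∧
  ∀ z : ℂ, IsCMPoint D z → ∃! w : ℂ, w ∈ R ∧ SLrel z w

/-- `w(D)`: `6` if `D = −3`, `4` if `D = −4`, `2` if `D < −4`. -/
def wD (D : ℤ) : ℕ := if D = -3 then 6 else if D = -4 then 4 else 2

/-- Kronecker symbol at `2`. -/
def kron2 (D : ℤ) : ℤ :=
  if D % 2 = 0 then 0 else if D % 8 = 1 ∨ D % 8 = 7 then 1 else -1

/-- Kronecker symbol `(D | n)` for `n : ℕ`, defined via the Jacobi symbol on the odd
part of `n`. -/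
def kron (D : ℤ) (n : ℕ) : ℤ :=
  kron2 D ^ (n.factorization 2) * jacobiSym D (n / 2 ^ (n.factorization 2))

/-- Fundamental discriminant. -/
def IsFundamentalDiscriminant (D : ℤ) : Prop :=
  (D % 4 = 1 ∧ Squarefree D) ∨
  (D % 4 = 0 ∧ Squarefree (D / 4) ∧ (D / 4 % 4 = 2 ∨ D / 4 % 4 = 3))


/-! ### Part A: the derivative of the Hurwitz zeta function at `0` (Lerch's formula) -/

lemma hasDerivAt_shift_cpow (x : ℝ) (s : ℂ) (u : ℝ) (h : 0 < x + u) :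
    HasDerivAt (fun u : ℝ => ((x + u : ℝ) : ℂ) ^ s) (s * ((x + u : ℝ) : ℂ) ^ (s - 1)) u := by
  have h1 : HasDerivAt (fun u : ℝ => ((x + u : ℝ) : ℂ)) 1 u := by
    have := ((hasDerivAt_id u).const_add x).ofReal_comp
    simpa using this
  have h2 : HasDerivAt (fun w : ℂ => w ^ s) (s * ((x + u : ℝ) : ℂ) ^ (s - 1) * 1)
      ((x + u : ℝ) : ℂ) := by
    have := (hasDerivAt_id ((x + u : ℝ) : ℂ)).cpow_const (c := s) (by
      left; simpa using h)
    simpa using this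
  have h3 := h2.scomp u h1
  simp only [one_smul, mul_one] at h3
  exact h3

lemma norm_shift_cpow_le (x u r : ℝ) (s : ℂ) (hx : 1 ≤ x) (hu : 0 ≤ u) (hr : -1 < r)
    (hs : r ≤ s.re) : ‖((x + u : ℝ) : ℂ) ^ (-s - 2)‖ ≤ x ^ (-r - 2) := by
  rw [Complex.norm_cpow_eq_rpow_re_of_pos (by linarith)]
  calc (x + u) ^ (-s - 2).re ≤ (x + u) ^ (-r - 2) := by
        apply Real.rpow_le_rpow_of_exponent_le (by linarith)
        simp; linarith
    _ ≤ x ^ (-r - 2) :=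
        Real.rpow_le_rpow_of_nonpos (by linarith) (by linarith) (by linarith)

lemma lerch_bound (x a r : ℝ) (s : ℂ) (hx : 1 ≤ x) (ha0 : 0 ≤ a) (ha1 : a ≤ 1) (hr : -1 < r)
    (hs : r ≤ s.re) :
    ‖((x + a : ℝ) : ℂ) ^ (-s) - (x : ℂ) ^ (-s) + s * a * (x : ℂ) ^ (-s - 1)‖
      ≤ ‖s‖ * ‖s + 1‖ * x ^ (-r - 2) := by
  have hC : 0 ≤ ‖s + 1‖ * x ^ (-r - 2) := by positivity
  -- first order estimate
  have h1 : ∀ u ∈ Set.Icc (0 : ℝ) 1,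
      ‖((x + u : ℝ) : ℂ) ^ (-s - 1) - (x : ℂ) ^ (-s - 1)‖ ≤ ‖s + 1‖ * x ^ (-r - 2) := by
    intro u hu
    have := Convex.norm_image_sub_le_of_norm_hasDerivWithin_le (𝕜 := ℝ)
      (f := fun u : ℝ => ((x + u : ℝ) : ℂ) ^ (-s - 1))
      (f' := fun u : ℝ => (-s - 1) * ((x + u : ℝ) : ℂ) ^ (-s - 1 - 1))
      (s := Set.Icc (0 : ℝ) 1) (x := 0) (y := u) (C := ‖s + 1‖ * x ^ (-r - 2))
      (fun v hv => (hasDerivAt_shift_cpow x _ v (by linarith [hv.1])).hasDerivWithinAt)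
      (fun v hv => by
        rw [norm_mul, show (-s - 1 : ℂ) = -(s + 1) by ring, norm_neg,
          show (-(s + 1) - 1 : ℂ) = -s - 2 by ring]
        gcongr
        exact norm_shift_cpow_le x v r s hx hv.1 hr hs)
      (convex_Icc 0 1) ⟨le_rfl, zero_le_one⟩ hu
    simp only [add_zero, sub_zero] at this
    refine this.trans ?_
    rw [Real.norm_of_nonneg hu.1]
    exact mul_le_of_le_one_right hC hu.2
  have h2 := Convex.norm_image_sub_le_of_norm_hasDerivWithin_le (𝕜 := ℝ)
      (f := fun u : ℝ => ((x + u : ℝ) : ℂ) ^ (-s) + s * u * (x : ℂ) ^ (-s - 1))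
      (f' := fun u : ℝ => (-s) * ((x + u : ℝ) : ℂ) ^ (-s - 1) + s * (x : ℂ) ^ (-s - 1))
      (s := Set.Icc (0 : ℝ) 1) (x := 0) (y := a) (C := ‖s‖ * (‖s + 1‖ * x ^ (-r - 2)))
      (fun v hv => by
        apply HasDerivAt.hasDerivWithinAt
        apply (hasDerivAt_shift_cpow x _ v (by linarith [hv.1])).add
        have := ((hasDerivAt_id v).ofReal_comp.const_mul s).mul_const ((x : ℂ) ^ (-s - 1))
        simpa using this)
      (fun v hv => by
        rw [show (-s) * ((x + v : ℝ) : ℂ) ^ (-s - 1) + s * (x : ℂ) ^ (-s - 1) =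
          -s * (((x + v : ℝ) : ℂ) ^ (-s - 1) - (x : ℂ) ^ (-s - 1)) by ring, norm_mul, norm_neg]
        gcongr
        exact h1 v hv)
      (convex_Icc 0 1) ⟨le_rfl, zero_le_one⟩ ⟨ha0, ha1⟩
  simp only [add_zero, sub_zero, ofReal_zero, mul_zero, zero_mul] at h2
  rw [show ((x + a : ℝ) : ℂ) ^ (-s) - (x : ℂ) ^ (-s) + s * a * (x : ℂ) ^ (-s - 1) =
    ((x + a : ℝ) : ℂ) ^ (-s) + s * a * (x : ℂ) ^ (-s - 1) - (x : ℂ) ^ (-s) by ring]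
  refine h2.trans ?_
  rw [Real.norm_of_nonneg ha0, ← mul_assoc ‖s‖]
  exact mul_le_of_le_one_right (by positivity) ha1

/-- The general term of the regularised Hurwitz series. -/
def lerchTerm (a : ℝ) (n : ℕ) (s : ℂ) : ℂ :=
  (((n + 1 : ℝ) + a : ℝ) : ℂ) ^ (-s) - ((n + 1 : ℝ) : ℂ) ^ (-s)
    + s * a * ((n + 1 : ℝ) : ℂ) ^ (-s - 1)

lemma lerchTerm_hasDerivAt (a : ℝ) (ha : 0 ≤ a) (n : ℕ) (s : ℂ) :
    HasDerivAt (lerchTerm a n)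
      (-(((n + 1 : ℝ) + a : ℝ) : ℂ) ^ (-s) * Complex.log (((n + 1 : ℝ) + a : ℝ) : ℂ)
        + ((n + 1 : ℝ) : ℂ) ^ (-s) * Complex.log ((n + 1 : ℝ) : ℂ)
        + (a * ((n + 1 : ℝ) : ℂ) ^ (-s - 1)
          - s * a * (((n + 1 : ℝ) : ℂ) ^ (-s - 1) * Complex.log ((n + 1 : ℝ) : ℂ)))) s := by
  have h1 : (((n + 1 : ℝ) + a : ℝ) : ℂ) ≠ 0 := by
    rw [Complex.ofReal_ne_zero]; positivity
  have h2 : ((n + 1 : ℝ) : ℂ) ≠ 0 := by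
    rw [Complex.ofReal_ne_zero]; positivity
  have e1 := (hasDerivAt_id s).neg.const_cpow (c := (((n + 1 : ℝ) + a : ℝ) : ℂ)) (Or.inl h1)
  have e2 := (hasDerivAt_id s).neg.const_cpow (c := ((n + 1 : ℝ) : ℂ)) (Or.inl h2)
  have e3 := ((hasDerivAt_id s).neg.sub_const 1).const_cpow (c := ((n + 1 : ℝ) : ℂ)) (Or.inl h2)
  have e4 := ((hasDerivAt_id s).mul_const (a : ℂ)).mul e3
  have := (e1.sub e2).add e4
  unfold lerchTerm
  convert! this using 1
  simp only [id]
  simp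
  ring

/-- The regularised Hurwitz series. -/
def lerchH (a : ℝ) (s : ℂ) : ℂ := ∑' n : ℕ, lerchTerm a n s

lemma lerch_local {a : ℝ} (ha0 : 0 ≤ a) (ha1 : a ≤ 1) {s : ℂ} (hs : -1 < s.re) :
    ∃ (u : ℕ → ℝ) (U : Set ℂ), Summable u ∧ IsOpen U ∧ s ∈ U ∧
      ∀ n, ∀ w ∈ U, ‖lerchTerm a n w‖ ≤ u n := by
  obtain ⟨r, hr1, hr2⟩ := exists_between hs
  refine ⟨fun n => (‖s‖ + 1) * (‖s‖ + 2) * ((n + 1 : ℝ)) ^ (-r - 2),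
    {w | r < w.re} ∩ Metric.ball s 1, ?_, ?_, ⟨hr2, by simp⟩, ?_⟩
  · apply Summable.mul_left
    have := (Real.summable_nat_rpow (p := -r - 2)).2 (by linarith)
    simpa using (summable_nat_add_iff 1).2 this
  · exact (isOpen_lt continuous_const continuous_re).inter Metric.isOpen_ball
  · rintro n w ⟨hw1, hw2⟩
    have hw3 : ‖w‖ ≤ ‖s‖ + 1 := by
      have : ‖w - s‖ < 1 := by simpa [dist_eq_norm] using hw2
      calc ‖w‖ = ‖s + (w - s)‖ := by ring_nf
        _ ≤ ‖s‖ + ‖w - s‖ := norm_add_le _ _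
        _ ≤ _ := by linarith
    have hw4 : ‖w + 1‖ ≤ ‖s‖ + 2 := by
      calc ‖w + 1‖ ≤ ‖w‖ + ‖(1 : ℂ)‖ := norm_add_le _ _
        _ ≤ _ := by simp; linarith
    refine (lerch_bound (n + 1) a r w (by linarith [n.cast_nonneg (α := ℝ)]) ha0 ha1 hr1
      (le_of_lt hw1)).trans ?_
    have : (0:ℝ) ≤ ((n : ℝ) + 1) ^ (-r - 2) := by positivity
    exact mul_le_mul_of_nonneg_right (mul_le_mul hw3 hw4 (norm_nonneg _) (by positivity)) this

lemma lerchTerm_summable {a : ℝ} (ha0 : 0 ≤ a) (ha1 : a ≤ 1) {s : ℂ} (hs : -1 < s.re) :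
    Summable (fun n => lerchTerm a n s) := by
  obtain ⟨u, U, hu, -, hsU, h⟩ := lerch_local ha0 ha1 hs
  exact Summable.of_norm_bounded hu fun n => h n s hsU

lemma lerchH_differentiableAt {a : ℝ} (ha0 : 0 ≤ a) (ha1 : a ≤ 1) {s : ℂ} (hs : -1 < s.re) :
    DifferentiableAt ℂ (lerchH a) s := by
  obtain ⟨u, U, hu, hU, hsU, h⟩ := lerch_local ha0 ha1 hs
  exact (differentiableOn_tsum_of_summable_norm hu
    (fun n w _ => (lerchTerm_hasDerivAt a ha0 n w).differentiableAt.differentiableWithinAt) hU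
    h).differentiableAt (hU.mem_nhds hsU)

lemma lerchH_hasSum_deriv {a : ℝ} (ha0 : 0 ≤ a) (ha1 : a ≤ 1) :
    HasSum (fun n : ℕ => ((-Real.log ((n + 1 : ℝ) + a) + Real.log (n + 1 : ℝ)
      + a / (n + 1 : ℝ) : ℝ) : ℂ)) (deriv (lerchH a) 0) := by
  obtain ⟨u, U, hu, hU, hsU, h⟩ := lerch_local (s := 0) ha0 ha1 (by simp)
  have := hasSum_deriv_of_summable_norm hu
    (fun n w _ => (lerchTerm_hasDerivAt a ha0 n w).differentiableAt.differentiableWithinAt) hU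
    h hsU
  refine this.congr_fun ?_ |> id
  intro n
  rw [(lerchTerm_hasDerivAt a ha0 n 0).deriv, ← Complex.ofReal_log (by positivity),
    ← Complex.ofReal_log (by positivity)]
  simp [Complex.cpow_neg_one]
  ring

open Filter Topology in
lemma lerchH_deriv_zero {a : ℝ} (ha0 : 0 < a) (ha1 : a ≤ 1) :
    deriv (lerchH a) 0 = ((Real.log (Real.Gamma a) + Real.log a
      + a * Real.eulerMascheroniConstant : ℝ) : ℂ) := by
  have h1 := (lerchH_hasSum_deriv ha0.le ha1).tendsto_sum_nat
  have h2 : Tendsto (fun N : ℕ => ∑ n ∈ Finset.range N, (-Real.log ((n + 1 : ℝ) + a)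
      + Real.log (n + 1 : ℝ) + a / (n + 1 : ℝ))) atTop
      (𝓝 (Real.log (Real.Gamma a) + Real.log a + a * Real.eulerMascheroniConstant)) := by
    have h3 := Real.BohrMollerup.tendsto_log_gamma ha0
    have h4 := Real.tendsto_harmonic_sub_log
    have h5 := (h3.add_const (Real.log a)).add (h4.const_mul a)
    refine h5.congr ?_
    intro N
    rw [Real.BohrMollerup.logGammaSeq, Finset.sum_range_succ']
    have e1 : ∀ N : ℕ, Real.log (N.factorial : ℝ) = ∑ n ∈ Finset.range N, Real.log (n + 1 : ℝ) := by
      intro N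
      induction N with
      | zero => simp
      | succ k ih =>
        rw [Finset.sum_range_succ, ← ih, Nat.factorial_succ, Nat.cast_mul, Real.log_mul]
        · push_cast; ring
        · positivity
        · positivity
    rw [e1, Finset.sum_add_distrib, Finset.sum_add_distrib, harmonic]
    push_cast
    simp only [div_eq_mul_inv, ← Finset.mul_sum, Finset.sum_neg_distrib, add_zero]
    rw [show (∑ k ∈ Finset.range N, Real.log (a + ((k : ℝ) + 1))) =
      ∑ k ∈ Finset.range N, Real.log ((k : ℝ) + 1 + a) from
      Finset.sum_congr rfl fun k _ => by rw [add_comm]]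
    ring
  have h3 := (continuous_ofReal.tendsto _).comp h2
  refine tendsto_nhds_unique h1 (h3.congr fun N => ?_)
  simp

lemma hasSum_zeta_succ {s : ℂ} (hs : 1 < s.re) :
    HasSum (fun n : ℕ => ((n + 1 : ℝ) : ℂ) ^ (-s)) (riemannZeta s) := by
  have h := zeta_eq_tsum_one_div_nat_add_one_cpow hs
  have hsum : Summable (fun n : ℕ => 1 / (n : ℂ) ^ s) := Complex.summable_one_div_nat_cpow.2 hs
  have := ((summable_nat_add_iff 1).2 hsum).hasSum
  rw [h]
  convert! this using 2 with n
  · rw [Complex.cpow_neg]; push_cast; simp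
  · push_cast; rfl

open HurwitzZeta in
lemma hurwitz_eq_of_one_lt {a : ℝ} (ha0 : 0 < a) (ha1 : a ≤ 1) {s : ℂ} (hs : 1 < s.re) :
    hurwitzZeta (a : UnitAddCircle) s - hurwitzZeta (0 : UnitAddCircle) s =
      (a : ℂ) ^ (-s) - a * riemannZeta₁ (s + 1) + lerchH a s := by
  have hz : riemannZeta₁ (s + 1) = s * riemannZeta (s + 1) := by
    have hs0 : s ≠ 0 := by rintro rfl; simp at hs; linarith
    rw [riemannZeta_eq_inv_sub_mul (by simpa using hs0)]
    rw [add_sub_cancel_right, mul_inv_cancel_left₀ hs0]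
  rw [hurwitzZeta_zero, hz]
  have h1 := hasSum_hurwitzZeta_of_one_lt_re (a := a) ⟨ha0.le, ha1⟩ hs
  have h2 := (hasSum_nat_add_iff' 1).2 h1
  have h3 := hasSum_zeta_succ hs
  have h4 := hasSum_zeta_succ (s := s + 1) (by simp; linarith)
  have h5 := (h2.sub h3).add (h4.mul_left (s * a))
  have h6 : lerchH a s = _ := (h5.congr_fun (fun n => ?_)).tsum_eq
  · rw [h6]
    simp [Complex.cpow_neg]
    ring
  · unfold lerchTerm
    rw [Complex.cpow_neg]
    push_cast
    rw [show -(s + 1) = -s - 1 by ring, one_div]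

open HurwitzZeta in
lemma hurwitz_eq {a : ℝ} (ha0 : 0 < a) (ha1 : a ≤ 1) {s : ℂ} (hs : -1 < s.re) :
    hurwitzZeta (a : UnitAddCircle) s - hurwitzZeta (0 : UnitAddCircle) s =
      (a : ℂ) ^ (-s) - a * riemannZeta₁ (s + 1) + lerchH a s := by
  set U : Set ℂ := {s | -1 < s.re} with hU
  have hUo : IsOpen U := isOpen_lt continuous_const continuous_re
  have hUc : IsPreconnected U := (convex_halfSpace_re_gt (-1)).isPreconnected
  have hf : AnalyticOnNhd ℂ (fun s => hurwitzZeta (a : UnitAddCircle) s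
      - hurwitzZeta (0 : UnitAddCircle) s) U :=
    (differentiable_hurwitzZeta_sub_hurwitzZeta _ _).differentiableOn.analyticOnNhd hUo
  have ha : (a : ℂ) ≠ 0 := by exact_mod_cast ha0.ne'
  have hg : AnalyticOnNhd ℂ (fun s : ℂ => (a : ℂ) ^ (-s) - a * riemannZeta₁ (s + 1)
      + lerchH a s) U := by
    apply DifferentiableOn.analyticOnNhd _ hUo
    intro w hw
    apply DifferentiableAt.differentiableWithinAt
    apply DifferentiableAt.add
    · apply DifferentiableAt.sub
      · exact (differentiableAt_id.neg).const_cpow (Or.inl ha)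
      · apply DifferentiableAt.const_mul
        exact (differentiable_riemannZeta₁ _).comp w (differentiableAt_id.add_const 1)
    · exact lerchH_differentiableAt ha0.le ha1 hw
  refine hf.eqOn_of_preconnected_of_eventuallyEq hg hUc (z₀ := 2) (by simp [hU]; norm_num) ?_ hs
  have : {s : ℂ | 1 < s.re} ∈ nhds (2 : ℂ) :=
    (isOpen_lt continuous_const continuous_re).mem_nhds (by simp)
  filter_upwards [this] with w hw
  exact hurwitz_eq_of_one_lt ha0 ha1 hw

open HurwitzZeta in
/-- Lerch's formula. -/
lemma hurwitz_hasDerivAt_zero {a : ℝ} (ha0 : 0 < a) (ha1 : a ≤ 1) :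
    HasDerivAt (fun s => hurwitzZeta (a : UnitAddCircle) s)
      (deriv riemannZeta 0 + (Real.log (Real.Gamma a) : ℝ)) 0 := by
  have ha : (a : ℂ) ≠ 0 := by exact_mod_cast ha0.ne'
  have h1 : HasDerivAt riemannZeta (deriv riemannZeta 0) 0 :=
    (differentiableAt_riemannZeta (by simp)).hasDerivAt
  have h2 : HasDerivAt (fun s : ℂ => (a : ℂ) ^ (-s)) (-(Real.log a : ℂ)) 0 := by
    have := ((hasDerivAt_id (0 : ℂ)).neg).const_cpow (c := (a : ℂ)) (Or.inl ha)
    convert! this using 1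
    simp [Complex.ofReal_log ha0.le]
  have h3 : HasDerivAt (fun s : ℂ => a * riemannZeta₁ (s + 1))
      (a * Real.eulerMascheroniConstant) 0 := by
    apply HasDerivAt.const_mul
    have : HasDerivAt riemannZeta₁ (Real.eulerMascheroniConstant : ℂ) (0 + 1) := by
      rw [zero_add, ← deriv_riemannZeta₁_one]
      exact (differentiable_riemannZeta₁ 1).hasDerivAt
    exact this.comp_add_const 0 1
  have h4 := (lerchH_differentiableAt ha0.le ha1 (s := 0) (by simp)).hasDerivAt
  rw [lerchH_deriv_zero ha0 ha1] at h4
  have h5 := ((h2.sub h3).add h4).add h1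
  refine (h5.congr_deriv ?_).congr_of_eventuallyEq ?_
  · push_cast; ring
  · have : {s : ℂ | -1 < s.re} ∈ nhds (0 : ℂ) :=
      (isOpen_lt continuous_const continuous_re).mem_nhds (by simp)
    filter_upwards [this] with w hw
    have := hurwitz_eq ha0 ha1 hw
    rw [hurwitzZeta_zero] at this
    simp only [Pi.add_apply, Pi.sub_apply]
    rw [← this]; ring

open HurwitzZeta in
/-- The derivative at `0` of the `L`-function of a function of sum zero vanishing at `0`. -/
lemma LFunction_hasDerivAt_zero {N : ℕ} [NeZero N] (Ψ : ZMod N → ℂ) (h0 : Ψ 0 = 0)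
    (hsum : ∑ j, Ψ j = 0) :
    HasDerivAt (ZMod.LFunction Ψ) (-(Real.log N : ℂ) * ZMod.LFunction Ψ 0
      + ∑ j : ZMod N, Ψ j * (Real.log (Real.Gamma ((j.val : ℝ) / N)) : ℝ)) 0 := by
  have hN : (N : ℂ) ≠ 0 := by exact_mod_cast NeZero.ne N
  have h1 : HasDerivAt (fun s : ℂ => (N : ℂ) ^ (-s)) (-(Real.log N : ℂ)) 0 := by
    have := ((hasDerivAt_id (0 : ℂ)).neg).const_cpow (c := (N : ℂ)) (Or.inl hN)
    convert! this using 1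
    simp
  have h2 : ∀ j : ZMod N, HasDerivAt (fun s => Ψ j * hurwitzZeta (ZMod.toAddCircle j) s)
      (Ψ j * (deriv riemannZeta 0 + (Real.log (Real.Gamma ((j.val : ℝ) / N)) : ℝ))) 0 := by
    intro j
    by_cases hj : j = 0
    · subst hj
      simp only [h0, zero_mul]
      exact hasDerivAt_const _ _
    · apply HasDerivAt.const_mul
      rw [ZMod.toAddCircle_apply]
      have hNp : (0 : ℝ) < N := by exact_mod_cast NeZero.pos N
      apply hurwitz_hasDerivAt_zero
      · apply div_pos _ hNp
        have : j.val ≠ 0 := by simpa using hj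
        exact_mod_cast Nat.pos_of_ne_zero this
      · rw [div_le_one hNp]
        exact_mod_cast (ZMod.val_lt j).le
  have h3 := h1.mul (HasDerivAt.fun_sum (u := Finset.univ) fun j _ => h2 j)
  refine h3.congr_deriv ?_
  simp only [ZMod.LFunction, neg_zero, cpow_zero, one_mul, mul_add, Finset.sum_add_distrib]
  rw [← Finset.sum_mul, hsum]
  simp

open MeasureTheory Filter Topology Set in
/-- antiderivative of the Gaussian -/
def gauG (x : ℝ) : ℝ := ∫ v in (0:ℝ)..x, Real.exp (-1 * v ^ 2)

lemma gauG_deriv (x : ℝ) : HasDerivAt gauG (Real.exp (-1 * x ^ 2)) x := by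
  unfold gauG
  have hc : Continuous (fun v : ℝ => Real.exp (-1 * v ^ 2)) := by fun_prop
  exact intervalIntegral.integral_hasDerivAt_right (hc.intervalIntegrable _ _)
    (hc.stronglyMeasurableAtFilter _ _) hc.continuousAt

open MeasureTheory Filter Topology Set in
lemma gauG_atTop : Tendsto gauG atTop (𝓝 (√Real.pi / 2)) := by
  have h := intervalIntegral_tendsto_integral_Ioi (μ := volume) (f := fun v : ℝ => Real.exp (-1 * v ^ 2))
    0 ((integrable_exp_neg_mul_sq one_pos).integrableOn) tendsto_id
  rw [integral_gaussian_Ioi, div_one] at h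
  exact h

open MeasureTheory Filter Topology Set in
lemma gauG_atBot : Tendsto gauG atBot (𝓝 (-(√Real.pi / 2))) := by
  have h : ∀ x, gauG x = - gauG (-x) := by
    intro x
    unfold gauG
    have := intervalIntegral.integral_comp_neg (a := 0) (b := x) (fun v : ℝ => Real.exp (-1 * v ^ 2))
    simp only [neg_zero, even_two.neg_pow] at this
    rw [this, intervalIntegral.integral_symm]
  have h2 := (gauG_atTop.comp tendsto_neg_atBot_atTop).neg
  refine h2.congr (fun x => ?_)
  simp [h x]

open MeasureTheory Filter Topology Set in
lemma schlomilch {α β : ℝ} (hα : 0 < α) (hβ : 0 < β) :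
    IntegrableOn (fun t : ℝ => 1 / (t * √t) * Real.exp (-(α ^ 2 * t + β ^ 2 / t))) (Ioi 0) ∧
    ∫ t in Ioi (0:ℝ), 1 / (t * √t) * Real.exp (-(α ^ 2 * t + β ^ 2 / t)) =
      √Real.pi / β * Real.exp (-2 * α * β) := by
  set H : ℝ → ℝ := fun t => -(1 / β) * (Real.exp (-2 * α * β) * gauG (β / √t - α * √t) +
    Real.exp (2 * α * β) * gauG (β / √t + α * √t)) with hH
  set g' : ℝ → ℝ := fun t : ℝ => 1 / (t * √t) * Real.exp (-(α ^ 2 * t + β ^ 2 / t)) with hg'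
  have hd : ∀ t ∈ Ioi (0:ℝ), HasDerivAt H (g' t) t := by
    intro t ht
    have ht : 0 < t := ht
    have hs : 0 < √t := Real.sqrt_pos.2 ht
    have hsq : √t ^ 2 = t := Real.sq_sqrt ht.le
    have d0 : HasDerivAt (fun t => √t) (1 / (2 * √t)) t := Real.hasDerivAt_sqrt ht.ne'
    have d1 : HasDerivAt (fun t => β / √t) (-β / (2 * (t * √t))) t := by
      convert! (hasDerivAt_const t β).div d0 hs.ne' using 1
      rw [hsq]; field_simp; simp
    have d2 := d0.const_mul α
    have e1 := (gauG_deriv (β / √t - α * √t)).comp t (d1.sub d2)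
    have e2 := (gauG_deriv (β / √t + α * √t)).comp t (d1.add d2)
    have := ((e1.const_mul (Real.exp (-2 * α * β))).add (e2.const_mul (Real.exp (2 * α * β)))).const_mul (-(1 / β))
    refine this.congr_deriv ?_
    have x1 : Real.exp (-2 * α * β) * (Real.exp (-1 * (β / √t - α * √t) ^ 2)) =
        Real.exp (-(α ^ 2 * t + β ^ 2 / t)) := by
      rw [← Real.exp_add]; congr 1
      have : (β / √t - α * √t) ^ 2 = β ^ 2 / t - 2 * α * β + α ^ 2 * t := by
        rw [sub_sq, div_pow, mul_pow, hsq]; field_simp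
      rw [this]; ring
    have x2 : Real.exp (2 * α * β) * (Real.exp (-1 * (β / √t + α * √t) ^ 2)) =
        Real.exp (-(α ^ 2 * t + β ^ 2 / t)) := by
      rw [← Real.exp_add]; congr 1
      have : (β / √t + α * √t) ^ 2 = β ^ 2 / t + 2 * α * β + α ^ 2 * t := by
        rw [add_sq, div_pow, mul_pow, hsq]; field_simp
      rw [this]; ring
    rw [← mul_assoc (Real.exp (-2 * α * β)), ← mul_assoc (Real.exp (2 * α * β)), x1, x2, hg']
    field_simp
    ring
  have hs0 : Tendsto (fun t : ℝ => √t) (𝓝[>] 0) (𝓝[>] 0) := by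
    rw [tendsto_nhdsWithin_iff]
    constructor
    · have := (Real.continuous_sqrt.tendsto 0)
      rw [Real.sqrt_zero] at this
      exact this.mono_left nhdsWithin_le_nhds
    · filter_upwards [self_mem_nhdsWithin] with t ht using Real.sqrt_pos.2 ht
  have hi0 : Tendsto (fun t : ℝ => β / √t) (𝓝[>] 0) atTop := by
    have := (tendsto_inv_nhdsGT_zero.comp hs0).const_mul_atTop hβ
    simpa [div_eq_mul_inv] using this
  have hm0 : Tendsto (fun t : ℝ => α * √t) (𝓝[>] 0) (𝓝 0) := by
    simpa using (hs0.mono_right nhdsWithin_le_nhds).const_mul α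
  have hl0 : Tendsto H (𝓝[>] 0) (𝓝 (-(1 / β) * (Real.exp (-2 * α * β) * (√Real.pi / 2) +
    Real.exp (2 * α * β) * (√Real.pi / 2)))) := by
    have a1 : Tendsto (fun t : ℝ => β / √t - α * √t) (𝓝[>] 0) atTop := by
      have := hi0.atTop_add hm0.neg
      simpa [sub_eq_add_neg] using this
    have a2 : Tendsto (fun t : ℝ => β / √t + α * √t) (𝓝[>] 0) atTop := hi0.atTop_add hm0
    exact (((gauG_atTop.comp a1).const_mul _).add ((gauG_atTop.comp a2).const_mul _)).const_mul _
  have hi1 : Tendsto (fun t : ℝ => β / √t) atTop (𝓝 0) :=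
    tendsto_const_nhds.div_atTop Real.tendsto_sqrt_atTop
  have hm1 : Tendsto (fun t : ℝ => α * √t) atTop atTop :=
    Real.tendsto_sqrt_atTop.const_mul_atTop hα
  have hl1 : Tendsto H atTop (𝓝 (-(1 / β) * (Real.exp (-2 * α * β) * (-(√Real.pi / 2)) +
    Real.exp (2 * α * β) * (√Real.pi / 2)))) := by
    have a1 : Tendsto (fun t : ℝ => β / √t - α * √t) atTop atBot := by
      have := hi1.add_atBot (tendsto_neg_atTop_atBot.comp hm1)
      simpa [sub_eq_add_neg] using this
    have a2 : Tendsto (fun t : ℝ => β / √t + α * √t) atTop atTop := hi1.add_atTop hm1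
    exact (((gauG_atBot.comp a1).const_mul _).add ((gauG_atTop.comp a2).const_mul _)).const_mul _
  set L0 := (-(1 / β) * (Real.exp (-2 * α * β) * (√Real.pi / 2) +
    Real.exp (2 * α * β) * (√Real.pi / 2))) with hL0
  set g := Function.update H 0 L0 with hg
  have hcont : ContinuousWithinAt g (Ici 0) 0 := by
    rw [hg, continuousWithinAt_update_same]
    rwa [Ici_sdiff_left]
  have hd' : ∀ t ∈ Ioi (0:ℝ), HasDerivAt g (g' t) t := by
    intro t ht
    refine (hd t ht).congr_of_eventuallyEq ?_
    filter_upwards [isOpen_Ioi.mem_nhds ht] with u hu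
    rw [hg, Function.update_of_ne (ne_of_gt hu)]
  have hp : ∀ t ∈ Ioi (0:ℝ), 0 ≤ g' t := by
    intro t ht
    have ht : 0 < t := ht
    positivity
  have hl1' := hl1.congr' (f₂ := g) (by
    filter_upwards [eventually_gt_atTop 0] with u hu
    rw [hg, Function.update_of_ne (ne_of_gt hu)])
  refine ⟨integrableOn_Ioi_deriv_of_nonneg hcont hd' hp hl1', ?_⟩
  rw [integral_Ioi_of_hasDerivAt_of_nonneg hcont hd' hp hl1', hg, Function.update_self, hL0]
  field_simp
  ring

/-- summand of the non-constant part of the theta kernel -/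
def kterm (x y : ℝ) (p : ℕ × ℕ) (t : ℝ) : ℝ :=
  2 * Real.cos (2 * Real.pi * ((p.1 + 1) * x) * (p.2 + 1)) *
    Real.exp (-(Real.pi * y * (t * (p.1 + 1) ^ 2 + (p.2 + 1) ^ 2 / t)))

def gE (x y t : ℝ) : ℝ := √y / √t * ∑' p, kterm x y p t

def invSq (p : ℕ × ℕ) : ℝ := 1 / ((p.1 + 1 : ℝ) ^ 2) * (1 / (p.2 + 1 : ℝ) ^ 2)

lemma invSq_nonneg (p : ℕ × ℕ) : 0 ≤ invSq p := by unfold invSq; positivity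

lemma summable_inv_succ_sq : Summable (fun n : ℕ => 1 / (n + 1 : ℝ) ^ 2) := by
  have := (summable_nat_add_iff 1).2 (Real.summable_one_div_nat_pow.2 one_lt_two)
  simpa using this

lemma summable_invSq : Summable invSq := by
  apply summable_inv_succ_sq.mul_of_nonneg summable_inv_succ_sq
  · intro n; positivity
  · intro n; positivity

lemma exp_neg_le_pow {u : ℝ} (hu : 0 < u) (n : ℕ) : Real.exp (-u) ≤ n.factorial / u ^ n := by
  have h := Real.pow_div_factorial_le_exp u hu.le n
  rw [Real.exp_neg]
  rw [inv_le_comm₀ (Real.exp_pos _) (by positivity)]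
  rwa [inv_div]

lemma kterm_bound (x : ℝ) {y : ℝ} (hy : 0 < y) (A B : ℕ) (hA : 1 ≤ A) (hB : 1 ≤ B) (p : ℕ × ℕ)
    {t : ℝ} (ht : 0 < t) :
    |kterm x y p t| ≤ 2 * (A.factorial / (Real.pi * y) ^ A) * (B.factorial / (Real.pi * y) ^ B) *
      (t ^ B / t ^ A) * invSq p := by
  unfold kterm invSq
  have hpy : 0 < Real.pi * y := by positivity
  set m : ℝ := p.1 + 1
  set k : ℝ := p.2 + 1
  have hm : 1 ≤ m := by simp [m]
  have hk : 1 ≤ k := by simp [k]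
  have e1 : Real.exp (-(Real.pi * y * (t * m ^ 2 + k ^ 2 / t))) =
      Real.exp (-(Real.pi * y * (t * m ^ 2))) * Real.exp (-(Real.pi * y * (k ^ 2 / t))) := by
    rw [← Real.exp_add]; ring_nf
  have b1 : Real.exp (-(Real.pi * y * (t * m ^ 2))) ≤
      (A.factorial / (Real.pi * y) ^ A) * (1 / t ^ A) * (1 / m ^ 2) := by
    refine (exp_neg_le_pow (by positivity) A).trans ?_
    rw [mul_pow (Real.pi * y), mul_pow t, ← pow_mul]
    have : m ^ 2 ≤ m ^ (2 * A) := pow_le_pow_right₀ hm (by omega)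
    calc _ ≤ (A.factorial : ℝ) / ((Real.pi * y) ^ A * (t ^ A * m ^ 2)) := by gcongr
      _ = _ := by field_simp
  have b2 : Real.exp (-(Real.pi * y * (k ^ 2 / t))) ≤
      (B.factorial / (Real.pi * y) ^ B) * (t ^ B) * (1 / k ^ 2) := by
    refine (exp_neg_le_pow (by positivity) B).trans ?_
    rw [mul_pow (Real.pi * y), div_pow, ← pow_mul]
    have : k ^ 2 ≤ k ^ (2 * B) := pow_le_pow_right₀ hk (by omega)
    calc _ ≤ (B.factorial : ℝ) / ((Real.pi * y) ^ B * (k ^ 2 / t ^ B)) := by gcongr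
      _ = _ := by field_simp
  rw [e1, abs_mul, abs_mul, abs_two, abs_of_pos (mul_pos (Real.exp_pos _) (Real.exp_pos _))]
  calc _ ≤ 2 * 1 * (((A.factorial / (Real.pi * y) ^ A) * (1 / t ^ A) * (1 / m ^ 2)) *
      ((B.factorial / (Real.pi * y) ^ B) * (t ^ B) * (1 / k ^ 2))) := by
        gcongr
        exact Real.abs_cos_le_one _
    _ = _ := by field_simp

lemma kterm_bound1 (x : ℝ) {y : ℝ} (hy : 0 < y) (p : ℕ × ℕ) {t : ℝ} (ht : 0 < t) :
    |kterm x y p t| ≤ 2 * (1 / (Real.pi * y)) * (1 / (Real.pi * y)) * invSq p := by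
  have := kterm_bound x hy 1 1 le_rfl le_rfl p ht
  simpa [ht.ne'] using this

lemma kterm_summable (x : ℝ) {y : ℝ} (hy : 0 < y) {t : ℝ} (ht : 0 < t) :
    Summable (fun p => kterm x y p t) :=
  Summable.of_norm_bounded (summable_invSq.mul_left _) (fun p => kterm_bound1 x hy p ht)

lemma gE_continuousOn (x : ℝ) {y : ℝ} (hy : 0 < y) : ContinuousOn (gE x y) (Set.Ioi 0) := by
  unfold gE
  refine ContinuousOn.mul ?_ ?_
  · exact continuousOn_const.div Real.continuous_sqrt.continuousOn
      (fun t ht => (Real.sqrt_pos.2 ht).ne')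
  · refine continuousOn_tsum (fun p => ?_)
      (summable_invSq.mul_left (2 * (1 / (Real.pi * y)) * (1 / (Real.pi * y)))) (fun p t ht => kterm_bound1 x hy p ht)
    unfold kterm
    have : ContinuousOn (fun t : ℝ => (p.2 + 1 : ℝ) ^ 2 / t) (Set.Ioi 0) :=
      continuousOn_const.div continuousOn_id (fun t ht => ne_of_gt ht)
    fun_prop

lemma gE_bound (x : ℝ) {y : ℝ} (hy : 0 < y) (A B : ℕ) (hA : 1 ≤ A) (hB : 1 ≤ B) :
    ∃ C : ℝ, 0 ≤ C ∧ ∀ t : ℝ, 0 < t → |gE x y t| ≤ C * (1 / √t * (t ^ B / t ^ A)) := by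
  refine ⟨√y * (2 * (A.factorial / (Real.pi * y) ^ A) * (B.factorial / (Real.pi * y) ^ B) * ∑' p, invSq p),
    ?_, fun t ht => ?_⟩
  · have : 0 ≤ ∑' p, invSq p := tsum_nonneg invSq_nonneg
    positivity
  · have h1 : |∑' p, kterm x y p t| ≤ 2 * (A.factorial / (Real.pi * y) ^ A) * (B.factorial / (Real.pi * y) ^ B) *
      (t ^ B / t ^ A) * ∑' p, invSq p := by
      rw [← Real.norm_eq_abs, ← tsum_mul_left]
      exact tsum_of_norm_bounded (summable_invSq.mul_left _).hasSum
        (fun p => kterm_bound x hy A B hA hB p ht)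
    unfold gE
    rw [abs_mul, abs_of_nonneg (by positivity : 0 ≤ √y / √t)]
    calc _ ≤ √y / √t * (2 * (A.factorial / (Real.pi * y) ^ A) * (B.factorial / (Real.pi * y) ^ B) *
      (t ^ B / t ^ A) * ∑' p, invSq p) := by gcongr
      _ = _ := by ring

open Filter Topology Set Asymptotics in
lemma gE_isBigO_atTop (x : ℝ) {y : ℝ} (hy : 0 < y) (N : ℕ) :
    (fun t => (gE x y t : ℂ)) =O[atTop] (fun t : ℝ => t ^ (-(N : ℝ))) := by
  obtain ⟨C, hC, h⟩ := gE_bound x hy (N + 1) 1 (by omega) le_rfl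
  refine IsBigO.of_bound C ?_
  filter_upwards [eventually_ge_atTop 1] with t ht
  have ht0 : 0 < t := by linarith
  rw [Complex.norm_real, Real.norm_eq_abs]
  refine (h t ht0).trans ?_
  gcongr
  rw [Real.norm_eq_abs, abs_of_nonneg (by positivity), Real.rpow_neg ht0.le, Real.rpow_natCast]
  have : 1 ≤ √t := Real.one_le_sqrt.2 ht
  have h2 : 1 / √t ≤ 1 := by rw [div_le_one (by positivity)]; exact this
  calc _ ≤ 1 * (t ^ 1 / t ^ (N + 1)) := by gcongr
    _ = _ := by field_simp; ring

open Filter Topology Set Asymptotics in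
lemma gE_isBigO_zero (x : ℝ) {y : ℝ} (hy : 0 < y) (N : ℕ) :
    (fun t => (gE x y t : ℂ)) =O[𝓝[>] 0] (fun t : ℝ => t ^ (-(-(N : ℝ)))) := by
  obtain ⟨C, hC, h⟩ := gE_bound x hy 1 (N + 2) le_rfl (by omega)
  refine IsBigO.of_bound C ?_
  filter_upwards [Ioc_mem_nhdsGT (zero_lt_one)] with t ht
  obtain ⟨ht0, ht1⟩ := ht
  rw [Complex.norm_real, Real.norm_eq_abs]
  refine (h t ht0).trans ?_
  gcongr
  rw [Real.norm_eq_abs, abs_of_nonneg (Real.rpow_nonneg ht0.le _), neg_neg, Real.rpow_natCast]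
  have hs : t ≤ √t := by
    rw [Real.le_sqrt' ht0]; nlinarith
  calc _ ≤ 1 / t * (t ^ (N + 2) / t ^ 1) := by gcongr
    _ = _ := by field_simp; ring

open MeasureTheory in
lemma gE_locInt (x : ℝ) {y : ℝ} (hy : 0 < y) :
    LocallyIntegrableOn (fun t => (gE x y t : ℂ)) (Set.Ioi 0) :=
  (Complex.continuous_ofReal.comp_continuousOn (gE_continuousOn x hy)).locallyIntegrableOn
    measurableSet_Ioi

lemma gE_mellin_differentiable (x : ℝ) {y : ℝ} (hy : 0 < y) :
    Differentiable ℂ (mellin (fun t => (gE x y t : ℂ))) := by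
  intro s
  obtain ⟨N, hN⟩ := exists_nat_gt |s.re|
  have := abs_lt.1 hN
  exact mellin_differentiableAt_of_isBigO_rpow (gE_locInt x hy) (gE_isBigO_atTop x hy N) (by linarith)
    (gE_isBigO_zero x hy N) (by linarith)

lemma gE_mellinConvergent (x : ℝ) {y : ℝ} (hy : 0 < y) (s : ℂ) :
    MellinConvergent (fun t => (gE x y t : ℂ)) s := by
  obtain ⟨N, hN⟩ := exists_nat_gt |s.re|
  have := abs_lt.1 hN
  exact mellinConvergent_of_isBigO_rpow (gE_locInt x hy) (gE_isBigO_atTop x hy N) (by linarith)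
    (gE_isBigO_zero x hy N) (by linarith)

def bterm (x y : ℝ) (p : ℕ × ℕ) : ℝ :=
  2 * Real.cos (2 * Real.pi * ((p.1 + 1) * x) * (p.2 + 1)) *
    (1 / (p.2 + 1) * Real.exp (-2 * Real.pi * y * ((p.1 + 1) * (p.2 + 1))))

open MeasureTheory Set in
lemma kterm_int (x : ℝ) {y : ℝ} (hy : 0 < y) (p : ℕ × ℕ) :
    IntegrableOn (fun t : ℝ => t⁻¹ * (√y / √t * kterm x y p t)) (Ioi 0) ∧
    ∫ t in Ioi (0:ℝ), t⁻¹ * (√y / √t * kterm x y p t) = bterm x y p ∧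
    ∫ t in Ioi (0:ℝ), ‖t⁻¹ * (√y / √t * kterm x y p t)‖ ≤
      2 * (1 / (p.2 + 1) * Real.exp (-2 * Real.pi * y * ((p.1 + 1) * (p.2 + 1)))) := by
  have hpy : 0 < √(Real.pi * y) := Real.sqrt_pos.2 (by positivity)
  set α := √(Real.pi * y) * (p.1 + 1 : ℝ) with hα
  set β := √(Real.pi * y) * (p.2 + 1 : ℝ) with hβ
  have hsq : √(Real.pi * y) ^ 2 = Real.pi * y := Real.sq_sqrt (by positivity)
  obtain ⟨h1, h2⟩ := schlomilch (α := α) (β := β) (by positivity) (by positivity)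
  have hc : √y * (√Real.pi / β * Real.exp (-2 * α * β)) =
      1 / (p.2 + 1) * Real.exp (-2 * Real.pi * y * ((p.1 + 1) * (p.2 + 1))) := by
    have : -2 * α * β = -2 * Real.pi * y * ((p.1 + 1) * (p.2 + 1)) := by
      rw [hα, hβ]; linear_combination -2 * (p.1 + 1 : ℝ) * (p.2 + 1) * hsq
    rw [this, hβ, Real.sqrt_mul Real.pi_pos.le]
    have : √y ≠ 0 := (Real.sqrt_pos.2 hy).ne'
    have : √Real.pi ≠ 0 := (Real.sqrt_pos.2 Real.pi_pos).ne'
    field_simp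
  set C := Real.cos (2 * Real.pi * ((p.1 + 1) * x) * (p.2 + 1)) with hC
  have heq : ∀ t ∈ Ioi (0:ℝ), t⁻¹ * (√y / √t * kterm x y p t) =
      (2 * C * √y) * (1 / (t * √t) * Real.exp (-(α ^ 2 * t + β ^ 2 / t))) := by
    intro t ht
    have ht : 0 < t := ht
    unfold kterm
    have : Real.pi * y * (t * (p.1 + 1) ^ 2 + (p.2 + 1) ^ 2 / t) = α ^ 2 * t + β ^ 2 / t := by
      rw [hα, hβ, mul_pow, mul_pow, hsq]; ring
    rw [this, ← hC]
    have : √t ≠ 0 := (Real.sqrt_pos.2 ht).ne'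
    field_simp
  refine ⟨?_, ?_, ?_⟩
  · rw [integrableOn_congr_fun heq measurableSet_Ioi]
    exact h1.const_mul _
  · rw [setIntegral_congr_fun measurableSet_Ioi heq, integral_const_mul, h2, bterm, ← hC, ← hc]
    ring
  · have heq2 : ∀ t ∈ Ioi (0:ℝ), ‖t⁻¹ * (√y / √t * kterm x y p t)‖ =
      (2 * |C| * √y) * (1 / (t * √t) * Real.exp (-(α ^ 2 * t + β ^ 2 / t))) := by
      intro t ht
      have ht' : 0 < t := ht
      rw [heq t ht, norm_mul, norm_mul, norm_mul, Real.norm_eq_abs C, Real.norm_of_nonneg (by norm_num),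
        Real.norm_of_nonneg (Real.sqrt_nonneg y), Real.norm_of_nonneg (by positivity)]
    rw [setIntegral_congr_fun measurableSet_Ioi heq2, integral_const_mul, h2, ← hc]
    have : |C| ≤ 1 := Real.abs_cos_le_one _
    have h0 : 0 ≤ √y * (√Real.pi / β * Real.exp (-2 * α * β)) := by positivity
    nlinarith

lemma bexp_bound {y : ℝ} (hy : 0 < y) (p : ℕ × ℕ) :
    1 / (p.2 + 1) * Real.exp (-2 * Real.pi * y * ((p.1 + 1) * (p.2 + 1))) ≤
      Real.exp (-2 * Real.pi * y) ^ p.1 * Real.exp (-2 * Real.pi * y) ^ p.2 := by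
  rw [← Real.exp_nat_mul, ← Real.exp_nat_mul, ← Real.exp_add]
  have h1 : (1 : ℝ) / (p.2 + 1) ≤ 1 := by
    rw [div_le_one (by positivity)]; simp
  have h2 : Real.exp (-2 * Real.pi * y * ((p.1 + 1) * (p.2 + 1))) ≤
      Real.exp (p.1 * (-2 * Real.pi * y) + p.2 * (-2 * Real.pi * y)) := by
    apply Real.exp_le_exp.2
    have : 0 < Real.pi * y := by positivity
    have h3 : (0:ℝ) ≤ p.1 * p.2 := by positivity
    nlinarith [mul_nonneg this.le h3]
  calc _ ≤ 1 * Real.exp (p.1 * (-2 * Real.pi * y) + p.2 * (-2 * Real.pi * y)) := by gcongr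
    _ = _ := one_mul _

lemma bexp_summable {y : ℝ} (hy : 0 < y) : Summable (fun p : ℕ × ℕ =>
    1 / (p.2 + 1) * Real.exp (-2 * Real.pi * y * ((p.1 + 1) * (p.2 + 1)))) := by
  have hlt : Real.exp (-2 * Real.pi * y) < 1 := by
    rw [Real.exp_lt_one_iff]
    have : 0 < Real.pi * y := by positivity
    nlinarith
  have hg := summable_geometric_of_lt_one (Real.exp_pos _).le hlt
  refine Summable.of_nonneg_of_le (fun p => by positivity) (bexp_bound hy)
    (hg.mul_of_nonneg hg (fun n => by positivity) (fun n => by positivity))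

open MeasureTheory Set in
lemma gE_mellin_zero (x : ℝ) {y : ℝ} (hy : 0 < y) :
    ∃ b : ℝ, HasSum (bterm x y) b ∧ mellin (fun t => (gE x y t : ℂ)) 0 = b := by
  refine ⟨∫ t in Ioi (0:ℝ), ∑' p, t⁻¹ * (√y / √t * kterm x y p t), ?_, ?_⟩
  · have := hasSum_integral_of_summable_integral_norm (μ := volume.restrict (Ioi (0:ℝ)))
      (F := fun p t => t⁻¹ * (√y / √t * kterm x y p t)) (fun p => (kterm_int x hy p).1)
      (Summable.of_nonneg_of_le (fun p => integral_nonneg (fun t => norm_nonneg _))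
        (fun p => (kterm_int x hy p).2.2) ((bexp_summable hy).mul_left 2))
    simpa only [(kterm_int x hy _).2.1] using this
  · rw [mellin, ← integral_complex_ofReal]
    refine setIntegral_congr_fun measurableSet_Ioi (fun t ht => ?_)
    simp only [gE, tsum_mul_left, zero_sub, Complex.cpow_neg_one, smul_eq_mul]
    push_cast
    rfl


lemma qp_norm (z s : ℂ) (n : ℕ) (hs : s = n) : ‖qp z s‖ = Real.exp (-2 * Real.pi * z.im) ^ n := by
  subst hs
  rw [qp, Complex.norm_exp, ← Real.exp_nat_mul]
  congr 1
  simp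
  ring

lemma bterm_fiber {z : ℂ} (hz : 0 < z.im) (m : ℕ) :
    HasSum (fun k : ℕ => bterm z.re z.im (m, k)) (-2 * Real.log ‖1 - qp z ((m : ℂ) + 1)‖) := by
  have hlt : ‖qp z ((m : ℂ) + 1)‖ < 1 := by
    rw [qp_norm z _ (m + 1) (by push_cast; rfl)]
    apply pow_lt_one₀ (Real.exp_pos _).le _ (by omega)
    rw [Real.exp_lt_one_iff]
    have : 0 < Real.pi * z.im := by positivity
    nlinarith
  have h1 := Complex.hasSum_taylorSeries_neg_log hlt
  have h2 := (Complex.hasSum_iff _ _).1 h1 |>.1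
  rw [← hasSum_nat_add_iff' 1] at h2
  have h3 := h2.mul_left 2
  simp only [Finset.range_one, Finset.sum_singleton, pow_zero, Nat.cast_zero, div_zero, zero_re, sub_zero,
    neg_re, Complex.log_re] at h3
  convert! h3 using 1
  · ext k
    rw [bterm, qp, ← Complex.exp_nat_mul]
    have : (((k + 1 : ℕ) : ℂ) * (2 * (Real.pi : ℂ) * Complex.I * z * ((m : ℂ) + 1))) =
        ((-2 * Real.pi * z.im * ((m + 1) * (k + 1)) : ℝ) : ℂ) +
        ((2 * Real.pi * ((m + 1) * z.re) * (k + 1) : ℝ) : ℂ) * Complex.I := by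
      conv_lhs => rw [← Complex.re_add_im z]
      push_cast
      linear_combination (2 * Real.pi * z.im * ((m + 1) * (k + 1)) : ℂ) * Complex.I_sq
    have hd : ((k + 1 : ℕ) : ℂ) = ((k + 1 : ℝ) : ℂ) := by push_cast; rfl
    rw [this, Complex.exp_add, hd, ← Complex.ofReal_exp, Complex.div_ofReal_re, Complex.re_ofReal_mul,
      Complex.exp_ofReal_mul_I_re]
    push_cast
    ring
  · ring

lemma eta_norm {z : ℂ} (hz : 0 < z.im) {b : ℝ} (hb : HasSum (bterm z.re z.im) b) :
    ‖etaDedekind z‖ = Real.exp (-Real.pi * z.im / 12) * Real.exp (-b / 2) := by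
  have h1 := hb.prod_fiberwise (bterm_fiber hz)
  have h2 := h1.mul_left (-1 / 2)
  have h3 := h2.rexp
  have hr : Real.exp (-2 * Real.pi * z.im) < 1 := by
    rw [Real.exp_lt_one_iff]
    have : 0 < Real.pi * z.im := by positivity
    nlinarith
  have hm : Multipliable (fun n : ℕ => (1 - qp z ((n : ℂ) + 1))) := by
    simp_rw [sub_eq_add_neg]
    apply multipliable_one_add_of_summable
    simp_rw [norm_neg]
    have : Summable (fun n : ℕ => Real.exp (-2 * Real.pi * z.im) ^ (n + 1)) :=
      (summable_nat_add_iff 1).2 (summable_geometric_of_lt_one (Real.exp_pos _).le hr)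
    refine this.congr (fun n => ?_)
    rw [qp_norm z _ (n + 1) (by push_cast; rfl)]
  rw [etaDedekind, norm_mul]
  congr 1
  · rw [Complex.norm_exp]
    congr 1
    have : (Real.pi : ℂ) * Complex.I * z / 12 = ((Real.pi / 12 : ℝ) : ℂ) * (Complex.I * z) := by
      push_cast; ring
    rw [this, Complex.re_ofReal_mul]
    simp; ring
  · rw [hm.norm_tprod]
    have e : -b / 2 = -1 / 2 * b := by ring
    rw [e, ← h3.tprod_eq]
    congr 1
    ext n
    have hne : 0 < ‖1 - qp z ((n : ℂ) + 1)‖ := by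
      rw [norm_pos_iff, sub_ne_zero]
      intro h
      have h4 := qp_norm z ((n : ℂ) + 1) (n + 1) (by push_cast; rfl)
      rw [← h, norm_one] at h4
      have := pow_lt_one₀ (Real.exp_pos (-2 * Real.pi * z.im)).le hr (n := n + 1) (by omega)
      linarith
    simp only [Function.comp]
    rw [show -1 / 2 * (-2 * Real.log ‖1 - qp z ((n : ℂ) + 1)‖) = Real.log ‖1 - qp z ((n : ℂ) + 1)‖ by ring,
      Real.exp_log hne]

def qf (x y m n : ℝ) : ℝ := ((n + m * x) ^ 2 + (m * y) ^ 2) / y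

def psiE (y t : ℝ) : ℝ := ∑' m : ℕ, Real.exp (-Real.pi * ((m + 1) ^ 2 * y) * t)

lemma psiE_hasSum {y t : ℝ} (hy : 0 < y) (ht : 0 < t) :
    HasSum (fun m : ℕ => Real.exp (-Real.pi * ((m + 1) ^ 2 * y) * t)) (psiE y t) := by
  refine Summable.hasSum ?_
  refine Summable.of_nonneg_of_le (fun m => (Real.exp_pos _).le) (fun m => ?_)
    (summable_inv_succ_sq.mul_left (1 / (Real.pi * y * t)))
  have := exp_neg_le_pow (u := Real.pi * y * t * (m + 1) ^ 2) (by positivity) 1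
  calc _ = Real.exp (-(Real.pi * y * t * (m + 1) ^ 2)) := by congr 1; ring
    _ ≤ _ := this
    _ = _ := by simp; ring

open HurwitzZeta in
lemma theta_fiber (x : ℝ) {y t : ℝ} (hy : 0 < y) (ht : 0 < t) (m : ℕ) :
    HasSum (fun n : ℤ => Real.exp (-Real.pi * qf x y (m + 1) n * t))
      (√y / √t * Real.exp (-Real.pi * ((m + 1) ^ 2 * y) * t) +
        √y / √t * ∑' k : ℕ, kterm x y (m, k) t) := by
  have h1 := (hasSum_int_evenKernel ((m + 1 : ℝ) * x) (div_pos ht hy)).mul_left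
    (Real.exp (-Real.pi * ((m + 1) ^ 2 * y) * t))
  rw [evenKernel_functional_equation] at h1
  have hyt : 0 < 1 / (t / y) := by positivity
  have h2 := (hasSum_nat_cosKernel₀ ((m + 1 : ℝ) * x) hyt).mul_left
    (Real.exp (-Real.pi * ((m + 1) ^ 2 * y) * t))
  have h3 : HasSum (fun k : ℕ => kterm x y (m, k) t) (Real.exp (-Real.pi * ((m + 1) ^ 2 * y) * t) *
      (cosKernel (((m + 1 : ℝ) * x : ℝ) : UnitAddCircle) (1 / (t / y)) - 1)) := by
    convert! h2 using 1
    ext k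
    rw [kterm]
    have : Real.exp (-(Real.pi * y * (t * (m + 1) ^ 2 + (k + 1) ^ 2 / t))) =
      Real.exp (-Real.pi * ((m + 1) ^ 2 * y) * t) * Real.exp (-Real.pi * (k + 1) ^ 2 * (1 / (t / y))) := by
      rw [← Real.exp_add]; congr 1; field_simp; ring
    simp only [this]
    ring
  rw [h3.tsum_eq]
  convert! h1 using 1
  · ext n
    rw [← Real.exp_add, qf]
    congr 1; field_simp; ring
  · rw [← Real.sqrt_eq_rpow, Real.sqrt_div ht.le, one_div_div, one_div_div]
    ring

lemma theta_hasSum (x : ℝ) {y t : ℝ} (hy : 0 < y) (ht : 0 < t) :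
    HasSum (fun p : ℕ × ℤ => Real.exp (-Real.pi * qf x y (p.1 + 1) p.2 * t))
      (√y / √t * psiE y t + gE x y t) := by
  have h1 : HasSum (fun m : ℕ => √y / √t * Real.exp (-Real.pi * ((m + 1) ^ 2 * y) * t) +
        √y / √t * ∑' k : ℕ, kterm x y (m, k) t) (√y / √t * psiE y t + gE x y t) := by
    refine ((psiE_hasSum hy ht).mul_left _).add ?_
    unfold gE
    refine HasSum.mul_left _ ?_
    have hs := kterm_summable x hy ht
    exact hs.hasSum.prod_fiberwise (fun m => (hs.prod_factor m).hasSum)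
  have hs : Summable (fun p : ℕ × ℤ => Real.exp (-Real.pi * qf x y (p.1 + 1) p.2 * t)) := by
    rw [summable_prod_of_nonneg (fun p => (Real.exp_pos _).le)]
    refine ⟨fun m => (theta_fiber x hy ht m).summable, ?_⟩
    simp only [(theta_fiber x hy ht _).tsum_eq]
    exact h1.summable
  have h2 := hs.hasSum.prod_fiberwise (theta_fiber x hy ht)
  rw [h1.unique h2]
  exact hs.hasSum

lemma mellinConvergent_of_ne_zero {f : ℝ → ℂ} {s : ℂ} (h : mellin f s ≠ 0) : MellinConvergent f s := by
  by_contra hc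
  exact h (MeasureTheory.integral_undef hc)

lemma psiE_mellin {y σ : ℝ} (hy : 0 < y) (hσ : 1 < σ) :
    mellin (fun t => (psiE y t : ℂ)) ((σ : ℂ) - 1 / 2) =
      (y : ℂ) ^ (1 / 2 - (σ : ℂ)) * completedRiemannZeta (2 * σ - 1) := by
  set s : ℂ := (σ : ℂ) - 1 / 2 with hs
  have hre : s.re = σ - 1 / 2 := by simp [hs]
  have h1 := hasSum_mellin_pi_mul (a := fun _ : ℕ => 1) (q := fun m => ((m + 1 : ℝ) ^ 2 * y))
    (F := fun t => (psiE y t : ℂ)) (s := s) (fun m => Or.inr (by positivity)) (by rw [hre]; linarith)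
    (fun t ht => by
      have := (psiE_hasSum hy ht)
      have := (Complex.hasSum_ofReal (f := fun m : ℕ => Real.exp (-Real.pi * ((m + 1) ^ 2 * y) * t))).2 this
      simpa using this)
    (by
      rw [hre]
      have : Summable (fun n : ℕ => 1 / ((n : ℝ)) ^ (2 * σ - 1)) :=
        Real.summable_one_div_nat_rpow.2 (by linarith)
      have := ((summable_nat_add_iff 1).2 this).mul_right (1 / y ^ (σ - 1 / 2))
      refine this.congr (fun m => ?_)
      push_cast
      rw [Real.mul_rpow (by positivity) hy.le, ← Real.rpow_natCast_mul (by positivity)]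
      push_cast
      rw [show 2 * (σ - 1 / 2) = 2 * σ - 1 by ring]
      simp
      ring)
  have h2 := (hasSum_zeta_succ (s := 2 * s) (by simp [hre]; linarith)).mul_left
    ((Real.pi : ℂ) ^ (-s) * Gamma s * (y : ℂ) ^ (-s))
  have h3 := h1.unique (h2.congr_fun ?_)
  · rw [h3, show (1 / 2 - (σ : ℂ)) = -s by rw [hs]; ring, show (2 * (σ : ℂ) - 1) = 2 * s by rw [hs]; ring]
    have hne : (2 * s) ≠ 0 := by
      intro h
      have := congrArg Complex.re h
      simp [hre] at this
      linarith
    rw [riemannZeta_def_of_ne_zero hne]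
    have hG : (2 * s).Gammaℝ ≠ 0 := Complex.Gammaℝ_ne_zero_of_re_pos (by simp [hre]; linarith)
    have hG2 : (2 * s).Gammaℝ = (Real.pi : ℂ) ^ (-s) * Gamma s := by
      rw [Complex.Gammaℝ_def]; congr 2 <;> ring_nf
    rw [← hG2]
    field_simp
  · intro m
    have hm : (0:ℝ) ≤ (m + 1 : ℝ) ^ 2 := by positivity
    rw [Complex.ofReal_mul, Complex.mul_cpow_ofReal_nonneg hm hy.le, Complex.cpow_neg _ (2 * s), Complex.cpow_neg _ s,
       Complex.cpow_neg _ s]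
    have : (((m + 1 : ℝ) ^ 2 : ℝ) : ℂ) ^ s = ((m + 1 : ℝ) : ℂ) ^ (2 * s) := by
      rw [Complex.ofReal_pow, ← Complex.cpow_nat_mul' ]
      · push_cast; ring_nf
      · rw [Complex.arg_ofReal_of_nonneg (by positivity)]; simp [Real.pi_pos]
      · rw [Complex.arg_ofReal_of_nonneg (by positivity)]; simp [Real.pi_pos.le]
    rw [this]
    simp
    ring

def etermR (z : ℂ) (σ : ℝ) (v : ℤ × ℤ) : ℝ := (z.im / normSq (v.1 * z + v.2)) ^ σ

def Ecal (z s : ℂ) : ℂ :=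
  2 * (z.im : ℂ) ^ s * riemannZeta (2 * s) + (Real.pi : ℂ) ^ s * (Gamma s)⁻¹ *
    (2 * ((z.im : ℂ) ^ (1 - s) * completedRiemannZeta (2 * s - 1) +
      mellin (fun t => (gE z.re z.im t : ℂ)) s))

lemma normSq_lin (z : ℂ) (m n : ℤ) : normSq (m * z + n) = (n + m * z.re) ^ 2 + (m * z.im) ^ 2 := by
  rw [normSq_apply]; simp; ring

lemma etermR_eq_qf {z : ℂ} (σ : ℝ) (hz : 0 < z.im) (v : ℤ × ℤ) :
    etermR z σ v = (1 / qf z.re z.im v.1 v.2) ^ σ := by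
  rw [etermR, normSq_lin, qf, one_div_div]

lemma etermR_summable {z : ℂ} (hz : 0 < z.im) {σ : ℝ} (hσ : 1 < σ) : Summable (etermR z σ) := by
  have h1 := (EisensteinSeries.summable_one_div_norm_rpow (k := 2 * σ) (by linarith)).mul_left
    (z.im ^ σ * EisensteinSeries.r ⟨z, hz⟩ ^ (-(2 * σ)))
  have h2 : Summable (fun x : Fin 2 → ℤ => etermR z σ (x 0, x 1)) := by
    refine Summable.of_nonneg_of_le (fun x => ?_) (fun x => ?_) h1
    · exact Real.rpow_nonneg (div_nonneg hz.le (normSq_nonneg _)) _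
    · have := EisensteinSeries.summand_bound ⟨z, hz⟩ (k := 2 * σ) (by linarith) x
      rw [etermR, Real.div_rpow hz.le (normSq_nonneg _), div_eq_mul_inv, ← Real.rpow_neg (normSq_nonneg _),
        normSq_eq_norm_sq, ← Real.rpow_natCast_mul (norm_nonneg _), mul_assoc]
      gcongr
      convert! this using 2
      push_cast; ring
  have := (finTwoArrowEquiv ℤ).symm.summable_iff.2 h2
  simpa [Function.comp_def] using this

lemma qf_pos (x : ℝ) {y : ℝ} (hy : 0 < y) (m : ℕ) (n : ℝ) : 0 < qf x y (m + 1) n := by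
  unfold qf; positivity

lemma Ecal_half {z : ℂ} (hz : 0 < z.im) {σ : ℝ} (hσ : 1 < σ) :
    HasSum (fun p : ℕ × ℤ => ((etermR z σ ((p.1 : ℤ) + 1, p.2) : ℝ) : ℂ))
      ((Real.pi : ℂ) ^ (σ : ℂ) * (Gamma σ)⁻¹ *
    ((z.im : ℂ) ^ (1 - (σ : ℂ)) * completedRiemannZeta (2 * σ - 1) +
      mellin (fun t => (gE z.re z.im t : ℂ)) σ)) := by
  have hinj : Function.Injective (fun p : ℕ × ℤ => (((p.1 : ℤ) + 1, p.2) : ℤ × ℤ)) := by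
    rintro ⟨a, b⟩ ⟨c, d⟩ h
    simp at h
    ext <;> simp [h]
  have hsum := (etermR_summable hz hσ).comp_injective hinj
  have hre : 0 < ((σ : ℂ)).re := by simp; linarith
  have h1 := hasSum_mellin_pi_mul (a := fun _ : ℕ × ℤ => 1) (q := fun p => qf z.re z.im (p.1 + 1) p.2)
    (F := fun t => ((√z.im / √t * psiE z.im t : ℝ) : ℂ) + (gE z.re z.im t : ℂ)) (s := σ)
    (fun m => Or.inr (qf_pos _ hz _ _)) hre
    (fun t ht => by
      have := (theta_hasSum z.re hz ht)
      have := (Complex.hasSum_ofReal).2 this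
      simpa using this)
    (by
      refine hsum.congr (fun p => ?_)
      rw [Function.comp, etermR_eq_qf _ hz, Real.div_rpow zero_le_one]
      · simp
      · push_cast; exact (qf_pos _ hz _ _).le)
  have hm : mellin (fun t => ((√z.im / √t * psiE z.im t : ℝ) : ℂ)) σ =
      (z.im : ℂ) ^ (1 - (σ : ℂ)) * completedRiemannZeta (2 * σ - 1) ∧
      MellinConvergent (fun t => ((√z.im / √t * psiE z.im t : ℝ) : ℂ)) σ := by
    have e1 : mellin (fun t => ((√z.im / √t * psiE z.im t : ℝ) : ℂ)) σ =
        mellin (fun t : ℝ => (√z.im : ℂ) • ((t : ℂ) ^ (-(1 / 2) : ℂ) • (psiE z.im t : ℂ))) σ := by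
      refine MeasureTheory.setIntegral_congr_fun measurableSet_Ioi (fun t ht => ?_)
      have ht : 0 < t := ht
      have : (t : ℂ) ^ (-(1 / 2) : ℂ) = (((√t)⁻¹ : ℝ) : ℂ) := by
        rw [Real.sqrt_eq_rpow, ← Real.rpow_neg ht.le, Complex.ofReal_cpow ht.le]
        push_cast; rfl
      simp only [this, smul_eq_mul]
      push_cast
      ring
    have e2 : mellin (fun t => ((√z.im / √t * psiE z.im t : ℝ) : ℂ)) σ =
      (z.im : ℂ) ^ (1 - (σ : ℂ)) * completedRiemannZeta (2 * σ - 1) := by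
      rw [e1, mellin_const_smul, mellin_cpow_smul, ← sub_eq_add_neg, psiE_mellin hz hσ, smul_eq_mul,
        ← mul_assoc]
      congr 1
      rw [Real.sqrt_eq_rpow, Complex.ofReal_cpow hz.le,
        ← Complex.cpow_add _ _ (by exact_mod_cast hz.ne')]
      congr 1; push_cast; ring
    refine ⟨e2, mellinConvergent_of_ne_zero ?_⟩
    rw [e2]
    refine mul_ne_zero (by simp [Complex.cpow_eq_zero_iff, hz.ne']) ?_
    have hne : (2 * (σ : ℂ) - 1) ≠ 0 := by
      intro h
      have := congrArg Complex.re h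
      simp at this
      linarith
    have hz1 : riemannZeta (2 * σ - 1) ≠ 0 :=
      riemannZeta_ne_zero_of_one_le_re (by simp; linarith)
    rw [riemannZeta_def_of_ne_zero hne] at hz1
    exact (div_ne_zero_iff.1 hz1).1
  have h2 := (hasMellin_add hm.2 (gE_mellinConvergent z.re hz σ)).2
  rw [h2, hm.1] at h1
  have h3 := h1.mul_left ((Real.pi : ℂ) ^ (σ : ℂ) * (Gamma σ)⁻¹)
  refine h3.congr_fun (fun p => ?_)
  have hq := qf_pos z.re hz p.1 p.2
  have hG : Gamma (σ : ℂ) ≠ 0 := Complex.Gamma_ne_zero_of_re_pos hre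
  have hpi : (Real.pi : ℂ) ^ (σ : ℂ) ≠ 0 := by simp [Complex.cpow_eq_zero_iff, Real.pi_ne_zero]
  rw [etermR_eq_qf _ hz, Real.div_rpow zero_le_one (by push_cast; exact hq.le), Real.one_rpow, Complex.cpow_neg]
  push_cast
  rw [Complex.ofReal_cpow hq.le]
  field_simp

lemma Ecal_zero_row {z : ℂ} (hz : 0 < z.im) {σ : ℝ} (hσ : 1 < σ) :
    HasSum (fun n : ℤ => ((etermR z σ (0, n) : ℝ) : ℂ)) (2 * (z.im : ℂ) ^ (σ : ℂ) * riemannZeta (2 * σ)) := by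
  have h1 := (hasSum_zeta_succ (s := 2 * σ) (by simp; linarith)).mul_left ((z.im : ℂ) ^ (σ : ℂ))
  have key : ∀ n : ℕ, ((etermR z σ (0, (n : ℤ) + 1) : ℝ) : ℂ) =
      (z.im : ℂ) ^ (σ : ℂ) * ((n + 1 : ℝ) : ℂ) ^ (-(2 * (σ : ℂ))) := by
    intro n
    rw [etermR, normSq_lin]
    have hn : (0 : ℝ) ≤ n + 1 := by positivity
    push_cast
    simp only [zero_mul, add_zero]
    rw [zero_pow two_ne_zero, add_zero, Real.div_rpow hz.le (by positivity), ← Real.rpow_natCast_mul hn, div_eq_mul_inv, ← Real.rpow_neg hn]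
    push_cast
    rw [Complex.ofReal_cpow hz.le, Complex.ofReal_cpow hn]
    push_cast; rfl
  have key2 : ∀ n : ℕ, ((etermR z σ (0, -((n : ℤ) + 1)) : ℝ) : ℂ) =
      (z.im : ℂ) ^ (σ : ℂ) * ((n + 1 : ℝ) : ℂ) ^ (-(2 * (σ : ℂ))) := by
    intro n
    rw [← key]
    simp only [etermR, normSq_lin]
    push_cast
    ring_nf
  have h2 := HasSum.of_add_one_of_neg_add_one (f := fun n : ℤ => ((etermR z σ (0, n) : ℝ) : ℂ))
    (h1.congr_fun key) (h1.congr_fun key2)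
  convert! h2 using 1
  have : etermR z σ (0, 0) = 0 := by
    simp [etermR, Real.zero_rpow (by linarith : σ ≠ 0)]
  rw [this]
  push_cast; ring

lemma Ecal_hasSum {z : ℂ} (hz : 0 < z.im) {σ : ℝ} (hσ : 1 < σ) :
    HasSum (fun v : ℤ × ℤ => ((etermR z σ v : ℝ) : ℂ)) (Ecal z σ) := by
  have hs : Summable (fun v : ℤ × ℤ => ((etermR z σ v : ℝ) : ℂ)) :=
    Complex.summable_ofReal.2 (etermR_summable hz hσ)
  have h1 := hs.hasSum.prod_fiberwise (fun m => (hs.prod_factor m).hasSum)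
  have hh := Ecal_half hz hσ
  have h2 := hh.prod_fiberwise (fun m => (hh.summable.prod_factor m).hasSum)
  have h3 := HasSum.of_add_one_of_neg_add_one (f := fun m : ℤ => ∑' n, ((etermR z σ (m, n) : ℝ) : ℂ))
    h2 (h2.congr_fun (fun m => by
      rw [← (Equiv.neg ℤ).tsum_eq]
      congr 1
      ext n
      simp only [etermR, normSq_lin, Equiv.neg_apply]
      push_cast
      ring_nf))
  have h4 := h1.unique h3
  have := hs.hasSum
  rw [h4, (Ecal_zero_row hz hσ).tsum_eq] at this
  convert! this using 1
  rw [Ecal]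
  ring

lemma Ecal_differentiableAt {z : ℂ} (hz : 0 < z.im) {s : ℂ} (h1 : s ≠ 1 / 2) (h2 : s ≠ 1) :
    DifferentiableAt ℂ (Ecal z) s := by
  unfold Ecal
  have hy : (z.im : ℂ) ≠ 0 := by exact_mod_cast hz.ne'
  have hpi : (Real.pi : ℂ) ≠ 0 := by exact_mod_cast Real.pi_ne_zero
  have d1 : DifferentiableAt ℂ (fun s : ℂ => riemannZeta (2 * s)) s := by
    have : DifferentiableAt ℂ riemannZeta (2 * s) := differentiableAt_riemannZeta (by
      intro h; apply h1; linear_combination h / 2)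
    exact this.comp s (by fun_prop)
  have d2 : DifferentiableAt ℂ (fun s : ℂ => completedRiemannZeta (2 * s - 1)) s := by
    have : DifferentiableAt ℂ completedRiemannZeta (2 * s - 1) := differentiableAt_completedZeta (by
      intro h; apply h1; linear_combination h / 2) (by
      intro h; apply h2; linear_combination h / 2)
    exact this.comp s (by fun_prop)
  have d3 := (gE_mellin_differentiable z.re hz) s
  have d4 := Complex.differentiable_one_div_Gamma s
  have c1 : DifferentiableAt ℂ (fun s : ℂ => (z.im : ℂ) ^ s) s := by
    exact (differentiableAt_id).const_cpow (Or.inl hy)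
  have c2 : DifferentiableAt ℂ (fun s : ℂ => (z.im : ℂ) ^ (1 - s)) s := by
    exact ((differentiableAt_const _).sub differentiableAt_id).const_cpow (Or.inl hy)
  have c3 : DifferentiableAt ℂ (fun s : ℂ => (Real.pi : ℂ) ^ s) s := by
    exact (differentiableAt_id).const_cpow (Or.inl hpi)
  exact (((differentiableAt_const _).mul c1).mul d1).add
    ((c3.mul d4).mul ((differentiableAt_const _).mul ((c2.mul d2).add d3)))

lemma Ecal_zero (z : ℂ) : Ecal z 0 = -1 := by
  simp [Ecal, riemannZeta_zero, Complex.Gamma_zero]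
  norm_num

lemma hasDerivAt_inv_Gamma_zero : HasDerivAt (fun s : ℂ => (Gamma s)⁻¹) 1 0 := by
  have h : (fun s : ℂ => (Gamma s)⁻¹) = fun s => s * (Gamma (s + 1))⁻¹ := by
    ext s; exact Complex.one_div_Gamma_eq_self_mul_one_div_Gamma_add_one s
  rw [h]
  have d : DifferentiableAt ℂ (fun s : ℂ => (Gamma (s + 1))⁻¹) 0 :=
    (Complex.differentiable_one_div_Gamma.comp (differentiable_id.add_const 1)) 0
  have := (hasDerivAt_id (0:ℂ)).mul d.hasDerivAt
  refine this.congr_deriv ?_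
  simp

lemma completedZeta_neg_one : completedRiemannZeta (-1) = Real.pi / 6 := by
  have h := completedRiemannZeta_one_sub 2
  rw [show (1 - 2 : ℂ) = -1 by norm_num] at h
  rw [h]
  have h2 := riemannZeta_def_of_ne_zero (two_ne_zero : (2:ℂ) ≠ 0)
  have hG : (2:ℂ).Gammaℝ = (Real.pi : ℂ)⁻¹ := by
    rw [Complex.Gammaℝ_def]
    simp [Complex.cpow_neg_one]
  have hpi : (Real.pi : ℂ) ≠ 0 := by exact_mod_cast Real.pi_ne_zero
  rw [riemannZeta_two, hG] at h2
  field_simp at h2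
  field_simp
  linear_combination -h2

lemma Phi_pos {z : ℂ} (hz : 0 < z.im) : 0 < Phi z := by
  obtain ⟨b, hb, -⟩ := gE_mellin_zero z.re hz
  rw [Phi, eta_norm hz hb]
  positivity

lemma Ecal_hasDerivAt_zero {z : ℂ} (hz : 0 < z.im) :
    HasDerivAt (Ecal z) ((-Real.log (4 * Real.pi ^ 2 * Phi z) : ℝ) : ℂ) 0 := by
  have hy : (z.im : ℂ) ≠ 0 := by exact_mod_cast hz.ne'
  have hpi : (Real.pi : ℂ) ≠ 0 := by exact_mod_cast Real.pi_ne_zero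
  obtain ⟨b, hb, hmb⟩ := gE_mellin_zero z.re hz
  have d1 : HasDerivAt (fun s : ℂ => riemannZeta (2 * s)) (-Complex.log (2 * Real.pi)) 0 := by
    have : DifferentiableAt ℂ riemannZeta (2 * 0) := differentiableAt_riemannZeta (by simp)
    have h := this.hasDerivAt.comp (0:ℂ) ((hasDerivAt_id (0:ℂ)).const_mul 2)
    refine h.congr_deriv ?_
    rw [mul_zero, deriv_riemannZeta_zero]; ring
  have d2 : DifferentiableAt ℂ (fun s : ℂ => completedRiemannZeta (2 * s - 1)) 0 := by
    have : DifferentiableAt ℂ completedRiemannZeta (2 * 0 - 1) := differentiableAt_completedZeta (by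
      norm_num) (by norm_num)
    exact this.comp (0:ℂ) (by fun_prop)
  have d3 := (gE_mellin_differentiable z.re hz) 0
  have d4 := hasDerivAt_inv_Gamma_zero
  have c1 : HasDerivAt (fun s : ℂ => (z.im : ℂ) ^ s) (Complex.log z.im) 0 := by
    have := (hasDerivAt_id (0:ℂ)).const_cpow (c := (z.im : ℂ)) (Or.inl hy)
    simpa using this
  have c2 : DifferentiableAt ℂ (fun s : ℂ => (z.im : ℂ) ^ (1 - s)) 0 := by
    exact ((differentiableAt_const _).sub differentiableAt_id).const_cpow (Or.inl hy)
  have c3 : HasDerivAt (fun s : ℂ => (Real.pi : ℂ) ^ s) (Complex.log Real.pi) 0 := by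
    have := (hasDerivAt_id (0:ℂ)).const_cpow (c := (Real.pi : ℂ)) (Or.inl hpi)
    simpa using this
  have v := ((differentiableAt_const (2:ℂ)).mul ((c2.mul d2).add d3)).hasDerivAt
  have := (((hasDerivAt_const (0:ℂ) (2:ℂ)).mul c1).mul d1).add ((c3.mul d4).mul v)
  refine this.congr_deriv ?_
  have hlog : Real.log (4 * Real.pi ^ 2 * Phi z) =
      2 * Real.log (2 * Real.pi) + Real.log z.im - Real.pi * z.im / 3 - 2 * b := by
    rw [Phi, eta_norm hz hb, ← Real.exp_add, ← Real.exp_nat_mul, show 4 * Real.pi ^ 2 = (2 * Real.pi) ^ 2 by ring,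
      Real.log_mul (by positivity) (by positivity), Real.log_mul hz.ne' (Real.exp_pos _).ne', Real.log_exp,
      Real.log_pow]
    push_cast; ring
  rw [hlog]
  have l1 : Complex.log (2 * Real.pi) = ((Real.log (2 * Real.pi) : ℝ) : ℂ) := by
    rw [Complex.ofReal_log (by positivity)]; push_cast; rfl
  rw [l1, ← Complex.ofReal_log hz.le, ← Complex.ofReal_log Real.pi_pos.le]
  simp only [Pi.mul_apply, Pi.add_apply, hmb, mul_zero, zero_sub, completedZeta_neg_one, Complex.cpow_zero, Complex.Gamma_zero, inv_zero, sub_zero,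
    riemannZeta_zero, Complex.cpow_one]
  push_cast
  ring

lemma kron_mul (D : ℤ) {m n : ℕ} (hm : m ≠ 0) (hn : n ≠ 0) : kron D (m * n) = kron D m * kron D n := by
  unfold kron
  rw [Nat.ordCompl_mul, Nat.factorization_mul hm hn, jacobiSym.mul_right']
  · simp only [Finsupp.coe_add, Pi.add_apply, pow_add]; ring
  · exact (Nat.ordCompl_pos 2 hm).ne'
  · exact (Nat.ordCompl_pos 2 hn).ne'

lemma kron_odd (D : ℤ) {n : ℕ} (hn : Odd n) : kron D n = jacobiSym D n := by
  have : n.factorization 2 = 0 := Nat.factorization_eq_zero_of_not_dvd (by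
    rw [← even_iff_two_dvd]; exact Nat.not_even_iff_odd.2 hn)
  simp [kron, this]

lemma kron_one (D : ℤ) : kron D 1 = 1 := by
  rw [kron_odd D odd_one, jacobiSym.one_right]

lemma kron_two (D : ℤ) : kron D 2 = kron2 D := by
  have : Nat.factorization 2 2 = 1 := by simp [Nat.Prime.factorization_self Nat.prime_two]
  simp [kron, this]

lemma kron_pow (D : ℤ) {n : ℕ} (hn : n ≠ 0) (k : ℕ) : kron D (n ^ k) = kron D n ^ k := by
  induction k with
  | zero => simp [kron_one]
  | succ k ih => rw [pow_succ, kron_mul D (pow_ne_zero _ hn) hn, ih, pow_succ]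

lemma jacobi_odd_eq {D : ℤ} (hD : D < 0) (h : D % 4 = 1) {b : ℕ} (hb : Odd b) :
    jacobiSym D b = jacobiSym b D.natAbs := by
  have e : D = -(D.natAbs : ℤ) := by omega
  have h3 : D.natAbs % 4 = 3 := by omega
  have e2 : jacobiSym D b = ZMod.χ₄ b * jacobiSym (D.natAbs : ℤ) b := by
    conv_lhs => rw [e]
    exact jacobiSym.neg _ hb
  rw [e2]
  rcases Nat.odd_mod_four_iff.1 (Nat.odd_iff.1 hb) with h1 | h1
  · rw [ZMod.χ₄_nat_one_mod_four h1, one_mul]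
    exact (jacobiSym.quadratic_reciprocity_one_mod_four h1 (Nat.odd_iff.2 (by omega))).symm
  · rw [ZMod.χ₄_nat_three_mod_four h1, jacobiSym.quadratic_reciprocity_three_mod_four h3 h1]
    ring

lemma kron_odd_disc {D : ℤ} (hD : D < 0) (h : D % 4 = 1) {n : ℕ} (hn : n ≠ 0) :
    kron D n = jacobiSym n D.natAbs := by
  have hodd : Odd D.natAbs := Nat.odd_iff.2 (by omega)
  obtain ⟨a, b, hb, rfl⟩ := Nat.exists_eq_two_pow_mul_odd hn
  have hb0 : b ≠ 0 := by rintro rfl; simp at hb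
  rw [kron_mul D (by positivity) hb0, kron_pow D two_ne_zero, kron_two, kron_odd D hb,
    jacobi_odd_eq hD h hb]
  push_cast
  rw [jacobiSym.mul_left, jacobiSym.pow_left, jacobiSym.at_two hodd]
  congr 2
  rw [kron2, ZMod.χ₈_nat_eq_if_mod_eight]
  split_ifs <;> omega

lemma kron_even_of_even {D : ℤ} (h : D % 4 = 0) {n : ℕ} (hn : n ≠ 0) (he : Even n) : kron D n = 0 := by
  obtain ⟨k, rfl⟩ := even_iff_two_dvd.1 he
  have hk : k ≠ 0 := by rintro rfl; simp at hn
  rw [kron_mul D two_ne_zero hk, kron_two, kron2, if_pos (by omega), zero_mul]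

lemma kron_even_disc_odd {D : ℤ} (h : D % 4 = 0) {n : ℕ} (hn : Odd n) :
    kron D n = jacobiSym (D / 4) (n % D.natAbs) := by
  obtain ⟨d, rfl⟩ : ∃ d, D = 4 * d := ⟨D / 4, by omega⟩
  have : 4 * d / 4 = d := by omega
  rw [kron_odd _ hn, this, jacobiSym.mul_left, show (4:ℤ) = 2 ^ 2 by norm_num, jacobiSym.pow_left,
    jacobiSym.sq_one, one_mul, jacobiSym.mod_right d hn]
  · congr 2
    rw [Int.natAbs_mul]; rfl
  · rw [Int.gcd_comm]
    have := hn.coprime_two_right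
    simpa [Int.gcd] using this

lemma kron_periodic {D : ℤ} (hD : D < 0) (h : D % 4 = 0 ∨ D % 4 = 1) {m n : ℕ} (hm : m ≠ 0) (hn : n ≠ 0)
    (hmn : m % D.natAbs = n % D.natAbs) : kron D m = kron D n := by
  rcases h with h | h
  · have h2 : 2 ∣ D.natAbs := by omega
    have hp : m % 2 = n % 2 := by
      rw [← Nat.mod_mod_of_dvd m h2, hmn, Nat.mod_mod_of_dvd n h2]
    rcases Nat.even_or_odd m with he | ho
    · have he' : Even n := Nat.even_iff.2 (by have := Nat.even_iff.1 he; omega)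
      rw [kron_even_of_even h hm he, kron_even_of_even h hn he']
    · have ho' : Odd n := Nat.odd_iff.2 (by have := Nat.odd_iff.1 ho; omega)
      rw [kron_even_disc_odd h ho, kron_even_disc_odd h ho', hmn]
  · rw [kron_odd_disc hD h hm, kron_odd_disc hD h hn]
    apply jacobiSym.mod_left'
    exact_mod_cast congrArg (Nat.cast : ℕ → ℤ) hmn

lemma kron_self {D : ℤ} (hD : D < 0) (h : D % 4 = 0 ∨ D % 4 = 1) : kron D D.natAbs = 0 := by
  rcases h with h | h
  · exact kron_even_of_even h (by omega) (Nat.even_iff.2 (by omega))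
  · rw [kron_odd_disc hD h (by omega), jacobiSym.eq_zero_iff]
    refine ⟨by omega, ?_⟩
    simp only [Int.gcd, Int.natAbs_natCast, Nat.gcd_self]
    omega

lemma kron_neg_one {D : ℤ} (hD : D < 0) (h : D % 4 = 0 ∨ D % 4 = 1) : kron D (D.natAbs - 1) = -1 := by
  rcases h with h | h
  · have ho : Odd (D.natAbs - 1) := Nat.odd_iff.2 (by omega)
    rw [kron_odd _ ho]
    have e : D = -(D.natAbs : ℤ) := by omega
    have e2 : jacobiSym D (D.natAbs - 1) = ZMod.χ₄ ((D.natAbs - 1 : ℕ) : ZMod 4) * jacobiSym (D.natAbs : ℤ) (D.natAbs - 1) := by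
      rw [← jacobiSym.neg _ ho, ← e]
    rw [e2, ZMod.χ₄_nat_three_mod_four (by omega)]
    have : jacobiSym (D.natAbs : ℤ) (D.natAbs - 1) = jacobiSym 1 (D.natAbs - 1) := by
      apply jacobiSym.mod_left'
      have : (D.natAbs : ℤ) = 1 + ((D.natAbs - 1 : ℕ) : ℤ) := by omega
      conv_lhs => rw [this, Int.add_emod_right]
    rw [this, jacobiSym.one_left]; rfl
  · have hodd : Odd D.natAbs := Nat.odd_iff.2 (by omega)
    rw [kron_odd_disc hD h (by omega)]
    have : jacobiSym ((D.natAbs - 1 : ℕ) : ℤ) D.natAbs = jacobiSym (-1) D.natAbs := by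
      apply jacobiSym.mod_left'
      have : ((D.natAbs - 1 : ℕ) : ℤ) = -1 + (D.natAbs : ℤ) := by omega
      rw [this, Int.add_emod_right]
    rw [this, jacobiSym.at_neg_one hodd, ZMod.χ₄_nat_three_mod_four (by omega)]

/-- The Kronecker character as a function on residues -/
def PsiD (D : ℤ) : ZMod D.natAbs → ℂ := fun j => if j = 0 then 0 else (kron D j.val : ℂ)

lemma PsiD_natCast {D : ℤ} (hD : D < 0) (h : D % 4 = 0 ∨ D % 4 = 1) {n : ℕ} (hn : n ≠ 0) :
    PsiD D (n : ZMod D.natAbs) = (kron D n : ℂ) := by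
  have : NeZero D.natAbs := ⟨by omega⟩
  unfold PsiD
  split_ifs with h0
  · rw [ZMod.natCast_eq_zero_iff] at h0
    rw [kron_periodic hD h hn (n := D.natAbs) (by omega) (by simpa using Nat.mod_eq_zero_of_dvd h0), kron_self hD h]
    simp
  · rw [ZMod.val_natCast]
    rw [ZMod.natCast_eq_zero_iff] at h0
    rw [kron_periodic hD h (m := n % D.natAbs) (n := n) (fun h1 => h0 (Nat.dvd_of_mod_eq_zero h1)) hn (Nat.mod_mod _ _)]

lemma PsiD_neg {D : ℤ} (hD : D < 0) (h : D % 4 = 0 ∨ D % 4 = 1) (j : ZMod D.natAbs) :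
    PsiD D (-j) = -PsiD D j := by
  have : NeZero D.natAbs := ⟨by omega⟩
  by_cases h0 : j = 0
  · simp [h0, PsiD]
  have hv : j.val ≠ 0 := by rwa [ne_eq, ZMod.val_eq_zero]
  have hf : D.natAbs - 1 ≠ 0 := by omega
  have e : -j = (((D.natAbs - 1) * j.val : ℕ) : ZMod D.natAbs) := by
    rw [Nat.cast_mul, Nat.cast_sub (by omega)]
    simp
  have e2 : j = ((j.val : ℕ) : ZMod D.natAbs) := by simp
  rw [e, PsiD_natCast hD h (mul_ne_zero hf hv), kron_mul D hf hv, kron_neg_one hD h]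
  conv_rhs => rw [e2]
  rw [PsiD_natCast hD h hv]
  push_cast; ring

lemma PsiD_sum {D : ℤ} [NeZero D.natAbs] (hD : D < 0) (h : D % 4 = 0 ∨ D % 4 = 1) :
    ∑ j : ZMod D.natAbs, PsiD D j = 0 := by
  have h1 : ∑ j : ZMod D.natAbs, PsiD D j = ∑ j : ZMod D.natAbs, PsiD D (-j) :=
    (Equiv.sum_comp (Equiv.neg _) _).symm
  simp_rw [PsiD_neg hD h, Finset.sum_neg_distrib] at h1
  exact self_eq_neg.1 h1

lemma sum_PsiD {D : ℤ} [NeZero D.natAbs] (hD : D < 0) (h : D % 4 = 0 ∨ D % 4 = 1) (g : ℕ → ℂ) :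
    ∑ j : ZMod D.natAbs, PsiD D j * g j.val =
      ∑ j ∈ Finset.Icc 1 (D.natAbs - 1), (kron D j : ℂ) * g j := by
  have h0 : ∑ j : ZMod D.natAbs, PsiD D j * g j.val =
      ∑ j ∈ Finset.univ.erase (0 : ZMod D.natAbs), PsiD D j * g j.val := by
    rw [Finset.sum_erase]; simp [PsiD]
  rw [h0]
  symm
  refine Finset.sum_nbij' (fun j => (j : ZMod D.natAbs)) ZMod.val ?_ ?_ ?_ ?_ ?_
  · intro j hj
    rw [Finset.mem_Icc] at hj
    simp only [Finset.mem_erase, Finset.mem_univ, and_true]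
    rw [ne_eq, ZMod.natCast_eq_zero_iff]
    exact Nat.not_dvd_of_pos_of_lt (by omega) (by omega)
  · intro j hj
    simp only [Finset.mem_erase, Finset.mem_univ, and_true] at hj
    have : j.val ≠ 0 := by rwa [ne_eq, ZMod.val_eq_zero]
    have := ZMod.val_lt j
    rw [Finset.mem_Icc]; omega
  · intro j hj
    rw [Finset.mem_Icc] at hj
    rw [ZMod.val_natCast, Nat.mod_eq_of_lt (by omega)]
  · intro j hj; simp
  · intro j hj
    rw [Finset.mem_Icc] at hj
    rw [ZMod.val_natCast, Nat.mod_eq_of_lt (by omega), PsiD_natCast hD h (by omega)]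

open Filter Topology Set in
lemma eqOn_of_real {G H : ℂ → ℂ} (hG : ∀ s, s ≠ 1 / 2 → s ≠ 1 → DifferentiableAt ℂ G s)
    (hH : ∀ s, s ≠ 1 / 2 → s ≠ 1 → DifferentiableAt ℂ H s)
    (h : ∀ σ : ℝ, 1 < σ → G σ = H σ) : ∀ s, s ≠ 1 / 2 → s ≠ 1 → G s = H s := by
  set U : Set ℂ := ({1 / 2, 1} : Set ℂ)ᶜ with hU
  have hop : IsOpen U := (Set.toFinite _).isClosed.isOpen_compl
  have hmem : ∀ s, s ∈ U ↔ s ≠ 1 / 2 ∧ s ≠ 1 := by intro s; simp [hU]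
  have hconn : IsPreconnected U := by
    refine (Set.Countable.isConnected_compl_of_one_lt_rank ?_ (Set.toFinite _).countable).isPreconnected
    rw [Complex.rank_real_complex]; norm_num
  have aG : AnalyticOnNhd ℂ G U := DifferentiableOn.analyticOnNhd
    (fun s hs => (hG s ((hmem s).1 hs).1 ((hmem s).1 hs).2).differentiableWithinAt) hop
  have aH : AnalyticOnNhd ℂ H U := DifferentiableOn.analyticOnNhd
    (fun s hs => (hH s ((hmem s).1 hs).1 ((hmem s).1 hs).2).differentiableWithinAt) hop
  have h2 : (2 : ℂ) ∈ U := by rw [hmem]; norm_num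
  have hf : ∃ᶠ s in 𝓝[≠] (2:ℂ), G s = H s := by
    have ht : Tendsto (fun x : ℝ => (x : ℂ)) (𝓝[≠] (2:ℝ)) (𝓝[≠] (2:ℂ)) := by
      refine tendsto_nhdsWithin_iff.2 ⟨?_, ?_⟩
      · have := (Complex.continuous_ofReal.tendsto (2:ℝ)).mono_left (nhdsWithin_le_nhds (s := {2}ᶜ))
        simpa using this
      · filter_upwards [self_mem_nhdsWithin] with x hx
        simp only [mem_compl_iff, mem_singleton_iff] at hx ⊢
        exact_mod_cast hx
    refine ht.frequently ?_
    apply Eventually.frequently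
    filter_upwards [nhdsWithin_le_nhds (lt_mem_nhds (by norm_num : (1:ℝ) < 2))] with x hx using h x hx
  have := aG.eqOn_of_preconnected_of_frequently_eq aH hconn h2 hf
  intro s h1 h3
  exact this ((hmem s).2 ⟨h1, h3⟩)

lemma final_step {D : ℤ} (hD : D < 0) (h : D % 4 = 0 ∨ D % 4 = 1) [NeZero D.natAbs] (R : Finset ℂ)
    (hR : ∀ z ∈ R, 0 < z.im) (w : ℕ) (hw : w ≠ 0)
    (hC : ∀ σ : ℝ, 1 < σ → ∑ z ∈ R, ((2 / √(D.natAbs : ℝ) : ℝ) : ℂ) ^ (σ : ℂ) * Ecal z σ =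
      w * riemannZeta σ * ZMod.LFunction (PsiD D) σ) :
    ∏ z ∈ R, (4 * Real.pi * Real.sqrt |(D : ℝ)| * Phi z) ^ ((2 : ℝ) / (w : ℝ)) =
        ∏ j ∈ Finset.Icc 1 (D.natAbs - 1),
          Real.Gamma ((j : ℝ) / (D.natAbs : ℝ)) ^ (kron D j) := by
  have hf : 0 < (D.natAbs : ℝ) := by
    have : 0 < D.natAbs := by omega
    exact_mod_cast this
  have habs : |(D : ℝ)| = (D.natAbs : ℝ) := by
    rw [Nat.cast_natAbs]; push_cast; rfl
  rw [habs]
  set f : ℝ := (D.natAbs : ℝ) with hfdef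
  have hsf : 0 < √f := Real.sqrt_pos.2 hf
  set c : ℝ := 2 / √f with hc
  have hc0 : 0 < c := by positivity
  have hcc : (c : ℂ) ≠ 0 := by exact_mod_cast hc0.ne'
  set L : ℂ → ℂ := ZMod.LFunction (PsiD D) with hL
  have dL : Differentiable ℂ L := ZMod.differentiable_LFunction_of_sum_zero (PsiD_sum hD h)
  set G : ℂ → ℂ := fun s => ∑ z ∈ R, (c : ℂ) ^ s * Ecal z s with hGdef
  set H : ℂ → ℂ := fun s => w * riemannZeta s * L s with hHdef
  have hGH : ∀ s, s ≠ 1 / 2 → s ≠ 1 → G s = H s := by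
    refine eqOn_of_real (fun s h1 h2 => ?_) (fun s h1 h2 => ?_) hC
    · refine DifferentiableAt.fun_sum (fun z hz => ?_)
      exact ((differentiableAt_id).const_cpow (Or.inl hcc)).mul (Ecal_differentiableAt (hR z hz) h1 h2)
    · exact ((differentiableAt_const _).mul (differentiableAt_riemannZeta h2)).mul (dL s)
  have hev : G =ᶠ[nhds 0] H := by
    have : ({1 / 2, 1} : Set ℂ)ᶜ ∈ nhds (0:ℂ) :=
      (Set.toFinite _).isClosed.isOpen_compl.mem_nhds (by simp)
    filter_upwards [this] with s hs
    simp at hs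
    exact hGH s (by simpa using hs.1) hs.2
  have h00 : G 0 = H 0 := hev.self_of_nhds
  have hL0 : (w : ℂ) * L 0 = 2 * (R.card : ℂ) := by
    simp only [hGdef, hHdef, Ecal_zero, Complex.cpow_zero, riemannZeta_zero, Finset.sum_const, nsmul_eq_mul] at h00
    linear_combination 2 * h00
  have dG : HasDerivAt G (∑ z ∈ R, (Complex.log c * Ecal z 0 + (c : ℂ) ^ (0:ℂ) * ((-Real.log (4 * Real.pi ^ 2 * Phi z) : ℝ) : ℂ))) 0 := by
    refine HasDerivAt.fun_sum (fun z hz => ?_)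
    have c1 : HasDerivAt (fun s : ℂ => (c : ℂ) ^ s) (Complex.log c) 0 := by
      have := (hasDerivAt_id (0:ℂ)).const_cpow (c := (c : ℂ)) (Or.inl hcc)
      simpa using this
    exact c1.mul (Ecal_hasDerivAt_zero (hR z hz))
  set S : ℂ := ∑ j : ZMod D.natAbs, PsiD D j * (Real.log (Real.Gamma ((j.val:ℝ)/D.natAbs)) : ℝ) with hS
  have dL0 : HasDerivAt L (-(Real.log f : ℂ) * L 0 + S) 0 :=
    LFunction_hasDerivAt_zero (PsiD D) (by simp [PsiD]) (PsiD_sum hD h)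
  have dz : HasDerivAt riemannZeta (-Complex.log (2 * Real.pi) / 2) 0 := by
    have := (differentiableAt_riemannZeta (s := 0) (by simp)).hasDerivAt
    rwa [deriv_riemannZeta_zero] at this
  have dH : HasDerivAt H (w * (-Complex.log (2 * Real.pi) / 2) * L 0 + w * riemannZeta 0 * (-(Real.log f : ℂ) * L 0 + S)) 0 := by
    exact (dz.const_mul (w : ℂ)).mul dL0
  have hder := (dG.congr_of_eventuallyEq hev.symm).unique dH
  have l1 : Complex.log (2 * Real.pi) = ((Real.log (2 * Real.pi) : ℝ) : ℂ) := by
    rw [Complex.ofReal_log (by positivity)]; push_cast; rfl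
  have hS2 : S = ((∑ j ∈ Finset.Icc 1 (D.natAbs - 1), (kron D j : ℝ) * Real.log (Real.Gamma ((j : ℝ) / D.natAbs)) : ℝ) : ℂ) := by
    rw [hS, sum_PsiD hD h (fun j => (Real.log (Real.Gamma ((j:ℝ)/D.natAbs)) : ℝ))]
    push_cast; rfl
  rw [l1, ← Complex.ofReal_log hc0.le, riemannZeta_zero] at hder
  simp only [Ecal_zero, Complex.cpow_zero, one_mul] at hder
  have hw0 : (w : ℝ) ≠ 0 := by exact_mod_cast hw
  have hkey : ∑ j ∈ Finset.Icc 1 (D.natAbs - 1), (kron D j : ℝ) * Real.log (Real.Gamma ((j : ℝ) / D.natAbs)) =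
      (2 / w) * ∑ z ∈ R, Real.log (4 * Real.pi * √f * Phi z) := by
    have hz : ∀ z ∈ R, Real.log (4 * Real.pi * √f * Phi z) = Real.log (4 * Real.pi ^ 2 * Phi z) +
        (Real.log c + Real.log f - Real.log (2 * Real.pi)) := by
      intro z hz
      have hP := Phi_pos (hR z hz)
      have hsq : √f * √f = f := Real.mul_self_sqrt hf.le
      have : 4 * Real.pi * √f * Phi z = (4 * Real.pi ^ 2 * Phi z) * (c * f / (2 * Real.pi)) := by
        rw [hc]; field_simp; linear_combination hsq
      rw [this, Real.log_mul (by positivity) (by positivity), Real.log_div (by positivity) (by positivity),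
        Real.log_mul hc0.ne' hf.ne']
    rw [Finset.sum_congr rfl hz, Finset.sum_add_distrib, Finset.sum_const, nsmul_eq_mul]
    rw [hS2] at hder
    set T : ℝ := ∑ j ∈ Finset.Icc 1 (D.natAbs - 1), (kron D j : ℝ) * Real.log (Real.Gamma ((j : ℝ) / D.natAbs)) with hT
    rw [Finset.sum_add_distrib, Finset.sum_const, nsmul_eq_mul, ← Complex.ofReal_sum] at hder
    have : ((w * T : ℝ) : ℂ) = ((2 * (-(∑ z ∈ R, -Real.log (4 * Real.pi ^ 2 * Phi z)) + R.card * (Real.log c + Real.log f - Real.log (2 * Real.pi))) : ℝ) : ℂ) := by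
      push_cast at hder ⊢
      linear_combination 2 * hder + (Real.log f - Real.log (2 * Real.pi)) * hL0
    have := Complex.ofReal_injective this
    rw [Finset.sum_neg_distrib, neg_neg] at this
    field_simp
    rw [mul_comm T]; exact this
  have hl : ∀ z ∈ R, 0 < (4 * Real.pi * √f * Phi z) := fun z hz => by
    have hP := Phi_pos (hR z hz)
    positivity
  have hr : ∀ j ∈ Finset.Icc 1 (D.natAbs - 1), 0 < Real.Gamma ((j : ℝ) / f) := fun j hj => by
    rw [Finset.mem_Icc] at hj
    have : (0:ℝ) < j := by exact_mod_cast (by omega : 0 < j)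
    exact Real.Gamma_pos_of_pos (by positivity)
  apply Real.log_injOn_pos
  · exact Finset.prod_pos (fun z hz => Real.rpow_pos_of_pos (hl z hz) _)
  · exact Finset.prod_pos (fun j hj => zpow_pos (hr j hj) _)
  rw [Real.log_prod (fun z hz => (Real.rpow_pos_of_pos (hl z hz) _).ne'),
    Real.log_prod (fun j hj => (zpow_pos (hr j hj) _).ne')]
  simp only [Real.log_zpow]
  rw [hkey, Finset.mul_sum]
  exact Finset.sum_congr rfl (fun z hz => Real.log_rpow (hl z hz) _)

/-- coefficients of a binary quadratic form -/
abbrev QF := ℤ × ℤ × ℤ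

/-- action of `SL(2,ℤ)` on forms, compatible with the action on roots -/
def qact (g : SL2Z) (F : QF) : QF :=
  (F.1 * g.1 1 1 ^ 2 - F.2.1 * g.1 1 1 * g.1 1 0 + F.2.2 * g.1 1 0 ^ 2,
   -2 * F.1 * g.1 1 1 * g.1 0 1 + F.2.1 * (g.1 1 1 * g.1 0 0 + g.1 0 1 * g.1 1 0) - 2 * F.2.2 * g.1 1 0 * g.1 0 0,
   F.1 * g.1 0 1 ^ 2 - F.2.1 * g.1 0 1 * g.1 0 0 + F.2.2 * g.1 0 0 ^ 2)

def IsQF (D : ℤ) (F : QF) : Prop := 0 < F.1 ∧ F.2.1 ^ 2 - 4 * F.1 * F.2.2 = D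

/-- root of the form in the upper half plane -/
def IsQRoot (F : QF) (z : ℂ) : Prop := 0 < z.im ∧ (F.1 : ℂ) * z ^ 2 + (F.2.1 : ℂ) * z + (F.2.2 : ℂ) = 0

lemma sl_det (g : SL2Z) : g.1 0 0 * g.1 1 1 - g.1 0 1 * g.1 1 0 = 1 := by
  have := g.2; rwa [Matrix.det_fin_two] at this

lemma qact_one (F : QF) : qact 1 F = F := by
  obtain ⟨a, b, c⟩ := F
  simp [qact]

lemma qact_mul (g h : SL2Z) (F : QF) : qact (g * h) F = qact g (qact h F) := by
  obtain ⟨a, b, c⟩ := F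
  simp only [qact, Matrix.SpecialLinearGroup.coe_mul, Matrix.mul_apply, Fin.sum_univ_two, Prod.mk.injEq]
  refine ⟨?_, ?_, ?_⟩ <;> ring

lemma qact_inv (g : SL2Z) (F : QF) : qact g⁻¹ (qact g F) = F := by
  rw [← qact_mul, inv_mul_cancel, qact_one]

lemma qact_inv' (g : SL2Z) (F : QF) : qact g (qact g⁻¹ F) = F := by
  rw [← qact_mul, mul_inv_cancel, qact_one]

lemma posdef_aux {a b c D : ℤ} (ha : 0 < a) (hD : D < 0) (h : b ^ 2 - 4 * a * c = D) (m n : ℤ)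
    (hmn : ¬ (m = 0 ∧ n = 0)) : 0 < a * n ^ 2 - b * n * m + c * m ^ 2 := by
  by_cases hm : m = 0
  · have hn : n ≠ 0 := fun h => hmn ⟨hm, h⟩
    subst hm
    have : 0 < n ^ 2 := by positivity
    nlinarith
  · have h1 : 4 * a * (a * n ^ 2 - b * n * m + c * m ^ 2) = (2 * a * n - b * m) ^ 2 + (-D) * m ^ 2 := by
      rw [← h]; ring
    have h2 : 0 < (-D) * m ^ 2 := by
      have : 0 < -D := by omega
      positivity
    have h3 : 0 < 4 * a * (a * n ^ 2 - b * n * m + c * m ^ 2) := by rw [h1]; positivity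
    exact pos_of_mul_pos_right h3 (by omega)

lemma qact_isQF {D : ℤ} (hD : D < 0) {F : QF} (hF : IsQF D F) (g : SL2Z) : IsQF D (qact g F) := by
  obtain ⟨a, b, c⟩ := F
  obtain ⟨ha, hd⟩ := hF
  simp only at ha hd
  have hdet := sl_det g
  constructor
  · apply posdef_aux ha hD hd
    rintro ⟨h1, h2⟩
    rw [h1, h2] at hdet; simp at hdet
  · simp only [qact]
    rw [← hd]
    linear_combination (b ^ 2 - 4 * a * c) * (g.1 0 0 * g.1 1 1 - g.1 0 1 * g.1 1 0 + 1) * hdet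

lemma isQRoot_unique {D : ℤ} {F : QF} (hF : IsQF D F) {z w : ℂ} (hz : IsQRoot F z)
    (hw : IsQRoot F w) : z = w := by
  obtain ⟨a, b, c⟩ := F
  obtain ⟨hz0, hz⟩ := hz
  obtain ⟨hw0, hw⟩ := hw
  obtain ⟨ha, -⟩ := hF
  simp only at *
  have h : (z - w) * ((a : ℂ) * (z + w) + b) = 0 := by linear_combination hz - hw
  rcases mul_eq_zero.1 h with h | h
  · exact sub_eq_zero.1 h
  · have := congrArg Complex.im h
    simp at this
    have ha' : (0:ℝ) < a := by exact_mod_cast ha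
    rcases this with h | h
    · omega
    · linarith

lemma isQRoot_re_im {F : QF} {z : ℂ} (hz : IsQRoot F z) :
    2 * F.1 * z.re = -(F.2.1 : ℝ) ∧ (F.1 : ℝ) * normSq z = F.2.2 := by
  obtain ⟨a, b, c⟩ := F
  obtain ⟨hz0, hz⟩ := hz
  simp only at *
  have h1 := congrArg Complex.re hz
  have h2 := congrArg Complex.im hz
  simp [pow_two] at h1 h2
  have h3 : 2 * (a:ℝ) * z.re = -(b : ℝ) := by
    have : z.im * (2 * (a:ℝ) * z.re + b) = 0 := by linear_combination h2
    rcases mul_eq_zero.1 this with h | h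
    · exact absurd h hz0.ne'
    · linarith
  refine ⟨h3, ?_⟩
  rw [normSq_apply]
  linear_combination -h1 + z.re * h3

lemma isQRoot_form_unique {D : ℤ} (hD : D < 0) {F G : QF} (hF : IsQF D F) (hG : IsQF D G) {z : ℂ}
    (h1 : IsQRoot F z) (h2 : IsQRoot G z) : F = G := by
  obtain ⟨a, b, c⟩ := F
  obtain ⟨a', b', c'⟩ := G
  obtain ⟨e1, e2⟩ := isQRoot_re_im h1
  obtain ⟨e3, e4⟩ := isQRoot_re_im h2
  obtain ⟨ha, hd⟩ := hF
  obtain ⟨ha', hd'⟩ := hG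
  simp only at *
  have har : (0:ℝ) < a := by exact_mod_cast ha
  have har' : (0:ℝ) < a' := by exact_mod_cast ha'
  have k1 : (a' : ℝ) * b = a * b' := by linear_combination a' * e1 - a * e3
  have k2 : (a' : ℝ) * c = a * c' := by linear_combination a * e4 - a' * e2
  have k1' : a' * b = a * b' := by exact_mod_cast k1
  have k2' : a' * c = a * c' := by exact_mod_cast k2
  have k3 : (a' ^ 2 - a ^ 2) * D = 0 := by
    have : a' ^ 2 * D = a ^ 2 * D := by
      nth_rewrite 1 [← hd]; rw [← hd']
      linear_combination (a' * b + a * b') * k1' - 4 * a * a' * k2'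
    linear_combination this
  have k4 : a' = a := by
    rcases mul_eq_zero.1 k3 with h | h
    · nlinarith
    · omega
  subst k4
  have : b = b' := mul_left_cancel₀ ha.ne' k1'
  have : c = c' := mul_left_cancel₀ ha.ne' k2'
  simp [*]

lemma acts_den_ne {z : ℂ} (hz : 0 < z.im) (g : SL2Z) : (g.1 1 0 : ℂ) * z + (g.1 1 1 : ℂ) ≠ 0 := by
  intro h
  have h1 := congrArg Complex.im h
  have h2 := congrArg Complex.re h
  simp at h1 h2
  rcases h1 with h1 | h1
  · rw [h1] at h2; simp at h2
    have := sl_det g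
    rw [h1, h2] at this; simp at this
  · exact hz.ne' h1

lemma acts_im_pos {z : ℂ} (hz : 0 < z.im) (g : SL2Z) : 0 < (acts g z).im := by
  have hd := acts_den_ne hz g
  have hdet : (g.1 0 0 : ℝ) * g.1 1 1 - g.1 0 1 * g.1 1 0 = 1 := by exact_mod_cast sl_det g
  have : (acts g z).im = z.im / normSq ((g.1 1 0 : ℂ) * z + (g.1 1 1 : ℂ)) := by
    rw [acts, Complex.div_im]
    have hn : normSq ((g.1 1 0 : ℂ) * z + (g.1 1 1 : ℂ)) ≠ 0 := by simpa using hd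
    rw [← sub_div]
    congr 1
    simp
    linear_combination z.im * hdet
  rw [this]
  exact div_pos hz (normSq_pos.2 hd)

lemma isQRoot_acts {F : QF} {z : ℂ} (hz : IsQRoot F z) (g : SL2Z) : IsQRoot (qact g F) (acts g z) := by
  refine ⟨acts_im_pos hz.1 g, ?_⟩
  have hd := acts_den_ne hz.1 g
  have hdet : (g.1 0 0 : ℂ) * g.1 1 1 - g.1 0 1 * g.1 1 0 = 1 := by exact_mod_cast sl_det g
  obtain ⟨a, b, c⟩ := F
  obtain ⟨hz0, hz⟩ := hz
  simp only at hz
  simp only [acts, qact]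
  push_cast
  generalize hα : (g.1 0 0 : ℂ) = α at *
  generalize hα : (g.1 0 1 : ℂ) = β at *
  generalize hα : (g.1 1 0 : ℂ) = γ at *
  generalize hα : (g.1 1 1 : ℂ) = δ at *
  rw [div_pow]
  field_simp
  linear_combination (α * δ - β * γ)^2 * hz

lemma exists_qroot {D : ℤ} (hD : D < 0) {F : QF} (hF : IsQF D F) : ∃ z, IsQRoot F z := by
  obtain ⟨a, b, c⟩ := F
  obtain ⟨ha, hd⟩ := hF
  simp only at *
  have har : (0:ℝ) < a := by exact_mod_cast ha
  have hfr : (0:ℝ) < -D := by exact_mod_cast (by omega : 0 < -D)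
  refine ⟨⟨-b / (2 * a), √(-D) / (2 * a)⟩, by simp only; positivity, ?_⟩
  have hs : √(-D : ℝ) * √(-D) = -D := Real.mul_self_sqrt hfr.le
  have hd' : (b:ℝ) ^ 2 - 4 * a * c = D := by exact_mod_cast hd
  apply Complex.ext
  · simp [pow_two]
    field_simp
    linear_combination -hs - hd'
  · simp [pow_two]
    field_simp
    ring

lemma fund_mod4 {D : ℤ} (h : IsFundamentalDiscriminant D) : D % 4 = 0 ∨ D % 4 = 1 := by
  rcases h with h | h
  · exact Or.inr h.1
  · exact Or.inl h.1

/-- no odd prime square divides a fundamental discriminant -/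
lemma fund_sq {D : ℤ} (h : IsFundamentalDiscriminant D) {p : ℕ} (hp : p.Prime) (hp2 : p ≠ 2) :
    ¬ ((p : ℤ) ^ 2 ∣ D) := by
  intro hd
  have hpu : ¬ IsUnit (p : ℤ) := (Nat.prime_iff_prime_int.1 hp).not_isUnit
  rcases h with h | h
  · exact hpu (h.2 p (by rwa [← pow_two]))
  · obtain ⟨h1, h2, -⟩ := h
    have e : D = 4 * (D / 4) := by omega
    rw [e] at hd
    have hc : IsCoprime ((p : ℤ) ^ 2) 4 := by
      have : Nat.Coprime (p ^ 2) 4 := by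
        rw [show 4 = 2 ^ 2 by norm_num]
        exact Nat.Coprime.pow 2 2 ((Nat.coprime_primes hp Nat.prime_two).2 hp2)
      exact_mod_cast Nat.isCoprime_iff_coprime.2 this
    have := hc.dvd_of_dvd_mul_left hd
    exact hpu (h2 p (by rwa [← pow_two]))

lemma sq_mod4 (b : ℤ) : b ^ 2 % 4 = 0 ∨ b ^ 2 % 4 = 1 := by
  rcases Int.emod_two_eq_zero_or_one b with h | h
  · obtain ⟨k, rfl⟩ := Int.dvd_of_emod_eq_zero h
    left; ring_nf; omega
  · obtain ⟨k, rfl⟩ : ∃ k, b = 2 * k + 1 := ⟨b / 2, by omega⟩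
    right; ring_nf; omega

lemma fund_prim {D : ℤ} (h : IsFundamentalDiscriminant D) {a b c : ℤ} (hd : b ^ 2 - 4 * a * c = D) :
    Int.gcd (Int.gcd a b : ℤ) c = 1 := by
  by_contra hne
  obtain ⟨p, hp, hpd⟩ := Nat.exists_prime_and_dvd hne
  have h1 : (p : ℤ) ∣ Int.gcd (Int.gcd a b : ℤ) c := by exact_mod_cast hpd
  have hc : (p : ℤ) ∣ c := h1.trans (Int.gcd_dvd_right _ _)
  have hab := h1.trans (Int.gcd_dvd_left _ _)
  have ha : (p : ℤ) ∣ a := hab.trans (Int.gcd_dvd_left _ _)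
  have hb : (p : ℤ) ∣ b := hab.trans (Int.gcd_dvd_right _ _)
  obtain ⟨a', rfl⟩ := ha
  obtain ⟨b', rfl⟩ := hb
  obtain ⟨c', rfl⟩ := hc
  have e : D = (p : ℤ) ^ 2 * (b' ^ 2 - 4 * a' * c') := by rw [← hd]; ring
  by_cases hp2 : p = 2
  · subst hp2
    have e' : D = 4 * (b' ^ 2 - 4 * (a' * c')) := by rw [e]; push_cast; ring
    have hm := sq_mod4 b'
    rcases h with h | h
    · omega
    · obtain ⟨h1, -, h2⟩ := h
      omega
  · exact fund_sq h hp hp2 ⟨_, e⟩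

lemma stab_eqs {F : QF} {g : SL2Z} (h : qact g F = F) :
    F.1 * (g.1 1 1 - g.1 0 0) = g.1 1 0 * F.2.1 ∧ F.1 * g.1 0 1 = - g.1 1 0 * F.2.2 := by
  obtain ⟨a, b, c⟩ := F
  have hdet := sl_det g
  simp only [qact, Prod.mk.injEq] at h ⊢
  obtain ⟨h1, h2, h3⟩ := h
  generalize g.1 0 0 = α at *
  generalize g.1 0 1 = β at *
  generalize g.1 1 0 = γ at *
  generalize g.1 1 1 = δ at *
  constructor
  · have e1 : 2 * (a * (δ - α)) = 2 * (γ * b) := by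
      linear_combination 2 * α * h1 + γ * h2 - 2 * a * δ * hdet + γ * b * hdet
    linarith
  · have e1 : 2 * (a * β) = 2 * (-γ * c) := by
      linear_combination -2 * β * h1 - δ * h2 + δ * b * hdet - 2 * c * γ * hdet
    linarith

lemma prim_dvd {a b c x : ℤ} (hp : Int.gcd (Int.gcd a b : ℤ) c = 1) (h1 : a ∣ x * b) (h2 : a ∣ x * c) :
    a ∣ x := by
  have e1 := Int.gcd_eq_gcd_ab a b
  have e2 := Int.gcd_eq_gcd_ab (Int.gcd a b : ℤ) c
  rw [hp] at e2
  generalize Int.gcdA a b = s at *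
  generalize Int.gcdB a b = t at *
  generalize Int.gcdA (Int.gcd a b : ℤ) c = s' at *
  generalize Int.gcdB (Int.gcd a b : ℤ) c = t' at *
  rw [e1] at e2
  have : x = a * (x * s * s') + (x * b) * (t * s') + (x * c) * t' := by
    push_cast at e2
    linear_combination x * e2
  rw [this]
  exact dvd_add (dvd_add (dvd_mul_right _ _) (h1.mul_right _)) (h2.mul_right _)

def pellSet (D : ℤ) : Set (ℤ × ℤ) := {p | p.1 ^ 2 - D * p.2 ^ 2 = 4}

lemma stab_data {D : ℤ} (hfund : IsFundamentalDiscriminant D) {F : QF} (hF : IsQF D F)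
    {g : SL2Z} (h : qact g F = F) :
    ∃ u, g.1 1 0 = u * F.1 ∧ g.1 1 1 - g.1 0 0 = u * F.2.1 ∧ g.1 0 1 = - u * F.2.2 := by
  obtain ⟨e1, e2⟩ := stab_eqs h
  obtain ⟨a, b, c⟩ := F
  obtain ⟨ha, hd⟩ := hF
  simp only at *
  obtain ⟨u, hu⟩ := prim_dvd (fund_prim hfund hd) (Dvd.intro _ e1) (by
    refine ⟨-g.1 0 1, ?_⟩; linear_combination e2)
  refine ⟨u, by rw [hu]; ring, mul_left_cancel₀ ha.ne' ?_, mul_left_cancel₀ ha.ne' ?_⟩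
  · rw [e1, hu]; ring
  · rw [e2, hu]; ring

lemma stab_bij {D : ℤ} (hfund : IsFundamentalDiscriminant D) {F : QF} (hF : IsQF D F) :
    Nat.card {g : SL2Z // qact g F = F} = Nat.card (pellSet D) := by
  have hF' := hF
  obtain ⟨ha, hd⟩ := hF'
  have hmem : ∀ g : SL2Z, qact g F = F → (g.1 0 0 + g.1 1 1, g.1 1 0 / F.1) ∈ pellSet D := by
    intro g h
    obtain ⟨u, h1, h2, h3⟩ := stab_data hfund hF h
    have hdet := sl_det g
    simp only [pellSet, Set.mem_ofPred_eq]
    rw [h1, Int.mul_ediv_cancel _ ha.ne', ← hd]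
    rw [h1, h3] at hdet
    have : g.1 1 1 = u * F.2.1 + g.1 0 0 := by linarith
    rw [this] at hdet ⊢
    linear_combination 4 * hdet
  refine Nat.card_congr (Equiv.ofBijective
    (fun g => (⟨_, hmem g.1 g.2⟩ : pellSet D)) ⟨?_, ?_⟩)
  · rintro ⟨g, hg⟩ ⟨g', hg'⟩ heq
    simp only [Subtype.mk.injEq, Prod.mk.injEq] at heq
    obtain ⟨u, h1, h2, h3⟩ := stab_data hfund hF hg
    obtain ⟨u', h1', h2', h3'⟩ := stab_data hfund hF hg'
    obtain ⟨k1, k2⟩ := heq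
    rw [h1, h1', Int.mul_ediv_cancel _ ha.ne', Int.mul_ediv_cancel _ ha.ne'] at k2
    subst k2
    apply Subtype.ext
    apply Matrix.SpecialLinearGroup.ext
    intro i j
    fin_cases i <;> fin_cases j <;> simp only [Fin.zero_eta, Fin.mk_one, Fin.isValue]
    · linarith
    · linarith
    · linarith
    · linarith
  · rintro ⟨⟨t, u⟩, htu⟩
    simp only [pellSet, Set.mem_ofPred_eq] at htu
    obtain ⟨a, b, c⟩ := F
    simp only at ha hd
    have hpar : (2 : ℤ) ∣ t - u * b := by
      have : (2 : ℤ) ∣ (t - u * b) ^ 2 := by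
        refine ⟨2 - 2 * u ^ 2 * a * c - t * u * b + u ^ 2 * b ^ 2, ?_⟩
        rw [← hd] at htu
        linear_combination htu
      exact Int.prime_two.dvd_of_dvd_pow this
    obtain ⟨α, hα⟩ := hpar
    have ht : t = 2 * α + u * b := by linarith
    have hdet : α * (α + u * b) + u ^ 2 * a * c = 1 := by
      rw [ht, ← hd] at htu
      have : 4 * (α * (α + u * b) + u ^ 2 * a * c) = 4 * 1 := by linear_combination htu
      linarith
    refine ⟨⟨⟨!![α, -u * c; u * a, α + u * b], ?_⟩, ?_⟩, ?_⟩
    · rw [Matrix.det_fin_two_of]; linear_combination hdet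
    · simp only [qact, Prod.mk.injEq, Matrix.of_apply, Matrix.cons_val', Matrix.cons_val_zero, Matrix.cons_val_one,
        Matrix.cons_val_fin_one]
      refine ⟨?_, ?_, ?_⟩
      · linear_combination a * hdet
      · linear_combination b * hdet
      · linear_combination c * hdet
    · apply Subtype.ext
      simp only [Prod.mk.injEq, Matrix.of_apply, Matrix.cons_val', Matrix.cons_val_zero, Matrix.cons_val_one,
        Matrix.cons_val_fin_one]
      exact ⟨by linarith, Int.mul_ediv_cancel _ ha.ne'⟩

lemma pell_card {D : ℤ} (hD : D < 0) (h : D % 4 = 0 ∨ D % 4 = 1) : Nat.card (pellSet D) = wD D := by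
  have key : ∀ p : ℤ × ℤ, p ∈ pellSet D → -2 ≤ p.1 ∧ p.1 ≤ 2 ∧ -1 ≤ p.2 ∧ p.2 ≤ 1 ∧ (p.2 = 0 ∨ -4 ≤ D) := by
    rintro ⟨t, u⟩ hp
    simp only [pellSet, Set.mem_ofPred_eq] at hp ⊢
    have h3 : D ≤ -3 := by omega
    have hu2 : u ^ 2 ≤ 1 := by
      by_contra hc
      push Not at hc
      nlinarith [sq_nonneg t]
    have ht2 : t ^ 2 ≤ 4 := by nlinarith [sq_nonneg u]
    refine ⟨by nlinarith, by nlinarith, by nlinarith, by nlinarith, ?_⟩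
    by_cases hu : u = 0
    · exact Or.inl hu
    · right
      have : 0 < u ^ 2 := by positivity
      have : u ^ 2 = 1 := by omega
      rw [this] at hp
      nlinarith [sq_nonneg t]
  by_cases h3 : D = -3
  · have : pellSet D = ({(2,0),(-2,0),(1,1),(1,-1),(-1,1),(-1,-1)} : Finset (ℤ × ℤ)) := by
      ext ⟨t, u⟩
      constructor
      · intro hp
        obtain ⟨k1, k2, k3, k4, -⟩ := key _ hp
        simp only [pellSet, Set.mem_ofPred_eq, h3] at hp k1 k2 k3 k4
        interval_cases t <;> interval_cases u <;> simp_all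
      · intro hp
        simp at hp
        simp only [pellSet, Set.mem_ofPred_eq, h3]
        rcases hp with hp | hp | hp | hp | hp | hp <;> rw [hp.1, hp.2] <;> norm_num
    rw [this]; simp [wD, h3]
  by_cases h4 : D = -4
  · have : pellSet D = ({(2,0),(-2,0),(0,1),(0,-1)} : Finset (ℤ × ℤ)) := by
      ext ⟨t, u⟩
      constructor
      · intro hp
        obtain ⟨k1, k2, k3, k4, -⟩ := key _ hp
        simp only [pellSet, Set.mem_ofPred_eq, h4] at hp k1 k2 k3 k4
        interval_cases t <;> interval_cases u <;> simp_all
      · intro hp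
        simp at hp
        simp only [pellSet, Set.mem_ofPred_eq, h4]
        rcases hp with hp | hp | hp | hp <;> rw [hp.1, hp.2] <;> norm_num
    rw [this]; simp [wD, h4]
  · have : pellSet D = ({(2,0),(-2,0)} : Finset (ℤ × ℤ)) := by
      ext ⟨t, u⟩
      constructor
      · intro hp
        obtain ⟨k1, k2, k3, k4, k5⟩ := key _ hp
        have hu : u = 0 := by
          rcases k5 with k5 | k5
          · exact k5
          · omega
        subst hu
        simp only [pellSet, Set.mem_ofPred_eq] at hp k1 k2
        interval_cases t <;> simp_all
      · intro hp
        simp at hp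
        simp only [pellSet, Set.mem_ofPred_eq]
        rcases hp with hp | hp <;> rw [hp.1, hp.2] <;> norm_num
    rw [this]; simp [wD, h3, h4]

lemma stab_card {D : ℤ} (hD : D < 0) (hfund : IsFundamentalDiscriminant D) {F : QF} (hF : IsQF D F) :
    Nat.card {g : SL2Z // qact g F = F} = wD D := by
  rw [stab_bij hfund hF, pell_card hD (fund_mod4 hfund)]

open scoped ENNReal

/-- reduced-modulo-translation forms -/
def ZSet (D : ℤ) : Set QF := {F | IsQF D F ∧ D % 2 ≤ F.2.1 ∧ F.2.1 < D % 2 + 2 * F.1}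

def QV (F : QF) (v : ℤ × ℤ) : ℤ := F.1 * v.2 ^ 2 - F.2.1 * v.2 * v.1 + F.2.2 * v.1 ^ 2

def IsRepQF (D : ℤ) (RF : Set QF) : Prop :=
  (∀ F ∈ RF, IsQF D F) ∧ ∀ F', IsQF D F' → ∃! F, F ∈ RF ∧ ∃ g : SL2Z, F = qact g F'

def XSet (D : ℤ) (RF : Set QF) : Set (QF × SL2Z) := {p | p.1 ∈ RF ∧ qact p.2 p.1 ∈ ZSet D}

def YSet (RF : Set QF) : Set (QF × (ℤ × ℤ)) := {p | p.1 ∈ RF ∧ IsCoprime p.2.1 p.2.2}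

lemma mem_ZSet {D : ℤ} {F : QF} : F ∈ ZSet D ↔ IsQF D F ∧ D % 2 ≤ F.2.1 ∧ F.2.1 < D % 2 + 2 * F.1 := Iff.rfl

lemma qact_shift {g g' : SL2Z} {k : ℤ} (F : QF) (h0 : g'.1 0 0 = g.1 0 0 + k * g.1 1 0)
    (h1 : g'.1 0 1 = g.1 0 1 + k * g.1 1 1) (h2 : g'.1 1 0 = g.1 1 0) (h3 : g'.1 1 1 = g.1 1 1) :
    (qact g' F).1 = (qact g F).1 ∧ (qact g' F).2.1 = (qact g F).2.1 - 2 * k * (qact g F).1 := by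
  simp only [qact, h0, h1, h2, h3]
  refine ⟨trivial, ?_⟩
  ring

lemma XY_mem {D : ℤ} {RF : Set QF} (p : QF × SL2Z) (hp : p ∈ XSet D RF) :
    (p.1, (p.2.1 1 0, p.2.1 1 1)) ∈ YSet RF := by
  refine ⟨hp.1, ?_⟩
  have := sl_det p.2
  exact ⟨-p.2.1 0 1, p.2.1 0 0, by simp only; linear_combination this⟩

lemma XY_bij {D : ℤ} (hD : D < 0) {RF : Set QF} (hRF : IsRepQF D RF) :
    Function.Bijective (fun p : XSet D RF => (⟨_, XY_mem p.1 p.2⟩ : YSet RF)) := by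
  constructor
  · rintro ⟨⟨F, g⟩, hF, hg⟩ ⟨⟨F', g'⟩, hF', hg'⟩ h
    simp only [Subtype.mk.injEq, Prod.mk.injEq] at h
    obtain ⟨rfl, h2, h3⟩ := h
    simp only at hg hg' hF
    have d1 := sl_det g
    have d2 := sl_det g'
    rw [← h2, ← h3] at d2
    have k0 : g'.1 0 0 = g.1 0 0 + (-(g'.1 0 0) * g.1 0 1 + g'.1 0 1 * g.1 0 0) * g.1 1 0 := by
      linear_combination - g'.1 0 0 * d1 + g.1 0 0 * d2
    have k1 : g'.1 0 1 = g.1 0 1 + (-(g'.1 0 0) * g.1 0 1 + g'.1 0 1 * g.1 0 0) * g.1 1 1 := by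
      linear_combination - g'.1 0 1 * d1 + g.1 0 1 * d2
    obtain ⟨s1, s2⟩ := qact_shift F k0 k1 h2.symm h3.symm
    generalize (-(g'.1 0 0) * g.1 0 1 + g'.1 0 1 * g.1 0 0) = k at *
    obtain ⟨⟨m1, -⟩, m2, m3⟩ := hg
    obtain ⟨-, m4, m5⟩ := hg'
    rw [s1] at m5
    rw [s2] at m4 m5
    have hk : k = 0 := by
      have l1 : k < 1 := by nlinarith
      have l2 : -1 < k := by nlinarith
      omega
    subst hk
    simp only [zero_mul, add_zero] at k0 k1
    have : g = g' := by
      apply Matrix.SpecialLinearGroup.ext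
      intro i j
      fin_cases i <;> fin_cases j
      · exact k0.symm
      · exact k1.symm
      · exact h2
      · exact h3
    exact Subtype.ext (Prod.ext rfl this)
  · rintro ⟨⟨F, m, n⟩, hF, u, v, huv⟩
    simp only at hF huv
    have hdet : ∀ k : ℤ, (!![v + k * m, -u + k * n; m, n] : Matrix (Fin 2) (Fin 2) ℤ).det = 1 := by
      intro k; rw [Matrix.det_fin_two_of]; linear_combination huv
    set g : ℤ → SL2Z := fun k => ⟨_, hdet k⟩ with hg
    have hQ : ∀ k, IsQF D (qact (g k) F) := fun k => qact_isQF hD (hRF.1 F hF) (g k)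
    set b0 := (qact (g 0) F).2.1
    set a := (qact (g 0) F).1 with ha
    have ha0 : 0 < a := (hQ 0).1
    set k := (b0 - D % 2) / (2 * a) with hk
    obtain ⟨s1, s2⟩ := qact_shift (g := g 0) (g' := g k) (k := k) F (by simp [hg]) (by simp [hg]) (by simp [hg]) (by simp [hg])
    have e1 := Int.emod_add_mul_ediv (b0 - D % 2) (2 * a)
    have e2 := Int.emod_nonneg (b0 - D % 2) (by omega : 2 * a ≠ 0)
    have e3 := Int.emod_lt_of_pos (b0 - D % 2) (by omega : 0 < 2 * a)
    rw [← hk] at e1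
    refine ⟨⟨⟨F, g k⟩, hF, hQ k, ?_, ?_⟩, ?_⟩
    · rw [s2]
      change D % 2 ≤ b0 - 2 * k * a
      nlinarith
    · rw [s2, s1]
      change b0 - 2 * k * a < D % 2 + 2 * a
      nlinarith
    · apply Subtype.ext
      simp [hg]

lemma fiber_card {D : ℤ} (hD : D < 0) (hfund : IsFundamentalDiscriminant D) {RF : Set QF} (hRF : IsRepQF D RF)
    (F' : ZSet D) :
    Nat.card {x : XSet D RF // (⟨qact x.1.2 x.1.1, x.2.2⟩ : ZSet D) = F'} = wD D := by
  obtain ⟨F', hF'⟩ := F'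
  rw [← stab_card hD hfund hF'.1]
  obtain ⟨F0, ⟨h0, g0, hg0⟩, huniq⟩ := hRF.2 F' hF'.1
  have hinv : qact g0⁻¹ F0 = F' := by rw [hg0, qact_inv]
  symm
  have hm : ∀ g : {g : SL2Z // qact g F' = F'}, qact (g.1 * g0⁻¹) F0 = F' := fun g => by
    rw [qact_mul, hinv, g.2]
  refine Nat.card_congr (Equiv.ofBijective
    (fun g => ⟨⟨(F0, g.1 * g0⁻¹), h0, by rw [hm]; exact hF'⟩, Subtype.ext (hm g)⟩) ⟨?_, ?_⟩)
  · rintro ⟨g, hg⟩ ⟨g', hg'⟩ h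
    have h' := congrArg (fun x => x.1.1.2) h
    simp only [mul_left_inj] at h'
    exact Subtype.ext h'
  · rintro ⟨⟨⟨F, g⟩, hF, hg⟩, h⟩
    simp only [Subtype.mk.injEq] at h
    have e : F = F0 := huniq F ⟨hF, g⁻¹, by rw [← h, qact_inv]⟩
    subst e
    refine ⟨⟨g * g0, by rw [qact_mul, ← hg0, h]⟩, ?_⟩
    simp [mul_assoc]

lemma wD_ne (D : ℤ) : wD D ≠ 0 := by
  unfold wD; split_ifs <;> norm_num

lemma tsum_const_card {α : Type*} {w : ℕ} (hw : w ≠ 0) (h : Nat.card α = w) (c : ℝ≥0∞) :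
    ∑' _ : α, c = w * c := by
  have : Finite α := Nat.finite_of_card_ne_zero (by rw [h]; exact hw)
  have := Fintype.ofFinite α
  rw [tsum_fintype, Finset.sum_const, Finset.card_univ, ← Nat.card_eq_fintype_card, h, nsmul_eq_mul]

lemma tsum_fiber {α β : Type*} (f : α → β) (F : α → ℝ≥0∞) :
    ∑' x, F x = ∑' y, ∑' x : {x // f x = y}, F x.1 := by
  rw [← (Equiv.sigmaFiberEquiv f).tsum_eq]
  exact ENNReal.tsum_sigma (fun y (x : {x // f x = y}) => F x.1)

lemma tsum_Y {D : ℤ} (hD : D < 0) (hfund : IsFundamentalDiscriminant D) {RF : Set QF} (hRF : IsRepQF D RF)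
    (h : ℤ → ℝ≥0∞) :
    ∑' y : YSet RF, h (QV y.1.1 y.1.2) = wD D * ∑' F : ZSet D, h F.1.1 := by
  rw [← (Equiv.ofBijective _ (XY_bij hD hRF)).tsum_eq]
  set f : XSet D RF → ZSet D := fun x => ⟨qact x.1.2 x.1.1, x.2.2⟩ with hf
  rw [tsum_fiber f, ← ENNReal.tsum_mul_left]
  refine tsum_congr (fun F => ?_)
  rw [← tsum_const_card (wD_ne D) (fiber_card hD hfund hRF F)]
  refine tsum_congr (fun x => ?_)
  exact congrArg (fun G : ZSet D => h G.1.1) x.2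

/-- number of square roots of `D` modulo `4n`, modulo translations -/
def Srt (D : ℤ) (n : ℕ) : ℕ := if n = 0 then 0 else
  Nat.card {x : ZMod n // x ^ 2 + ((D % 2 : ℤ) : ZMod n) * x + (((D % 2 - D) / 4 : ℤ) : ZMod n) = 0}

lemma disc_aux {D : ℤ} (h : D % 4 = 0 ∨ D % 4 = 1) (x : ℤ) :
    (2 * x + D % 2) ^ 2 - 4 * (x ^ 2 + (D % 2) * x + (D % 2 - D) / 4) = D := by
  rcases h with h | h
  · have h2 : D % 2 = 0 := by omega
    rw [h2]
    have : 4 * ((0 - D) / 4) = -D := by omega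
    linear_combination -this
  · have h2 : D % 2 = 1 := by omega
    rw [h2]
    have : 4 * ((1 - D) / 4) = 1 - D := by omega
    linear_combination -this

lemma ZSet_fiber_card {D : ℤ} (h : D % 4 = 0 ∨ D % 4 = 1) (n : ℕ) :
    Nat.card {F : ZSet D // F.1.1.toNat = n} = Srt D n := by
  unfold Srt
  split_ifs with hn
  · have : IsEmpty {F : ZSet D // F.1.1.toNat = n} := by
      refine ⟨?_⟩
      rintro ⟨F, h2⟩
      have h1 := F.2.1.1
      omega
    exact Nat.card_of_isEmpty
  have : NeZero n := ⟨hn⟩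
  have hb : ∀ F : ZSet D, F.1.2.1 = 2 * ((F.1.2.1 - D % 2) / 2) + D % 2 := by
    rintro ⟨⟨a, b, c⟩, ⟨h1, h2⟩, h3⟩
    simp only at *
    have : b % 2 = D % 2 := by
      have := sq_mod4 b
      rcases Int.emod_two_eq_zero_or_one b with hb | hb
      · obtain ⟨k, rfl⟩ := Int.dvd_of_emod_eq_zero hb
        have : D = 4 * (k ^ 2 - a * c) := by rw [← h2]; ring
        omega
      · obtain ⟨k, rfl⟩ : ∃ k, b = 2 * k + 1 := ⟨b / 2, by omega⟩
        have : D = 4 * (k ^ 2 + k - a * c) + 1 := by rw [← h2]; ring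
        omega
    omega
  have hP : ∀ F : ZSet D, (((F.1.2.1 - D % 2) / 2) ^ 2 + (D % 2) * ((F.1.2.1 - D % 2) / 2) + (D % 2 - D) / 4) =
      F.1.1 * F.1.2.2 := by
    intro F
    have h1 := disc_aux h ((F.1.2.1 - D % 2) / 2)
    rw [← hb F] at h1
    have h2 := F.2.1.2
    generalize ((F.1.2.1 - D % 2) / 2) ^ 2 + (D % 2) * ((F.1.2.1 - D % 2) / 2) + (D % 2 - D) / 4 = P at *
    linarith
  have hx : ∀ F : ZSet D, 0 ≤ (F.1.2.1 - D % 2) / 2 ∧ (F.1.2.1 - D % 2) / 2 < F.1.1 := by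
    intro F
    have h1 := hb F
    have h2 := F.2.2
    omega
  have ha : ∀ F : {F : ZSet D // F.1.1.toNat = n}, F.1.1.1 = n := by
    rintro ⟨F, hF⟩
    have h1 := F.2.1.1
    simp only
    omega
  refine Nat.card_congr (Equiv.ofBijective
    (fun F => ⟨(((F.1.1.2.1 - D % 2) / 2 : ℤ) : ZMod n), ?_⟩) ⟨?_, ?_⟩)
  · have := congrArg (Int.cast : ℤ → ZMod n) (hP F.1)
    rw [ha F] at this
    push_cast at this
    simpa using this
  · intro F G hFG
    simp only [Subtype.mk.injEq] at hFG
    rw [ZMod.intCast_eq_intCast_iff_dvd_sub] at hFG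
    have f1 := hx F.1
    have g1 := hx G.1
    have f2 := hb F.1
    have g2 := hb G.1
    have f3 := F.1.2.1.2
    have g3 := G.1.2.1.2
    rw [ha F] at f1 f3
    rw [ha G] at g1 g3
    have hz := Int.eq_zero_of_abs_lt_dvd hFG (by rw [abs_lt]; constructor <;> linarith)
    have e1 : F.1.1.2.1 = G.1.1.2.1 := by omega
    have e2 : F.1.1.2.2 = G.1.1.2.2 := by
      rw [e1] at f3
      have : (n : ℤ) * F.1.1.2.2 = n * G.1.1.2.2 := by linarith
      exact mul_left_cancel₀ (by exact_mod_cast hn) this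
    apply Subtype.ext; apply Subtype.ext
    exact Prod.ext (by rw [ha, ha]) (Prod.ext e1 e2)
  · rintro ⟨x, hx⟩
    set X : ℤ := (x.val : ℤ) with hX
    have hXx : ((X : ℤ) : ZMod n) = x := by simp [hX]
    have hd : (n : ℤ) ∣ X ^ 2 + (D % 2) * X + (D % 2 - D) / 4 := by
      rw [← ZMod.intCast_zmod_eq_zero_iff_dvd]
      push_cast
      rw [hXx]; exact_mod_cast hx
    obtain ⟨c, hc⟩ := hd
    have hdisc := disc_aux h X
    have hXn : X < n := by rw [hX]; exact_mod_cast ZMod.val_lt x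
    have hX0 : 0 ≤ X := by positivity
    refine ⟨⟨⟨((n : ℤ), 2 * X + D % 2, c), ⟨?_, ?_⟩, ?_, ?_⟩, ?_⟩, ?_⟩
    · simp only; exact_mod_cast Nat.pos_of_ne_zero hn
    · simp only; rw [hc] at hdisc; linarith
    · simp only; linarith
    · simp only; linarith
    · simp
    · apply Subtype.ext
      simp only [add_sub_cancel_right]
      rw [Int.mul_ediv_cancel_left _ (by norm_num), hXx]

lemma tsum_const_card' {α : Type*} [Finite α] {w : ℕ} (h : Nat.card α = w) (c : ℝ≥0∞) :
    ∑' _ : α, c = w * c := by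
  have := Fintype.ofFinite α
  rw [tsum_fintype, Finset.sum_const, Finset.card_univ, ← Nat.card_eq_fintype_card, h, nsmul_eq_mul]

lemma ZSet_finite {D : ℤ} (n : ℕ) : Finite {F : ZSet D // F.1.1.toNat = n} := by
  have : Set.Finite ((Set.Icc (-(n:ℤ)) n) ×ˢ (Set.Icc (D % 2) (D % 2 + 2 * n))) :=
    (Set.finite_Icc _ _).prod (Set.finite_Icc _ _)
  have := this.to_subtype
  refine Finite.of_injective (β := ↥((Set.Icc (-(n:ℤ)) n) ×ˢ (Set.Icc (D % 2) (D % 2 + 2 * n))))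
    (fun F => ⟨(F.1.1.1, F.1.1.2.1), ?_⟩) ?_
  · have h1 := F.1.2.1.1
    have h2 := F.1.2.2
    have h3 := F.2
    simp only [Set.mem_prod, Set.mem_Icc]
    omega
  · intro F G h
    have h1 := congrArg (fun x => x.1.1) h
    have h2 := congrArg (fun x => x.1.2) h
    simp only at h1 h2
    have f3 := F.1.2.1.2
    have g3 := G.1.2.1.2
    rw [← h1, ← h2] at g3
    have : F.1.1.1 * F.1.1.2.2 = F.1.1.1 * G.1.1.2.2 := by linarith
    have h3 := mul_left_cancel₀ F.1.2.1.1.ne' this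
    apply Subtype.ext; apply Subtype.ext
    exact Prod.ext h1 (Prod.ext h2 h3)

lemma tsum_Z {D : ℤ} (h : D % 4 = 0 ∨ D % 4 = 1) (f : ℤ → ℝ≥0∞) :
    ∑' F : ZSet D, f F.1.1 = ∑' n : ℕ, (Srt D n : ℝ≥0∞) * f n := by
  rw [tsum_fiber (fun F : ZSet D => F.1.1.toNat)]
  refine tsum_congr (fun n => ?_)
  have := ZSet_finite (D := D) n
  rw [← tsum_const_card' (ZSet_fiber_card h n)]
  refine tsum_congr (fun F => ?_)
  have h1 := F.1.2.1.1
  have h2 := F.2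
  congr 1
  omega

lemma tsum_gcd (f : ℤ × ℤ → ℝ≥0∞) (h0 : f 0 = 0) (φ : ℕ → ℝ≥0∞) (hφ0 : φ 0 = 0)
    (hφ : ∀ (g : ℕ) v, g ≠ 0 → f ((g : ℤ) * v.1, (g : ℤ) * v.2) = φ g * f v) :
    ∑' v, f v = (∑' g : ℕ, φ g) * ∑' v : {v : ℤ × ℤ // IsCoprime v.1 v.2}, f v.1 := by
  rw [tsum_fiber (fun v : ℤ × ℤ => Int.gcd v.1 v.2), ← ENNReal.tsum_mul_right]
  refine tsum_congr (fun g => ?_)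
  by_cases hg : g = 0
  · subst hg
    rw [hφ0, zero_mul, ENNReal.tsum_eq_zero]
    rintro ⟨⟨m, n⟩, hv⟩
    simp only [Int.gcd_eq_zero_iff] at hv
    obtain ⟨rfl, rfl⟩ := hv
    exact h0
  · rw [← ENNReal.tsum_mul_left]
    have hgz : (g : ℤ) ≠ 0 := by exact_mod_cast hg
    have hm : ∀ v : {v : ℤ × ℤ // IsCoprime v.1 v.2}, Int.gcd ((g : ℤ) * v.1.1) ((g : ℤ) * v.1.2) = g := by
      rintro ⟨v, hv⟩
      rw [Int.gcd_mul_left, Int.isCoprime_iff_gcd_eq_one.1 hv]; simp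
    rw [← (Equiv.ofBijective (fun v : {v : ℤ × ℤ // IsCoprime v.1 v.2} =>
      (⟨((g : ℤ) * v.1.1, (g : ℤ) * v.1.2), hm v⟩ : {v : ℤ × ℤ // Int.gcd v.1 v.2 = g})) ⟨?_, ?_⟩).tsum_eq]
    · exact tsum_congr (fun v => hφ g v.1 hg)
    · rintro ⟨⟨m, n⟩, h⟩ ⟨⟨m', n'⟩, h'⟩ he
      simpa [hg] using he
    · rintro ⟨⟨m, n⟩, h⟩
      simp only at h
      have h1 : (g : ℤ) ∣ m := h ▸ Int.gcd_dvd_left m n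
      have h2 : (g : ℤ) ∣ n := h ▸ Int.gcd_dvd_right m n
      obtain ⟨m', rfl⟩ := h1
      obtain ⟨n', rfl⟩ := h2
      refine ⟨⟨(m', n'), ?_⟩, rfl⟩
      rw [Int.isCoprime_iff_gcd_eq_one]
      rw [Int.gcd_mul_left] at h
      simp only [Int.natAbs_natCast] at h
      exact Nat.eq_of_mul_eq_mul_left (Nat.pos_of_ne_zero hg) (by rw [h, mul_one])

def hpw (σ : ℝ) (k : ℤ) : ℝ≥0∞ := ENNReal.ofReal ((1 / (k : ℝ)) ^ σ)

lemma tsum_all {D : ℤ} (hD : D < 0) (hfund : IsFundamentalDiscriminant D) {RF : Set QF} (hRF : IsRepQF D RF)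
    {σ : ℝ} (hσ : 1 < σ) :
    ∑' F : RF, ∑' v : ℤ × ℤ, hpw σ (QV F.1 v) =
      wD D * ((∑' g : ℕ, hpw σ (g ^ 2)) * ∑' n : ℕ, (Srt D n : ℝ≥0∞) * hpw σ n) := by
  have z0 : hpw σ 0 = 0 := by
    simp [hpw, Real.zero_rpow (by linarith : σ ≠ 0)]
  have h1 : ∀ F : RF, ∑' v : ℤ × ℤ, hpw σ (QV F.1 v) = (∑' g : ℕ, hpw σ (g ^ 2)) *
      ∑' v : {v : ℤ × ℤ // IsCoprime v.1 v.2}, hpw σ (QV F.1 v.1) := by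
    intro F
    refine tsum_gcd _ (by simpa [QV] using z0) _ (by simpa using z0) (fun g v hg => ?_)
    have : QV F.1 ((g : ℤ) * v.1, (g : ℤ) * v.2) = (g : ℤ) ^ 2 * QV F.1 v := by simp only [QV]; ring
    rw [this, hpw, hpw, hpw, ← ENNReal.ofReal_mul (by positivity)]
    push_cast
    have hQ : (0:ℝ) ≤ QV F.1 v := by
      by_cases hv : v.1 = 0 ∧ v.2 = 0
      · simp [QV, hv.1, hv.2]
      · have := hRF.1 F.1 F.2
        exact_mod_cast (posdef_aux this.1 hD this.2 _ _ hv).le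
    rw [← Real.mul_rpow (by positivity) (by positivity)]
    congr 2
    rw [one_div_mul_one_div]
  simp_rw [h1]
  rw [ENNReal.tsum_mul_left, ← tsum_Z (fund_mod4 hfund) (hpw σ), mul_left_comm, ← tsum_Y hD hfund hRF]
  congr 1
  rw [← ENNReal.tsum_sigma (fun (F : RF) (v : {v : ℤ × ℤ // IsCoprime v.1 v.2}) => hpw σ (QV F.1 v.1))]
  rw [← (Equiv.ofBijective (fun p : (Σ _ : RF, {v : ℤ × ℤ // IsCoprime v.1 v.2}) =>
    (⟨(p.1.1, p.2.1), p.1.2, p.2.2⟩ : YSet RF)) ⟨?_, ?_⟩).tsum_eq]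
  · rfl
  · rintro ⟨⟨F, hF⟩, ⟨v, hv⟩⟩ ⟨⟨F', hF'⟩, ⟨v', hv'⟩⟩ h
    have h1 := congrArg (fun x => x.1.1) h
    have h2 := congrArg (fun x => x.1.2) h
    simp only at h1 h2
    subst h1 h2
    rfl
  · rintro ⟨⟨F, v⟩, hF, hv⟩
    exact ⟨⟨⟨F, hF⟩, ⟨v, hv⟩⟩, rfl⟩

def Rts (e k : ℤ) (R : Type*) [CommRing R] : Type _ := {x : R // x ^ 2 + (e : R) * x + (k : R) = 0}

lemma Rts_congr (e k : ℤ) {R S : Type*} [CommRing R] [CommRing S] (f : R ≃+* S) :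
    Nat.card (Rts e k R) = Nat.card (Rts e k S) := by
  refine Nat.card_congr (Equiv.subtypeEquiv f.toEquiv (fun x => ?_))
  change _ ↔ (f x) ^ 2 + (e : S) * f x + (k : S) = 0
  rw [← map_eq_zero_iff f f.injective]
  simp

lemma Rts_prod (e k : ℤ) (R S : Type*) [CommRing R] [CommRing S] :
    Nat.card (Rts e k (R × S)) = Nat.card (Rts e k R) * Nat.card (Rts e k S) := by
  rw [← Nat.card_prod]
  refine Nat.card_congr ⟨fun x => (⟨x.1.1, (Prod.ext_iff.1 x.2).1⟩, ⟨x.1.2, (Prod.ext_iff.1 x.2).2⟩),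
    fun y => ⟨(y.1.1, y.2.1), Prod.ext y.1.2 y.2.2⟩, fun x => rfl, fun y => rfl⟩

lemma Srt_eq {D : ℤ} {n : ℕ} (hn : n ≠ 0) : Srt D n = Nat.card (Rts (D % 2) ((D % 2 - D) / 4) (ZMod n)) := by
  rw [Srt, if_neg hn]; rfl

lemma Srt_mul (D : ℤ) {m n : ℕ} (h : Nat.Coprime m n) : Srt D (m * n) = Srt D m * Srt D n := by
  by_cases hm : m = 0
  · subst hm; simp [Srt]
  by_cases hn : n = 0
  · subst hn; simp [Srt]
  rw [Srt_eq (mul_ne_zero hm hn), Srt_eq hm, Srt_eq hn, ← Rts_prod]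
  exact Rts_congr _ _ (ZMod.chineseRemainder h)

lemma Srt_one (D : ℤ) : Srt D 1 = 1 := by
  rw [Srt_eq one_ne_zero]
  have : Unique (Rts (D % 2) ((D % 2 - D) / 4) (ZMod 1)) :=
    ⟨⟨⟨0, Subsingleton.elim _ _⟩⟩, fun x => Subtype.ext (Subsingleton.elim _ _)⟩
  exact Nat.card_unique

/-- roots modulo `n` as integers -/
lemma intRoot {n : ℕ} {e k : ℤ} (x : ℤ) : ((x : ℤ) : ZMod n) ^ 2 + (e : ZMod n) * (x : ZMod n) + (k : ZMod n) = 0 ↔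
    (n : ℤ) ∣ x ^ 2 + e * x + k := by
  rw [← ZMod.intCast_zmod_eq_zero_iff_dvd]; push_cast; rfl

lemma Srt_prime_two {D : ℤ} (h : D % 4 = 0 ∨ D % 4 = 1) : (Srt D 2 : ℤ) = 1 + kron D 2 := by
  rw [Srt_eq two_ne_zero, kron_two]
  unfold Rts kron2
  have hk : ∀ a : ℤ, ((a : ℤ) : ZMod 2) = if a % 2 = 0 then 0 else 1 := by
    intro a
    split_ifs with ha
    · rw [ZMod.intCast_zmod_eq_zero_iff_dvd]; omega
    · have : ((a : ℤ) : ZMod 2) = ((1 : ℤ) : ZMod 2) := by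
        rw [ZMod.intCast_eq_intCast_iff_dvd_sub]; omega
      simpa using this
  rw [hk, hk]
  rcases h with h | h
  · have h1 : D % 2 = 0 := by omega
    rw [h1]
    simp only [EuclideanDomain.zero_mod, ite_true]
    split_ifs <;> rw [Nat.card_eq_fintype_card] <;> decide
  · have h1 : D % 2 = 1 := by omega
    rw [h1]
    rw [if_neg (by norm_num : ¬ ((1:ℤ) % 2 = 0)), if_neg (by norm_num : ¬ ((1:ℤ) = 0))]
    by_cases h8 : D % 8 = 1
    · rw [if_pos (by omega), if_pos (by omega), Nat.card_eq_fintype_card]; decide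
    · rw [if_neg (by omega), if_neg (by omega), Nat.card_eq_fintype_card]; decide

lemma Srt_prime_odd {D : ℤ} (h : D % 4 = 0 ∨ D % 4 = 1) {p : ℕ} (hp : p.Prime) (hp2 : p ≠ 2) :
    (Srt D p : ℤ) = 1 + kron D p := by
  have : Fact p.Prime := ⟨hp⟩
  have hodd : Odd p := hp.odd_of_ne_two hp2
  rw [Srt_eq hp.ne_zero, kron_odd D hodd, ← jacobiSym.legendreSym.to_jacobiSym, add_comm, ← legendreSym.card_sqrts p hp2]
  have e0 : ((D % 2 : ℤ) : ZMod p) ^ 2 - 4 * (((D % 2 - D) / 4 : ℤ) : ZMod p) = (D : ZMod p) := by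
    have := congrArg (Int.cast : ℤ → ZMod p) (disc_aux h 0)
    push_cast at this
    push_cast
    rw [← this]; ring
  have h2 : (2 : ZMod p) ≠ 0 := by
    intro h2
    have : ((2 : ℕ) : ZMod p) = 0 := by exact_mod_cast h2
    rw [ZMod.natCast_eq_zero_iff] at this
    exact hp2 ((Nat.prime_dvd_prime_iff_eq hp Nat.prime_two).1 this)
  have hc : Nat.card (Rts (D % 2) ((D % 2 - D) / 4) (ZMod p)) = Nat.card {x : ZMod p // x ^ 2 = (D : ZMod p)} := by
    refine Nat.card_congr (Equiv.ofBijective (fun x => ⟨2 * x.1 + ((D % 2 : ℤ) : ZMod p), ?_⟩) ⟨?_, ?_⟩)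
    · rw [← e0]
      linear_combination 4 * x.2
    · intro x y hxy
      have := congrArg Subtype.val hxy
      simp only [add_left_inj] at this
      exact Subtype.ext (mul_left_cancel₀ h2 this)
    · rintro ⟨y, hy⟩
      refine ⟨⟨(y - ((D % 2 : ℤ) : ZMod p)) / 2, ?_⟩, ?_⟩
      · rw [← e0] at hy
        have h4 : (4 : ZMod p) ≠ 0 := by
          have : (4 : ZMod p) = 2 * 2 := by norm_num
          rw [this]; exact mul_ne_zero h2 h2
        have hq : (2 : ZMod p) * ((y - ((D % 2 : ℤ) : ZMod p)) / 2) = y - ((D % 2 : ℤ) : ZMod p) := mul_div_cancel₀ _ h2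
        generalize (y - ((D % 2 : ℤ) : ZMod p)) / 2 = t at *
        have hy' : y = 2 * t + ((D % 2 : ℤ) : ZMod p) := by rw [hq]; ring
        rw [hy'] at hy
        apply mul_left_cancel₀ h4
        linear_combination hy
      · apply Subtype.ext
        simp only
        rw [mul_div_cancel₀ _ h2]; ring
  rw [hc, Set.toFinset_card, Nat.card_eq_fintype_card]
  norm_cast

lemma Srt_prime {D : ℤ} (h : D % 4 = 0 ∨ D % 4 = 1) {p : ℕ} (hp : p.Prime) :
    (Srt D p : ℤ) = 1 + kron D p := by
  by_cases hp2 : p = 2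
  · subst hp2; exact Srt_prime_two h
  · exact Srt_prime_odd h hp hp2

lemma hensel_lift {p : ℕ} (hp : p.Prime) {e k x : ℤ} (hx : (p : ℤ) ∣ x ^ 2 + e * x + k)
    (hc : IsCoprime (2 * x + e) (p : ℤ)) (j : ℕ) :
    ∃ y, (p : ℤ) ∣ y - x ∧ (p : ℤ) ^ (j + 1) ∣ y ^ 2 + e * y + k := by
  induction j with
  | zero => exact ⟨x, by simp, by simpa using hx⟩
  | succ j ih =>
    obtain ⟨y, ⟨q, hq⟩, ⟨r, hr⟩⟩ := ih
    have hc' : IsCoprime (2 * y + e) (p : ℤ) := by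
      have : 2 * y + e = (2 * x + e) + (p : ℤ) * (2 * q) := by linear_combination 2 * hq
      rw [this]
      exact IsCoprime.add_mul_right_left hc (2 * q) |> fun h => by simpa [mul_comm] using h
    obtain ⟨u, v, huv⟩ := hc'
    refine ⟨y + p ^ (j + 1) * (-(u * r)), ?_, ?_⟩
    · refine ⟨q + p ^ j * (-(u * r)), ?_⟩
      rw [pow_succ]; linear_combination hq
    · refine ⟨v * r + p ^ j * (u * r) ^ 2, ?_⟩
      have e1 : (y + (p:ℤ) ^ (j + 1) * (-(u * r))) ^ 2 + e * (y + p ^ (j + 1) * (-(u * r))) + k =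
          (p:ℤ) ^ (j + 1) * r - p ^ (j + 1) * (u * r) * (2 * y + e) + p ^ (j + 1) * p ^ (j+1) * (u * r) ^ 2 := by
        rw [← hr]; ring
      rw [e1]
      rw [pow_succ _ (j+1), pow_succ _ j]
      linear_combination (-(p:ℤ) ^ j * p * r) * huv

lemma root_coprime {D : ℤ} (h : D % 4 = 0 ∨ D % 4 = 1) {p : ℕ} (hp : p.Prime) (hpD : ¬ (p : ℤ) ∣ D) {x : ℤ}
    (hx : (p : ℤ) ∣ x ^ 2 + (D % 2) * x + (D % 2 - D) / 4) : IsCoprime (2 * x + D % 2) (p : ℤ) := by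
  rw [isCoprime_comm, (Nat.prime_iff_prime_int.1 hp).coprime_iff_not_dvd]
  intro hd
  apply hpD
  rw [← disc_aux h x]
  exact dvd_sub (dvd_pow hd two_ne_zero) (hx.mul_left _)

lemma Srt_pow {D : ℤ} (h : D % 4 = 0 ∨ D % 4 = 1) {p : ℕ} (hp : p.Prime) (hpD : ¬ (p : ℤ) ∣ D) (j : ℕ) :
    Srt D (p ^ (j + 1)) = Srt D p := by
  have hpj : p ^ (j + 1) ≠ 0 := pow_ne_zero _ hp.ne_zero
  have : NeZero p := ⟨hp.ne_zero⟩
  have : NeZero (p ^ (j + 1)) := ⟨hpj⟩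
  have hdiv : p ∣ p ^ (j + 1) := dvd_pow_self p (by omega)
  have hdivz : (p : ℤ) ∣ (p : ℤ) ^ (j + 1) := dvd_pow_self _ (by omega)
  rw [Srt_eq hpj, Srt_eq hp.ne_zero]
  set f := ZMod.castHom hdiv (ZMod p) with hf
  have hroot : ∀ x : Rts (D % 2) ((D % 2 - D) / 4) (ZMod (p ^ (j + 1))),
      (f x.1) ^ 2 + ((D % 2 : ℤ) : ZMod p) * f x.1 + (((D % 2 - D) / 4 : ℤ) : ZMod p) = 0 := by
    intro x
    have := congrArg f x.2
    rw [map_zero] at this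
    rw [← this]
    simp only [map_add, map_mul, map_pow, map_intCast]
  refine Nat.card_congr (Equiv.ofBijective (fun x => ⟨f x.1, hroot x⟩) ⟨?_, ?_⟩)
  · rintro ⟨x, hx⟩ ⟨y, hy⟩ hxy
    have hxy' : f x = f y := congrArg Subtype.val hxy
    obtain ⟨x, rfl⟩ := ZMod.intCast_surjective x
    obtain ⟨y, rfl⟩ := ZMod.intCast_surjective y
    rw [intRoot] at hx hy
    rw [map_intCast, map_intCast, ZMod.intCast_eq_intCast_iff_dvd_sub] at hxy'
    apply Subtype.ext
    simp only
    rw [ZMod.intCast_eq_intCast_iff_dvd_sub]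
    push_cast at hx hy ⊢
    have hc := root_coprime h hp hpD (hdivz.trans hx)
    have hc2 : IsCoprime (x + y + D % 2) (p : ℤ) := by
      obtain ⟨q, hq⟩ := hxy'
      have : x + y + D % 2 = (2 * x + D % 2) + q * (p : ℤ) := by linear_combination hq
      rw [this]
      exact IsCoprime.add_mul_right_left hc q
    have hd : (p : ℤ) ^ (j + 1) ∣ (x + y + D % 2) * (y - x) := by
      have := dvd_sub hy hx
      convert! this using 1
      ring
    exact (hc2.symm.pow_left).dvd_of_dvd_mul_left hd
  · rintro ⟨x, hx⟩
    obtain ⟨x, rfl⟩ := ZMod.intCast_surjective x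
    rw [intRoot] at hx
    obtain ⟨y, hy1, hy2⟩ := hensel_lift hp hx (root_coprime h hp hpD hx) j
    refine ⟨⟨(y : ZMod (p ^ (j + 1))), ?_⟩, ?_⟩
    · rw [intRoot]; push_cast; exact hy2
    · apply Subtype.ext
      simp only [map_intCast]
      rw [eq_comm, ZMod.intCast_eq_intCast_iff_dvd_sub]
      exact hy1

lemma Srt_pow_dvd {D : ℤ} (h : IsFundamentalDiscriminant D) {p : ℕ} (hp : p.Prime) (hpD : (p : ℤ) ∣ D) (j : ℕ) :
    Srt D (p ^ (j + 2)) = 0 := by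
  have hpj : p ^ (j + 2) ≠ 0 := pow_ne_zero _ hp.ne_zero
  rw [Srt_eq hpj]
  have : IsEmpty (Rts (D % 2) ((D % 2 - D) / 4) (ZMod (p ^ (j + 2)))) := by
    refine ⟨?_⟩
    rintro ⟨x, hx⟩
    obtain ⟨x, rfl⟩ := ZMod.intCast_surjective x
    rw [intRoot] at hx
    push_cast at hx
    have hx2 : (p : ℤ) ^ 2 ∣ x ^ 2 + D % 2 * x + (D % 2 - D) / 4 := (pow_dvd_pow _ (by omega)).trans hx
    by_cases hp2 : p = 2
    · subst hp2
      rcases h with h | ⟨h1, -, h3⟩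
      · have := h.1; push_cast at hpD; omega
      · have e : D % 2 = 0 := by omega
        rw [e] at hx2
        push_cast at hx2
        have := sq_mod4 x
        omega
    · apply fund_sq h hp hp2
      have hpp := Nat.prime_iff_prime_int.1 hp
      have hx1 : (p : ℤ) ∣ x ^ 2 + D % 2 * x + (D % 2 - D) / 4 := (dvd_pow_self _ two_ne_zero).trans hx2
      have e := disc_aux (fund_mod4 h) x
      have : (p : ℤ) ∣ (2 * x + D % 2) ^ 2 := by
        rw [sub_eq_iff_eq_add.1 e]
        exact dvd_add hpD (hx1.mul_left _)
      have := hpp.dvd_of_dvd_pow this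
      rw [← e]
      exact dvd_sub (pow_dvd_pow_of_dvd this 2) (hx2.mul_left _)
  exact Nat.card_of_isEmpty

lemma kron_prime_dvd {D : ℤ} {p : ℕ} (hp : p.Prime) (hpD : (p : ℤ) ∣ D) : kron D p = 0 := by
  by_cases hp2 : p = 2
  · subst hp2
    rw [kron_two, kron2, if_pos (by push_cast at hpD; omega)]
  · have : Fact p.Prime := ⟨hp⟩
    rw [kron_odd D (hp.odd_of_ne_two hp2), ← jacobiSym.legendreSym.to_jacobiSym, legendreSym.eq_zero_iff,
      ZMod.intCast_zmod_eq_zero_iff_dvd]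
    exact hpD

lemma kron_prime_not_dvd {D : ℤ} {p : ℕ} (hp : p.Prime) (hpD : ¬ (p : ℤ) ∣ D) : kron D p = 1 ∨ kron D p = -1 := by
  by_cases hp2 : p = 2
  · subst hp2
    rw [kron_two, kron2, if_neg (by push_cast at hpD; omega)]
    split_ifs <;> simp
  · have : Fact p.Prime := ⟨hp⟩
    rw [kron_odd D (hp.odd_of_ne_two hp2), ← jacobiSym.legendreSym.to_jacobiSym]
    apply legendreSym.eq_one_or_neg_one
    rw [Ne, ZMod.intCast_zmod_eq_zero_iff_dvd]
    exact hpD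

lemma Srt_prime_pow {D : ℤ} (h : IsFundamentalDiscriminant D) {p : ℕ} (hp : p.Prime) (j : ℕ) :
    (Srt D (p ^ (j + 2)) : ℤ) = kron D p ^ (j + 2) + kron D p ^ (j + 1) := by
  by_cases hpD : (p : ℤ) ∣ D
  · rw [Srt_pow_dvd h hp hpD, kron_prime_dvd hp hpD]; simp
  · rw [Srt_pow (fund_mod4 h) hp hpD (j + 1), Srt_prime (fund_mod4 h) hp]
    rcases kron_prime_not_dvd hp hpD with h | h <;> rw [h]
    · simp
    · ring

open Classical in
def sqA : ArithmeticFunction ℂ := ⟨fun n => if n ≠ 0 ∧ IsSquare n then 1 else 0, by simp⟩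

def SA (D : ℤ) : ArithmeticFunction ℂ := ⟨fun n => (Srt D n : ℂ), by simp [Srt]⟩

def KA (D : ℤ) : ArithmeticFunction ℂ := ⟨fun n => if n = 0 then 0 else (kron D n : ℂ), by simp⟩

open Classical in
lemma sqA_apply (n : ℕ) : sqA n = if n ≠ 0 ∧ IsSquare n then 1 else 0 := rfl

lemma SA_apply (D : ℤ) (n : ℕ) : SA D n = (Srt D n : ℂ) := rfl

lemma KA_apply (D : ℤ) {n : ℕ} (hn : n ≠ 0) : KA D n = (kron D n : ℂ) := if_neg hn

lemma sq_left_of_coprime {m n : ℕ} (h : m.Coprime n) (hs : IsSquare (m * n)) : IsSquare m := by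
  obtain ⟨r, hr⟩ := hs
  rw [← pow_two] at hr
  obtain ⟨d, hd⟩ := exists_eq_pow_of_mul_eq_pow (by rw [Nat.isUnit_iff]; exact h) hr
  exact ⟨d, by rw [hd, pow_two]⟩

lemma sqA_mult : sqA.IsMultiplicative := by
  rw [ArithmeticFunction.IsMultiplicative.iff_ne_zero]
  refine ⟨by simp [sqA_apply], fun {m n} hm hn h => ?_⟩
  simp only [sqA_apply, hm, hn, ne_eq, mul_eq_zero, or_self, not_false_eq_true, true_and]
  by_cases h1 : IsSquare m
  · by_cases h2 : IsSquare n
    · simp [h1, h2, IsSquare.mul]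
    · have : ¬ IsSquare (m * n) := fun hs => h2 (sq_left_of_coprime h.symm (by rwa [mul_comm]))
      simp [h2, this]
  · have : ¬ IsSquare (m * n) := fun hs => h1 (sq_left_of_coprime h hs)
    simp [h1, this]

lemma SA_mult (D : ℤ) : (SA D).IsMultiplicative := by
  refine ⟨by simp [SA_apply, Srt_one], fun {m n} h => ?_⟩
  simp [SA_apply, Srt_mul D h]

lemma KA_mult (D : ℤ) : (KA D).IsMultiplicative := by
  rw [ArithmeticFunction.IsMultiplicative.iff_ne_zero]
  refine ⟨by simp [KA_apply, kron_one], fun {m n} hm hn h => ?_⟩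
  rw [KA_apply D (mul_ne_zero hm hn), KA_apply D hm, KA_apply D hn, kron_mul D hm hn]; push_cast; rfl

lemma isSquare_prime_pow {p : ℕ} (hp : p.Prime) (i : ℕ) : IsSquare (p ^ i) ↔ Even i := by
  constructor
  · rintro ⟨r, hr⟩
    obtain ⟨k, -, rfl⟩ := (Nat.dvd_prime_pow hp).1 (Dvd.intro _ hr.symm)
    rw [← pow_add] at hr
    exact ⟨k, Nat.pow_right_injective hp.two_le hr⟩
  · rintro ⟨k, rfl⟩
    exact ⟨p ^ k, by rw [pow_add]⟩

lemma sqA_prime_pow {p : ℕ} (hp : p.Prime) (i : ℕ) : sqA (p ^ i) = if Even i then 1 else 0 := by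
  rw [sqA_apply]
  simp [isSquare_prime_pow hp, hp.ne_zero]

lemma conv_prime_pow (f g : ArithmeticFunction ℂ) {p : ℕ} (hp : p.Prime) (i : ℕ) :
    (f * g) (p ^ i) = ∑ k ∈ Finset.range (i + 1), f (p ^ k) * g (p ^ (i - k)) := by
  rw [ArithmeticFunction.mul_apply, Nat.sum_divisorsAntidiagonal (fun a b => f a * g b), Nat.sum_divisors_prime_pow hp]
  refine Finset.sum_congr rfl (fun k hk => ?_)
  rw [Finset.mem_range] at hk
  rw [Nat.pow_div (by omega) hp.pos]

lemma comb_aux (s : ℕ → ℂ) (χ : ℂ) (h0 : s 0 = 1) (h1 : s 1 = 1 + χ) (h2 : ∀ j, s (j + 2) = χ ^ (j + 2) + χ ^ (j + 1))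
    (i : ℕ) : (∑ k ∈ Finset.range (i + 1), (if Even k then (1:ℂ) else 0) * s (i - k)) = ∑ k ∈ Finset.range (i + 1), χ ^ k := by
  induction i using Nat.strong_induction_on with
  | _ i ih =>
    match i with
    | 0 => rw [Finset.sum_range_one, Finset.sum_range_one]; simp [h0]
    | 1 => simp [Finset.sum_range_succ, h1]
    | (j + 2) =>
      rw [Finset.sum_range_succ', Finset.sum_range_succ']
      have := ih j (by omega)
      have e : ∀ k, j + 2 - (k + 1 + 1) = j - k := fun k => by omega
      simp only [e, Nat.even_add_one, not_not, Nat.even_add_one]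
      rw [this, Finset.sum_range_succ _ (j + 2), Finset.sum_range_succ _ (j + 1)]
      simp [h2]
      ring

lemma conv_identity {D : ℤ} (h : IsFundamentalDiscriminant D) :
    sqA * SA D = (ArithmeticFunction.zeta : ArithmeticFunction ℂ) * KA D := by
  rw [ArithmeticFunction.IsMultiplicative.eq_iff_eq_on_prime_powers _ (sqA_mult.mul (SA_mult D)) _
    (ArithmeticFunction.isMultiplicative_zeta.natCast.mul (KA_mult D))]
  intro p i hp
  rw [conv_prime_pow _ _ hp, conv_prime_pow _ _ hp]
  simp only [sqA_prime_pow hp]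
  rw [comb_aux (fun j => SA D (p ^ j)) (kron D p)]
  · rw [← Finset.sum_range_reflect]
    refine Finset.sum_congr rfl (fun k hk => ?_)
    rw [KA_apply D (pow_ne_zero _ hp.ne_zero), kron_pow D hp.ne_zero]
    simp [hp.ne_zero]
  · simp [SA_apply, Srt_one]
  · have := Srt_prime (fund_mod4 h) hp
    simp only [SA_apply, pow_one]
    exact_mod_cast this
  · intro j
    have := Srt_prime_pow h hp j
    simp only [SA_apply]
    exact_mod_cast this

lemma zK_L {D : ℤ} (hD : D < 0) (h : IsFundamentalDiscriminant D) [NeZero D.natAbs] {s : ℂ} (hs : 1 < s.re) :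
    LSeriesSummable (fun n => KA D n) s ∧ LSeries (fun n => KA D n) s = ZMod.LFunction (PsiD D) s := by
  have e : ∀ {n : ℕ}, n ≠ 0 → KA D n = PsiD D (n : ZMod D.natAbs) := fun {n} hn => by
    rw [KA_apply D hn, PsiD_natCast hD (fund_mod4 h) hn]
  refine ⟨(LSeriesSummable_congr s e).2 (ZMod.LSeriesSummable_of_one_lt_re _ hs), ?_⟩
  rw [ZMod.LFunction_eq_LSeries _ hs]
  exact LSeries_congr e s

lemma SA_le {D : ℤ} (h : IsFundamentalDiscriminant D) (n : ℕ) :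
    ‖SA D n‖ ≤ ‖((ArithmeticFunction.zeta : ArithmeticFunction ℂ) * KA D) n‖ := by
  by_cases hn : n = 0
  · subst hn; simp
  rw [← conv_identity h, ArithmeticFunction.mul_apply]
  have hr : ∀ x : ℕ × ℕ, ∃ c : ℕ, sqA x.1 * SA D x.2 = (c : ℂ) := by
    intro x
    rw [sqA_apply, SA_apply]
    split_ifs
    · exact ⟨Srt D x.2, by simp⟩
    · exact ⟨0, by simp⟩
  choose c hc using hr
  simp_rw [hc]
  rw [← Nat.cast_sum, Complex.norm_natCast, SA_apply, Complex.norm_natCast]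
  have hmem : (1, n) ∈ n.divisorsAntidiagonal := by simp [hn]
  have := Finset.single_le_sum (f := c) (fun i _ => Nat.zero_le _) hmem
  have hc1 := hc (1, n)
  simp [sqA_apply, SA_apply] at hc1
  rw [hc1]
  exact_mod_cast this

lemma LSeries_identity {D : ℤ} (hD : D < 0) (h : IsFundamentalDiscriminant D) [NeZero D.natAbs] {s : ℂ} (hs : 1 < s.re) :
    LSeriesSummable (fun n => sqA n) s ∧ LSeriesSummable (fun n => SA D n) s ∧
    LSeries (fun n => sqA n) s * LSeries (fun n => SA D n) s = riemannZeta s * ZMod.LFunction (PsiD D) s := by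
  have hz : LSeriesSummable (fun n => (ArithmeticFunction.zeta : ArithmeticFunction ℂ) n) s :=
    ArithmeticFunction.LSeriesSummable_zeta_iff.2 hs
  obtain ⟨hK, hKL⟩ := zK_L hD h hs
  have hsum := ArithmeticFunction.LSeriesSummable_mul hz hK
  have hS : LSeriesSummable (fun n => SA D n) s := by
    refine Summable.of_norm_bounded hsum.norm (fun n => ?_)
    exact LSeries.norm_term_le s (SA_le h n)
  have hsq : LSeriesSummable (fun n => sqA n) s := by
    refine LSeriesSummable_of_bounded_of_one_lt_re (m := 1) (fun n _ => ?_) hs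
    rw [sqA_apply]; split_ifs <;> simp
  refine ⟨hsq, hS, ?_⟩
  rw [← ArithmeticFunction.LSeries_mul' hsq hS, conv_identity h, ArithmeticFunction.LSeries_mul' hz hK, hKL]
  congr 1
  exact ArithmeticFunction.LSeries_zeta_eq_riemannZeta hs

def RFset (D : ℤ) (R : Finset ℂ) : Set QF := {F | IsQF D F ∧ ∃ z ∈ R, IsQRoot F z}

lemma isCM_of_root {D : ℤ} (hfund : IsFundamentalDiscriminant D) {F : QF} (hF : IsQF D F) {z : ℂ}
    (hz : IsQRoot F z) : IsCMPoint D z :=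
  ⟨hz.1, F.1, F.2.1, F.2.2, hF.1, fund_prim hfund hF.2, hF.2, hz.2⟩

lemma form_of_CM {D : ℤ} {z : ℂ} (hz : IsCMPoint D z) : ∃ F, IsQF D F ∧ IsQRoot F z := by
  obtain ⟨h1, a, b, c, ha, -, hd, hr⟩ := hz
  exact ⟨(a, b, c), ⟨ha, hd⟩, ⟨h1, hr⟩⟩

lemma RFset_rep {D : ℤ} (hD : D < 0) (hfund : IsFundamentalDiscriminant D) {R : Finset ℂ} (hR : IsRepSet D R) :
    IsRepQF D (RFset D R) := by
  refine ⟨fun F hF => hF.1, fun F' hF' => ?_⟩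
  obtain ⟨z', hz'⟩ := exists_qroot hD hF'
  obtain ⟨w, ⟨hwR, g, hg⟩, huniq⟩ := hR.2 z' (isCM_of_root hfund hF' hz')
  refine ⟨qact g F', ⟨⟨qact_isQF hD hF' g, w, hwR, ?_⟩, g, rfl⟩, ?_⟩
  · rw [hg]; exact isQRoot_acts hz' g
  · rintro G ⟨⟨hG, z, hzR, hz⟩, g', hg'⟩
    have e : z = acts g' z' := by
      refine isQRoot_unique hG hz ?_
      rw [hg']; exact isQRoot_acts hz' g'
    have e2 : z = w := huniq z ⟨hzR, g', e⟩
    refine isQRoot_form_unique hD hG (qact_isQF hD hF' g) hz ?_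
    rw [e2, hg]; exact isQRoot_acts hz' g

lemma term_eq {D : ℤ} (hD : D < 0) {F : QF} (hF : IsQF D F) {z : ℂ} (hz : IsQRoot F z) (σ : ℝ) (v : ℤ × ℤ) :
    (2 / √(D.natAbs : ℝ)) ^ σ * etermR z σ v = (1 / (QV F v : ℝ)) ^ σ := by
  obtain ⟨e1, e2⟩ := isQRoot_re_im hz
  have hz0 := hz.1
  obtain ⟨a, b, c⟩ := F
  obtain ⟨m, n⟩ := v
  obtain ⟨ha, hd⟩ := hF
  simp only at *
  have har : (0:ℝ) < a := by exact_mod_cast ha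
  have hfD : (D.natAbs : ℝ) = -(D : ℝ) := by
    have : (D.natAbs : ℤ) = -D := by omega
    rw [← Int.cast_natCast, this]; push_cast; rfl
  have hd' : (b:ℝ) ^ 2 - 4 * a * c = D := by exact_mod_cast hd
  have hs : √(D.natAbs : ℝ) = 2 * a * z.im := by
    rw [Real.sqrt_eq_iff_mul_self_eq (by positivity) (by positivity), hfD, ← hd']
    rw [normSq_apply] at e2
    linear_combination -(4 * a * e2) + (2 * a * z.re - b) * e1
  have hQ : (QV (a, b, c) (m, n) : ℝ) = a * normSq (m * z + n) := by
    rw [normSq_lin]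
    rw [normSq_apply] at e2
    simp only [QV]
    push_cast
    linear_combination - m ^ 2 * e2 - n * m * e1
  unfold etermR
  rw [hs, hQ, ← Real.mul_rpow (by positivity) (div_nonneg hz0.le (normSq_nonneg _))]
  congr 1
  by_cases h0 : normSq (m * z + n) = 0
  · simp [h0]
  · field_simp

lemma LSeries_sq {σ : ℝ} (hσ : 1 < σ) (hs : LSeriesSummable (fun n => sqA n) σ) :
    Summable (fun g : ℕ => (1 / ((g : ℝ) ^ 2)) ^ σ) ∧
    LSeries (fun n => sqA n) σ = ((∑' g : ℕ, (1 / ((g : ℝ) ^ 2)) ^ σ : ℝ) : ℂ) := by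
  have hinj : Function.Injective (fun g : ℕ => g ^ 2) := Nat.pow_left_injective two_ne_zero
  have ht : ∀ g : ℕ, LSeries.term (fun n => sqA n) σ (g ^ 2) = (((1 / ((g : ℝ) ^ 2)) ^ σ : ℝ) : ℂ) := by
    intro g
    by_cases hg : g = 0
    · subst hg
      simp [Real.zero_rpow (by linarith : σ ≠ 0)]
    · rw [LSeries.term_of_ne_zero (pow_ne_zero 2 hg), sqA_apply, if_pos ⟨pow_ne_zero 2 hg, ⟨g, pow_two g⟩⟩]
      rw [Complex.ofReal_cpow (by positivity), one_div ((g : ℝ) ^ 2), Complex.ofReal_inv, Complex.inv_cpow]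
      · push_cast; rw [one_div]
      · rw [Complex.arg_ofReal_of_nonneg (by positivity)]; exact Real.pi_pos.ne
  constructor
  · have := hs.comp_injective hinj
    rw [← Complex.summable_ofReal]
    exact this.congr ht
  · rw [Complex.ofReal_tsum, LSeries, ← hinj.tsum_eq]
    · exact tsum_congr ht
    · intro n hn
      rw [Function.mem_support] at hn
      by_contra hc
      apply hn
      by_cases h0 : n = 0
      · subst h0; simp
      · rw [LSeries.term_of_ne_zero h0, sqA_apply, if_neg, zero_div]
        rintro ⟨-, r, hr⟩
        exact hc ⟨r, by rw [hr]; exact pow_two r⟩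

lemma LSeries_S {D : ℤ} {σ : ℝ} (hσ : 1 < σ) (hs : LSeriesSummable (fun n => SA D n) σ) :
    Summable (fun n : ℕ => (Srt D n : ℝ) * (1 / (n : ℝ)) ^ σ) ∧
    LSeries (fun n => SA D n) σ = ((∑' n : ℕ, (Srt D n : ℝ) * (1 / (n : ℝ)) ^ σ : ℝ) : ℂ) := by
  have ht : ∀ n : ℕ, LSeries.term (fun n => SA D n) σ n = (((Srt D n : ℝ) * (1 / (n : ℝ)) ^ σ : ℝ) : ℂ) := by
    intro g
    by_cases hg : g = 0
    · subst hg
      simp [Srt]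
    · rw [LSeries.term_of_ne_zero hg, SA_apply, Complex.ofReal_mul]
      rw [Complex.ofReal_cpow (by positivity), one_div, Complex.ofReal_inv, Complex.inv_cpow]
      · push_cast; rw [div_eq_mul_inv]
      · rw [Complex.arg_ofReal_of_nonneg (by positivity)]; exact Real.pi_pos.ne
  constructor
  · rw [← Complex.summable_ofReal]
    exact hs.congr ht
  · rw [Complex.ofReal_tsum, LSeries]
    exact tsum_congr ht

lemma hC_main {D : ℤ} (hD : D < 0) (hfund : IsFundamentalDiscriminant D) [NeZero D.natAbs] {R : Finset ℂ}
    (hR : IsRepSet D R) (σ : ℝ) (hσ : 1 < σ) :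
    ∑ z ∈ R, ((2 / √(D.natAbs : ℝ) : ℝ) : ℂ) ^ (σ : ℂ) * Ecal z σ =
      wD D * riemannZeta σ * ZMod.LFunction (PsiD D) σ := by
  have hs : 1 < (σ : ℂ).re := by simpa using hσ
  obtain ⟨h1, h2, h3⟩ := LSeries_identity hD hfund hs
  obtain ⟨s1, e1⟩ := LSeries_sq hσ h1
  obtain ⟨s2, e2⟩ := LSeries_S hσ h2
  rw [mul_assoc, ← h3, e1, e2]
  have hRF := RFset_rep hD hfund hR
  have hall := tsum_all hD hfund hRF hσ
  -- the bijection between points and forms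
  have hex : ∀ z : R, ∃ F, IsQF D F ∧ IsQRoot F z.1 := fun z => form_of_CM (hR.1 z.1 z.2)
  choose φ hφ1 hφ2 using hex
  have hbij : Function.Bijective (fun z : R => (⟨φ z, hφ1 z, z.1, z.2, hφ2 z⟩ : RFset D R)) := by
    constructor
    · intro z w h
      have h' : φ z = φ w := congrArg Subtype.val h
      apply Subtype.ext
      refine isQRoot_unique (hφ1 z) (hφ2 z) ?_
      rw [h']; exact hφ2 w
    · rintro ⟨F, hF, z, hzR, hz⟩
      refine ⟨⟨z, hzR⟩, Subtype.ext ?_⟩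
      exact isQRoot_form_unique hD (hφ1 _) hF (hφ2 _) hz
  rw [← (Equiv.ofBijective _ hbij).tsum_eq] at hall
  set c : ℝ := 2 / √(D.natAbs : ℝ) with hc
  have hc0 : 0 ≤ c := by positivity
  have hterm : ∀ z : R, ∑' v : ℤ × ℤ, hpw σ (QV (φ z) v) = ENNReal.ofReal (c ^ σ * ∑' v, etermR z σ v) := by
    intro z
    have hpos := (hφ2 z).1
    rw [← tsum_mul_left, ENNReal.ofReal_tsum_of_nonneg]
    · refine tsum_congr (fun v => ?_)
      rw [term_eq hD (hφ1 z) (hφ2 z)]; rfl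
    · intro v
      refine mul_nonneg (by positivity) (Real.rpow_nonneg (div_nonneg hpos.le (normSq_nonneg _)) _)
    · exact (etermR_summable hpos hσ).mul_left _
  have hnn : ∀ z : R, 0 ≤ c ^ σ * ∑' v, etermR z σ v := by
    intro z
    have hpos := (hφ2 z).1
    exact mul_nonneg (by positivity) (tsum_nonneg (fun v => Real.rpow_nonneg (div_nonneg hpos.le (normSq_nonneg _)) _))
  have hL : ∑' z : R, ∑' v : ℤ × ℤ, hpw σ (QV (φ z) v) = ENNReal.ofReal (∑ z ∈ R, c ^ σ * ∑' v, etermR z σ v) := by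
    simp_rw [hterm]
    rw [tsum_fintype, ← ENNReal.ofReal_sum_of_nonneg (fun z _ => hnn z)]
    congr 1
    exact Finset.sum_coe_sort R (fun z => c ^ σ * ∑' v, etermR z σ v)
  have hZ : ∑' g : ℕ, hpw σ (g ^ 2) = ENNReal.ofReal (∑' g : ℕ, (1 / ((g : ℝ) ^ 2)) ^ σ) := by
    rw [ENNReal.ofReal_tsum_of_nonneg (fun g => by positivity) s1]
    refine tsum_congr (fun g => ?_)
    rw [hpw]; push_cast; rfl
  have hS : ∑' n : ℕ, (Srt D n : ℝ≥0∞) * hpw σ n = ENNReal.ofReal (∑' n : ℕ, (Srt D n : ℝ) * (1 / (n : ℝ)) ^ σ) := by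
    rw [ENNReal.ofReal_tsum_of_nonneg (fun g => by positivity) s2]
    refine tsum_congr (fun g => ?_)
    rw [hpw, ENNReal.ofReal_mul (by positivity), ENNReal.ofReal_natCast]; push_cast; rfl
  have hall' : ∑' z : R, ∑' v : ℤ × ℤ, hpw σ (QV (φ z) v) = _ := hall
  rw [hL, hZ, hS] at hall'
  have n1 : 0 ≤ ∑' g : ℕ, (1 / ((g : ℝ) ^ 2)) ^ σ := tsum_nonneg (fun g => by positivity)
  have n2 : 0 ≤ ∑' n : ℕ, (Srt D n : ℝ) * (1 / (n : ℝ)) ^ σ := tsum_nonneg (fun g => by positivity)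
  rw [← ENNReal.ofReal_mul n1, ← ENNReal.ofReal_natCast, ← ENNReal.ofReal_mul (by positivity),
    ENNReal.ofReal_eq_ofReal_iff (Finset.sum_nonneg (fun z hz => hnn ⟨z, hz⟩)) (by positivity)] at hall'
  have hfin := congrArg (Complex.ofReal) hall'
  push_cast at hfin ⊢
  rw [← hfin]
  refine Finset.sum_congr rfl (fun z hz => ?_)
  rw [Complex.ofReal_cpow hc0]
  congr 1
  rw [← Complex.ofReal_tsum]
  rw [Complex.ofReal_tsum]
  exact (Ecal_hasSum (hR.1 z hz).1 hσ).tsum_eq.symm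

def qsetoid : Setoid QF where
  r F G := ∃ g : SL2Z, G = qact g F
  iseqv := ⟨fun F => ⟨1, (qact_one F).symm⟩,
    fun {F G} ⟨g, h⟩ => ⟨g⁻¹, by rw [h, qact_inv]⟩,
    fun {F G H} ⟨g, h⟩ ⟨g', h'⟩ => ⟨g' * g, by rw [h', h, qact_mul]⟩⟩

/-- a canonical representative of the orbit of a form -/
def qrep (F : QF) : QF := (Quotient.mk qsetoid F).out

lemma qrep_rel (F : QF) : ∃ g : SL2Z, qrep F = qact g F := by
  have h : qsetoid.r (qrep F) F := Quotient.mk_out (s := qsetoid) F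
  exact qsetoid.iseqv.symm h

lemma qrep_eq {F G : QF} (h : ∃ g : SL2Z, G = qact g F) : qrep F = qrep G := by
  unfold qrep
  have : Quotient.mk qsetoid F = Quotient.mk qsetoid G := Quotient.sound (s := qsetoid) h
  rw [this]

def redSet (D : ℤ) : Set QF := {F | IsQF D F ∧ |F.2.1| ≤ F.1 ∧ F.1 ≤ F.2.2}

lemma redSet_finite (D : ℤ) : (redSet D).Finite := by
  refine Set.Finite.subset (Set.finite_Icc ((0, -|D|, 0) : QF) (|D|, |D|, |D|)) ?_
  rintro ⟨a, b, c⟩ ⟨⟨ha, hd⟩, hb, hc⟩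
  simp only at ha hd hb hc
  have hD : -D ≤ |D| := neg_le_abs D
  have hb2 : b ^ 2 ≤ a ^ 2 := sq_le_sq' (by linarith [abs_le.1 hb]) (abs_le.1 hb).2
  have h3 : 3 * (a * c) ≤ |D| := by nlinarith
  have hc1 : c ≤ |D| := by nlinarith
  have ha1 : a ≤ |D| := by linarith
  rw [abs_le] at hb
  simp only [Set.mem_Icc, Prod.mk_le_mk]
  refine ⟨⟨?_, ?_, ?_⟩, ?_, ?_, ?_⟩ <;> linarith

def matT (k : ℤ) : SL2Z := ⟨!![1, k; 0, 1], by simp [Matrix.det_fin_two]⟩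
def matS : SL2Z := ⟨!![0, -1; 1, 0], by simp [Matrix.det_fin_two]⟩

lemma qact_T (k : ℤ) (F : QF) : (qact (matT k) F).1 = F.1 ∧ (qact (matT k) F).2.1 = F.2.1 - 2 * F.1 * k := by
  constructor <;> simp [qact, matT] <;> ring

lemma qact_S (F : QF) : (qact matS F).1 = F.2.2 := by
  simp [qact, matS]

lemma exists_red {D : ℤ} (hD : D < 0) {F : QF} (hF : IsQF D F) : ∃ g : SL2Z, qact g F ∈ redSet D := by
  have hex : ∃ n : ℕ, ∃ g : SL2Z, (qact g F).1 = n :=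
    ⟨F.1.toNat, 1, by rw [qact_one, Int.toNat_of_nonneg hF.1.le]⟩
  classical
  obtain ⟨g, hg⟩ := Nat.find_spec hex
  set G := qact g F with hG
  have hGq : IsQF D G := qact_isQF hD hF g
  have hmin : ∀ h : SL2Z, G.1 ≤ (qact h F).1 := by
    intro h
    have hp := (qact_isQF hD hF h).1
    rw [hg, ← Int.toNat_of_nonneg hp.le]
    exact_mod_cast Nat.find_min' hex ⟨h, (Int.toNat_of_nonneg hp.le).symm⟩
  -- translate so that the middle coefficient is small
  obtain ⟨k, hk⟩ : ∃ k : ℤ, |G.2.1 - 2 * G.1 * k| ≤ G.1 := by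
    have ha := hGq.1
    refine ⟨(G.2.1 + G.1) / (2 * G.1), ?_⟩
    have h1 := Int.emod_add_mul_ediv (G.2.1 + G.1) (2 * G.1)
    have h2 := Int.emod_nonneg (G.2.1 + G.1) (by linarith : 2 * G.1 ≠ 0)
    have h3 := Int.emod_lt_of_pos (G.2.1 + G.1) (by linarith : 0 < 2 * G.1)
    rw [abs_le]
    constructor <;> linarith
  obtain ⟨t1, t2⟩ := qact_T k G
  refine ⟨matT k * g, ?_⟩
  rw [qact_mul, ← hG]
  refine ⟨qact_isQF hD hGq _, ?_, ?_⟩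
  · rw [t1, t2]; exact hk
  · rw [t1, ← qact_S, hG, ← qact_mul, ← qact_mul]
    exact hmin _

open Classical in
/-- the root in the upper half plane of a form -/
def qroot (F : QF) : ℂ := if h : ∃ z, IsQRoot F z then h.choose else 0

lemma qroot_spec {D : ℤ} (hD : D < 0) {F : QF} (hF : IsQF D F) : IsQRoot F (qroot F) := by
  unfold qroot
  rw [dif_pos (exists_qroot hD hF)]
  exact (exists_qroot hD hF).choose_spec

lemma exists_repset {D : ℤ} (hD : D < 0) (hfund : IsFundamentalDiscriminant D) :
    ∃ R : Finset ℂ, IsRepSet D R := by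
  classical
  have hrq : ∀ F, IsQF D F → IsQF D (qrep F) := by
    intro F hF
    obtain ⟨g, hg⟩ := qrep_rel F
    rw [hg]; exact qact_isQF hD hF g
  refine ⟨(redSet_finite D).toFinset.image (fun F => qroot (qrep F)), ?_, ?_⟩
  · intro z hz
    rw [Finset.mem_image] at hz
    obtain ⟨F, hF, rfl⟩ := hz
    rw [Set.Finite.mem_toFinset] at hF
    exact isCM_of_root hfund (hrq F hF.1) (qroot_spec hD (hrq F hF.1))
  · intro z hz
    obtain ⟨F, hF, hFz⟩ := form_of_CM hz
    obtain ⟨g, hg⟩ := exists_red hD hF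
    obtain ⟨g1, hg1⟩ := qrep_rel F
    have e1 : qrep F = qrep (qact g F) := qrep_eq ⟨g, rfl⟩
    refine ⟨qroot (qrep F), ⟨?_, g1, ?_⟩, ?_⟩
    · rw [Finset.mem_image]
      exact ⟨qact g F, (Set.Finite.mem_toFinset _).2 hg, by rw [e1]⟩
    · refine isQRoot_unique (hrq F hF) (qroot_spec hD (hrq F hF)) ?_
      rw [hg1]; exact isQRoot_acts hFz g1
    · rintro w ⟨hw, g2, hg2⟩
      rw [Finset.mem_image] at hw
      obtain ⟨G, hG, rfl⟩ := hw
      rw [Set.Finite.mem_toFinset] at hG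
      have e2 : qrep G = qact g2 F := by
        refine isQRoot_form_unique hD (hrq G hG.1) (qact_isQF hD hF g2) (qroot_spec hD (hrq G hG.1)) ?_
        rw [hg2]; exact isQRoot_acts hFz g2
      obtain ⟨g3, hg3⟩ := qrep_rel G
      have e3 : qrep F = qrep G := by
        refine qrep_eq ⟨g3⁻¹ * g2, ?_⟩
        rw [qact_mul, ← e2, hg3, qact_inv]
      simp only [e3]

/-- **Chowla–Selberg formula.** For `D < 0` a fundamental discriminant, `PSL(2,ℤ)` acts
on the CM points of discriminant `D` with finitely many orbits, and for any set `R`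
of orbit representatives,
`∏_{z ∈ R} (4π√|D| Φ(z))^{2/w(D)} = ∏_{j=1}^{|D|−1} Γ(j/|D|)^{χ_D(j)}`. -/
theorem chowla_selberg (D : ℤ) (hD : D < 0) (hfund : IsFundamentalDiscriminant D) :
    (∃ R : Finset ℂ, IsRepSet D R) ∧
    ∀ R : Finset ℂ, IsRepSet D R →
      ∏ z ∈ R, (4 * Real.pi * Real.sqrt |(D : ℝ)| * Phi z) ^ ((2 : ℝ) / (wD D : ℝ)) =
        ∏ j ∈ Finset.Icc 1 (D.natAbs - 1),
          Real.Gamma ((j : ℝ) / (D.natAbs : ℝ)) ^ (kron D j) := by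
  haveI : NeZero D.natAbs := ⟨by omega⟩
  exact ⟨exists_repset hD hfund, fun R hR => final_step hD (fund_mod4 hfund) R (fun z hz => (hR.1 z hz).1)
    (wD D) (wD_ne D) (fun σ hσ => hC_main hD hfund hR σ hσ)⟩
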